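/- Let M = M_1 *_B M_2 be an amalgamated free product of σ-finite von Neumann algebras. If B is a semifinite von Neumann algebra, and M_1 is amenable and of type III, then M_1 is maximal amenable with expectation inside M: whenever Q ⊆ M is an amenable von Neumann subalgebra with expectation satisfying M_1 ⊆ Q, one has Q = M_1. -/

import Mathlib

/- Framework: von Neumann algebras are modeled concretely as `VonNeumannAlgebra H` for a
complex Hilbert space `H` (in the relevant statements, `H` plays the role of the standard
form Hilbert space `L²(M)`).  Conditional expectations, normality (complete additivity,
phrased via preservation of suprema of upward-directed sets in the Loewner order),
faithfulness, σ-finiteness, standard forms, Jones basic constructions `⟨M, Q⟩ = (JQJ)'`,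
amalgamated free products, Popa's intertwining relation `A ≼_M B` and relative amenability
are all defined below. -/

open scoped InnerProductSpace ComplexOrder

noncomputable section

namespace AFP

variable {H : Type*} [NormedAddCommGroup H] [InnerProductSpace ℂ H] [CompleteSpace H]

abbrev BH (H : Type*) [NormedAddCommGroup H] [InnerProductSpace ℂ H] [CompleteSpace H] :=
  H →L[ℂ] H

/-- A (self-adjoint) projection in `B(H)`. -/
def IsProjection (p : BH H) : Prop := IsSelfAdjoint p ∧ IsIdempotentElem p

/-- A map defined (at least) on `N ⊆ B(H)` is *normal* on `N` if it preserves suprema of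
upward-directed subsets of `N` (with respect to the Loewner order on `B(H)`). -/
def IsNormalOn (N : Set (BH H)) (Φ : BH H → BH H) : Prop :=
  ∀ S : Set (BH H), S ⊆ N → S.Nonempty → DirectedOn (· ≤ ·) S →
    ∀ x ∈ N, IsLUB S x → IsLUB (Φ '' S) (Φ x)

/-- A complex-valued functional is normal on `N` if it preserves suprema of upward-directed
subsets of `N` (using the standard partial order on `ℂ`). -/
def IsNormalFunctionalOn (N : Set (BH H)) (φ : BH H → ℂ) : Prop :=
  ∀ S : Set (BH H), S ⊆ N → S.Nonempty → DirectedOn (· ≤ ·) S →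
    ∀ x ∈ N, IsLUB S x → IsLUB (φ '' S) (φ x)

/-- A map is faithful on `N` if it kills no nonzero positive element of `N`. -/
def FaithfulOn (N : Set (BH H)) (Φ : BH H → BH H) : Prop :=
  ∀ x ∈ N, 0 ≤ x → Φ x = 0 → x = 0

/-- A conditional expectation from `N` onto `P ⊆ N` (as subsets of `B(H)`):
a unital positive `P`-bimodular projection of `N` onto `P`. -/
structure IsCondExp (N P : Set (BH H)) (Φ : BH H → BH H) : Prop where
  subset : P ⊆ N
  map_add : ∀ x ∈ N, ∀ y ∈ N, Φ (x + y) = Φ x + Φ y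
  map_smul : ∀ (c : ℂ), ∀ x ∈ N, Φ (c • x) = c • Φ x
  maps_to : ∀ x ∈ N, Φ x ∈ P
  fixes : ∀ x ∈ P, Φ x = x
  pos : ∀ x ∈ N, 0 ≤ x → 0 ≤ Φ x
  bimod : ∀ a ∈ P, ∀ b ∈ P, ∀ x ∈ N, Φ (a * x * b) = a * Φ x * b

/-- The inclusion `P ⊆ N` is *with expectation*: there is a faithful normal conditional
expectation of `N` onto `P`. -/
def WithExpectation (N P : Set (BH H)) : Prop :=
  ∃ Φ : BH H → BH H, IsCondExp N P Φ ∧ FaithfulOn N Φ ∧ IsNormalOn N Φ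

/-- σ-finiteness (countable decomposability) of a von Neumann algebra viewed as a subset
of `B(H)`: any family of pairwise orthogonal nonzero projections in it is countable. -/
def SigmaFinite (N : Set (BH H)) : Prop :=
  ∀ F : Set (BH H), F ⊆ N → (∀ p ∈ F, IsProjection p ∧ p ≠ 0) →
    (∀ p ∈ F, ∀ q ∈ F, p ≠ q → p * q = 0) → F.Countable

/-- Conjugation `T ↦ J T J` of a bounded operator by a conjugate-linear isometric involution. -/
def conjJ (J : H ≃ₗᵢ⋆[ℂ] H) (T : BH H) : BH H where
  toFun := fun ξ => J (T (J.symm ξ))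
  map_add' := by intro ξ η; simp
  map_smul' := by intro c ξ; simp [map_smulₛₗ]
  cont := J.continuous.comp (T.continuous.comp J.symm.continuous)

/-- Standard form data for a von Neumann algebra `M ⊆ B(H)`: the modular conjugation `J`
and the self-dual positive cone `L²(M)₊`, with their basic properties. -/
structure StandardForm (M : VonNeumannAlgebra H) where
  J : H ≃ₗᵢ⋆[ℂ] H
  cone : Set H
  J_involutive : ∀ ξ, J (J ξ) = ξ
  J_fixes_cone : ∀ ξ ∈ cone, J ξ = ξ
  commutant_eq : Set.centralizer (M : Set (BH H)) = conjJ J '' (M : Set (BH H))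
  selfdual : cone = {ξ : H | ∀ η ∈ cone, 0 ≤ ⟪ξ, η⟫_ℂ}
  cone_invariant : ∀ x ∈ (M : Set (BH H)), ∀ ξ ∈ cone, x (conjJ J x ξ) ∈ cone

/-- The Jones basic construction `⟨M, Q⟩ = (JQJ)'` associated with a subalgebra `Q ⊆ M`,
where `J` is the modular conjugation of `M` in its standard form `H = L²(M)`. -/
def basicConstruction (J : H ≃ₗᵢ⋆[ℂ] H) (Q : Set (BH H)) : Set (BH H) :=
  Set.centralizer (conjJ J '' Q)

/-- The corner `e N e` of a subset `N ⊆ B(H)` by a projection `e`. -/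
def Corner (e : BH H) (N : Set (BH H)) : Set (BH H) := {x | x ∈ N ∧ e * x * e = x}

/-- Popa's intertwining relation `A ≼_N C`: `A` embeds with expectation into `C` inside `N`.
There are projections `e ∈ A`, `f ∈ C`, a nonzero partial isometry `v ∈ eNf` and a unital
normal *-homomorphism `θ : eAe → fCf` such that `θ(eAe) ⊆ fCf` is with expectation and
`a v = v θ(a)` for all `a ∈ eAe`. -/
def EmbedsWE (N A C : Set (BH H)) : Prop :=
  ∃ (e f v : BH H) (θ : BH H → BH H),
    e ∈ A ∧ IsProjection e ∧
    f ∈ C ∧ IsProjection f ∧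
    v ∈ N ∧ v ≠ 0 ∧ v * star v * v = v ∧ e * v = v ∧ v * f = v ∧
    (∀ x ∈ Corner e A, θ x ∈ Corner f C) ∧
    (∀ x ∈ Corner e A, ∀ y ∈ Corner e A, θ (x + y) = θ x + θ y) ∧
    (∀ (c : ℂ), ∀ x ∈ Corner e A, θ (c • x) = c • θ x) ∧
    (∀ x ∈ Corner e A, ∀ y ∈ Corner e A, θ (x * y) = θ x * θ y) ∧
    (∀ x ∈ Corner e A, θ (star x) = star (θ x)) ∧
    θ e = f ∧
    IsNormalOn (Corner e A) θ ∧
    WithExpectation (Corner f C) (θ '' Corner e A) ∧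
    (∀ a ∈ Corner e A, a * v = v * θ a)

/-- Amalgamated free product structure `M = M₁ *_B M₂`: `M` is generated by `M₁` and `M₂`,
which both contain `B`, and `E : M → B` is a faithful normal conditional expectation with
respect to which `M₁` and `M₂` are freely independent with amalgamation over `B`
(`E` kills every reduced word with letters alternating between `ker E ∩ M₁` and
`ker E ∩ M₂`; `E` restricts to the given expectations `Eᵢ : Mᵢ → B`). -/
structure IsAFP (M M₁ M₂ B : VonNeumannAlgebra H) (E : BH H → BH H) : Prop where
  le₁ : (B : Set (BH H)) ⊆ (M₁ : Set (BH H))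
  le₂ : (B : Set (BH H)) ⊆ (M₂ : Set (BH H))
  le₁M : (M₁ : Set (BH H)) ⊆ (M : Set (BH H))
  le₂M : (M₂ : Set (BH H)) ⊆ (M : Set (BH H))
  generated : Set.centralizer (Set.centralizer ((M₁ : Set (BH H)) ∪ (M₂ : Set (BH H)))) = M
  condExp : IsCondExp (M : Set (BH H)) (B : Set (BH H)) E
  faithful : FaithfulOn (M : Set (BH H)) E
  normal : IsNormalOn (M : Set (BH H)) E
  free : ∀ (n : ℕ) (x : Fin n → BH H) (ι : Fin n → Bool), 0 < n →
    (∀ k, x k ∈ (if ι k then (M₁ : Set (BH H)) else (M₂ : Set (BH H))) ∧ E (x k) = 0) →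
    (∀ (k : ℕ) (h : k + 1 < n), ι ⟨k, Nat.lt_of_succ_lt h⟩ ≠ ι ⟨k + 1, h⟩) →
    E (List.ofFn x).prod = 0

/-- `P` is amenable relative to `Q` inside `M` (all sitting in `B(L²(M))`, `J` being the
modular conjugation of `M`): there is a conditional expectation `Φ : ⟨M, Q⟩ → P` whose
restriction to `M` is faithful and normal. -/
def AmenableRel (J : H ≃ₗᵢ⋆[ℂ] H) (Mset P Q : Set (BH H)) : Prop :=
  ∃ Φ : BH H → BH H, IsCondExp (basicConstruction J Q) P Φ ∧
    FaithfulOn Mset Φ ∧ IsNormalOn Mset Φ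

/-- Amenability (injectivity) of a von Neumann algebra `P ⊆ B(H)`: there is a conditional
expectation from all of `B(H)` onto `P`. -/
def IsAmenableVN (P : Set (BH H)) : Prop :=
  ∃ Φ : BH H → BH H, IsCondExp (Set.univ) P Φ

/-- A central projection of `N ⊆ B(H)`. -/
def IsCentralProjection (N : Set (BH H)) (z : BH H) : Prop :=
  IsProjection z ∧ z ∈ N ∧ ∀ x ∈ N, z * x = x * z

/-- An abelian projection of `N ⊆ B(H)`: `p N p` is commutative. -/
def IsAbelianProjection (N : Set (BH H)) (p : BH H) : Prop :=
  IsProjection p ∧ p ∈ N ∧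
    ∀ x ∈ N, ∀ y ∈ N, (p * x * p) * (p * y * p) = (p * y * p) * (p * x * p)

/-- A von Neumann algebra is of type I if every nonzero central projection dominates a
nonzero abelian projection. -/
def IsTypeI (N : Set (BH H)) : Prop :=
  ∀ z, IsCentralProjection N z → z ≠ 0 →
    ∃ p, IsAbelianProjection N p ∧ p ≠ 0 ∧ p * z = p

/-- `N` has no type I direct summand: no nonzero central corner of `N` is of type I. -/
def HasNoTypeIDirectSummand (N : Set (BH H)) : Prop :=
  ∀ z, IsCentralProjection N z → z ≠ 0 → ¬ IsTypeI (Corner z N)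

/-- Murray–von Neumann equivalence of projections inside `N`. -/
def MvNEquiv (N : Set (BH H)) (p q : BH H) : Prop :=
  ∃ v ∈ N, star v * v = p ∧ v * star v = q

/-- A finite projection of `N`: not equivalent to a proper subprojection of itself. -/
def IsFiniteProjection (N : Set (BH H)) (p : BH H) : Prop :=
  IsProjection p ∧ p ∈ N ∧
    ∀ q, IsProjection q → q ∈ N → q * p = q → MvNEquiv N p q → q = p

/-- A von Neumann algebra is semifinite if every nonzero central projection dominates a
nonzero finite projection. -/
def IsSemifiniteVN (N : Set (BH H)) : Prop :=
  ∀ z, IsCentralProjection N z → z ≠ 0 →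
    ∃ p, p ≠ 0 ∧ p * z = p ∧ IsFiniteProjection N p

/-- A von Neumann algebra is of type III if it has no nonzero finite projection. -/
def IsTypeIII (N : Set (BH H)) : Prop :=
  ∀ p, IsFiniteProjection N p → p = 0

section Part1
open Filter Topology
section basics
variable {H : Type*} [NormedAddCommGroup H] [InnerProductSpace ℂ H] [CompleteSpace H]
variable {L : Type*} [NormedAddCommGroup L] [InnerProductSpace ℂ L] [CompleteSpace L]

/-- quadratic form of an operator -/
def qf (T : BH H) (ξ : H) : ℝ := (⟪T ξ, ξ⟫_ℂ).re

lemma qf_add (S T : BH H) (ξ : H) : qf (S + T) ξ = qf S ξ + qf T ξ := by simp [qf, inner_add_left]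
lemma qf_sub (S T : BH H) (ξ : H) : qf (S - T) ξ = qf S ξ - qf T ξ := by simp [qf, inner_sub_left]
lemma qf_zero (ξ : H) : qf (0 : BH H) ξ = 0 := by simp [qf]
lemma qf_one (ξ : H) : qf (1 : BH H) ξ = ‖ξ‖ ^ 2 := by
  simp [qf, inner_self_eq_norm_sq_to_K]; norm_cast
lemma qf_smul (c : ℝ) (T : BH H) (ξ : H) : qf (c • T) ξ = c * qf T ξ := by
  simp [qf, inner_smul_left]
lemma qf_csmul (c : ℝ) (T : BH H) (ξ : H) : qf ((c : ℂ) • T) ξ = c * qf T ξ := by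
  simp [qf, inner_smul_left]
lemma qf_sum {ι : Type*} (s : Finset ι) (T : ι → BH H) (ξ : H) :
    qf (∑ i ∈ s, T i) ξ = ∑ i ∈ s, qf (T i) ξ := by
  classical
  induction s using Finset.induction_on with
  | empty => simp [qf_zero]
  | insert a s ha ih => rw [Finset.sum_insert ha, Finset.sum_insert ha, qf_add, ih]
lemma star_inner (A : BH H) (ξ η : H) : ⟪star A ξ, η⟫_ℂ = ⟪ξ, A η⟫_ℂ := by
  rw [ContinuousLinearMap.star_eq_adjoint, ContinuousLinearMap.adjoint_inner_left]
lemma inner_star (A : BH H) (ξ η : H) : ⟪ξ, star A η⟫_ℂ = ⟪A ξ, η⟫_ℂ := by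
  rw [ContinuousLinearMap.star_eq_adjoint, ContinuousLinearMap.adjoint_inner_right]
lemma qf_conj (A T : BH H) (ξ : H) : qf (star A * T * A) ξ = qf T (A ξ) := by
  simp [qf, star_inner]
lemma qf_star_mul (A : BH H) (ξ : H) : qf (star A * A) ξ = ‖A ξ‖ ^ 2 := by
  have := qf_conj A 1 ξ
  rw [mul_one, qf_one] at this; exact this
lemma qf_le_norm (T : BH H) (ξ : H) : qf T ξ ≤ ‖T‖ * ‖ξ‖ ^ 2 := by
  calc qf T ξ ≤ ‖⟪T ξ, ξ⟫_ℂ‖ := Complex.re_le_norm _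
    _ ≤ ‖T ξ‖ * ‖ξ‖ := norm_inner_le_norm _ _
    _ ≤ (‖T‖ * ‖ξ‖) * ‖ξ‖ := by gcongr; exact T.le_opNorm ξ
    _ = _ := by ring
lemma qf_nonneg {T : BH H} (h : 0 ≤ T) (ξ : H) : 0 ≤ qf T ξ :=
  ((ContinuousLinearMap.nonneg_iff_isPositive T).1 h).re_inner_nonneg_left ξ
lemma qf_mono {S T : BH H} (h : S ≤ T) (ξ : H) : qf S ξ ≤ qf T ξ := by
  have := qf_nonneg (sub_nonneg.2 h) ξ
  rw [qf_sub] at this; linarith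
lemma nonneg_of_qf {T : BH H} (hs : IsSelfAdjoint T) (h : ∀ ξ, 0 ≤ qf T ξ) : 0 ≤ T := by
  rw [ContinuousLinearMap.nonneg_iff_isPositive, ContinuousLinearMap.isPositive_def']
  exact ⟨hs, h⟩
lemma le_of_qf {S T : BH H} (hS : IsSelfAdjoint S) (hT : IsSelfAdjoint T)
    (h : ∀ ξ, qf S ξ ≤ qf T ξ) : S ≤ T := by
  rw [← sub_nonneg]
  refine nonneg_of_qf (hT.sub hS) fun ξ => ?_
  rw [qf_sub]; linarith [h ξ]
lemma nonneg_of_inner {T : BH H} (h : ∀ ξ, 0 ≤ ⟪T ξ, ξ⟫_ℂ) : 0 ≤ T := by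
  rw [ContinuousLinearMap.nonneg_iff_isPositive, ContinuousLinearMap.isPositive_iff_complex]
  intro ξ
  have := h ξ
  rw [Complex.le_def] at this
  refine ⟨?_, this.1⟩
  apply Complex.ext
  · simp
  · simpa using this.2
lemma inner_nonneg_of {T : BH H} (h : 0 ≤ T) (ξ : H) : 0 ≤ ⟪T ξ, ξ⟫_ℂ :=
  ((ContinuousLinearMap.nonneg_iff_isPositive T).1 h).inner_nonneg_left ξ
lemma sa_of_nonneg {T : BH H} (h : 0 ≤ T) : IsSelfAdjoint T := IsSelfAdjoint.of_nonneg h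

/-- Square root factorisation of positives -/
lemma sqrt_fac {T : BH H} (h : 0 ≤ T) :
    0 ≤ CFC.sqrt T ∧ star (CFC.sqrt T) = CFC.sqrt T ∧ CFC.sqrt T * CFC.sqrt T = T := by
  have h1 : 0 ≤ CFC.sqrt T := CFC.sqrt_nonneg T
  exact ⟨h1, (sa_of_nonneg h1).star_eq, CFC.sqrt_mul_sqrt_self T h⟩

lemma norm_sqrt_apply {T : BH H} (h : 0 ≤ T) (ξ : H) : ‖CFC.sqrt T ξ‖ ^ 2 = qf T ξ := by
  obtain ⟨-, h2, h3⟩ := sqrt_fac h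
  rw [← qf_star_mul, h2, h3]

lemma norm_sqrt_sq {T : BH H} (h : 0 ≤ T) : ‖CFC.sqrt T‖ ^ 2 = ‖T‖ := by
  obtain ⟨-, h2, h3⟩ := sqrt_fac h
  have := CStarRing.norm_star_mul_self (x := CFC.sqrt T)
  rw [h2, h3] at this
  rw [this, sq]

lemma norm_apply_sq_le {T : BH H} (h : 0 ≤ T) (ξ : H) : ‖T ξ‖ ^ 2 ≤ ‖T‖ * qf T ξ := by
  obtain ⟨-, h2, h3⟩ := sqrt_fac h
  have e : T ξ = CFC.sqrt T (CFC.sqrt T ξ) := by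
    conv_lhs => rw [← h3]
    rfl
  rw [e, ← norm_sqrt_sq h, ← norm_sqrt_apply h, ← mul_pow]
  gcongr
  exact ContinuousLinearMap.le_opNorm _ _

lemma eq_zero_of_qf {T : BH H} (h : 0 ≤ T) (h0 : ∀ ξ, qf T ξ = 0) : T = 0 := by
  ext ξ
  have := norm_apply_sq_le h ξ
  rw [h0 ξ, mul_zero] at this
  have : ‖T ξ‖ ^ 2 = 0 := le_antisymm this (by positivity)
  simpa using this

lemma apply_eq_zero_of_qf {T : BH H} (h : 0 ≤ T) {ξ : H} (h0 : qf T ξ = 0) : T ξ = 0 := by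
  have := norm_apply_sq_le h ξ
  rw [h0, mul_zero] at this
  have : ‖T ξ‖ ^ 2 = 0 := le_antisymm this (by positivity)
  simpa using this

lemma norm_mono {S T : BH H} (h0 : 0 ≤ S) (h : S ≤ T) : ‖S‖ ≤ ‖T‖ :=
  CStarAlgebra.norm_le_norm_of_nonneg_of_le h0 h

lemma le_norm_smul {T : BH H} (h : 0 ≤ T) : T ≤ (‖T‖ : ℝ) • (1 : BH H) := by
  refine le_of_qf (sa_of_nonneg h) (IsSelfAdjoint.smul (by simp [IsSelfAdjoint]) (.one _)) fun ξ => ?_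
  rw [qf_smul, qf_one]; exact qf_le_norm T ξ

lemma norm_le_of_sq_le {A : BH H} {c : ℝ} (hc : 0 ≤ c) (h : ∀ ξ, qf (star A * A) ξ ≤ c ^ 2 * ‖ξ‖ ^ 2) :
    ‖A‖ ≤ c := by
  refine A.opNorm_le_bound hc fun ξ => ?_
  have := h ξ
  rw [qf_star_mul, ← mul_pow] at this
  exact le_of_sq_le_sq this (by positivity)

/-- directed suprema -/
theorem directed_sup (S : Set (BH H)) (hne : S.Nonempty) (hd : DirectedOn (· ≤ ·) S)
    (hb : BddAbove S) :
    ∃ x, IsLUB S x ∧ ∀ ξ, ∀ ε > 0, ∃ s ∈ S, ∀ t ∈ S, s ≤ t → ‖x ξ - t ξ‖ < ε := by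
  classical
  obtain ⟨b, hb⟩ := hb
  obtain ⟨s0, hs0⟩ := hne
  haveI : Nonempty S := ⟨⟨s0, hs0⟩⟩
  haveI : IsDirectedOrder S := ⟨fun a c => by
    obtain ⟨z, hz, h1, h2⟩ := hd a.1 a.2 c.1 c.2
    exact ⟨⟨z, hz⟩, h1, h2⟩⟩
  -- Cauchy
  have key : ∀ s t : BH H, s0 ≤ s → s ≤ t → t ∈ S → ∀ ξ, ‖t ξ - s ξ‖ ^ 2 ≤ ‖b - s0‖ * (qf t ξ - qf s ξ) := by
    intro s t h1 h2 ht ξ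
    have hp : 0 ≤ t - s := sub_nonneg.2 h2
    have h3 := norm_apply_sq_le hp ξ
    rw [qf_sub] at h3
    have h4 : ‖t - s‖ ≤ ‖b - s0‖ := norm_mono hp (sub_le_sub (hb ht) h1)
    have h5 : 0 ≤ qf t ξ - qf s ξ := by rw [← qf_sub]; exact qf_nonneg hp ξ
    calc ‖t ξ - s ξ‖ ^ 2 ≤ ‖t - s‖ * (qf t ξ - qf s ξ) := h3
      _ ≤ _ := by gcongr
  have cau : ∀ ξ, ∃ y, Tendsto (fun s : S => s.1 ξ) atTop (𝓝 y) := by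
    intro ξ
    apply cauchy_map_iff_exists_tendsto.1
    rw [Metric.cauchy_iff]
    refine ⟨inferInstance, fun ε hε => ?_⟩
    -- sup of qf
    have hbd : BddAbove (Set.range fun s : S => qf s.1 ξ) := ⟨qf b ξ, by
      rintro _ ⟨s, rfl⟩; exact qf_mono (hb s.2) ξ⟩
    set g := ⨆ s : S, qf s.1 ξ with hg
    set C := ‖b - s0‖ + 1 with hC
    have hCpos : 0 < C := by positivity
    obtain ⟨s1, hs1⟩ := exists_lt_of_lt_ciSup (show g - (ε/3)^2 / C < g by
      have : 0 < (ε/3)^2 / C := by positivity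
      linarith)
    obtain ⟨s2, h21, h22⟩ := directed_of (· ≤ ·) s1 (⟨s0, hs0⟩ : S)
    refine ⟨(fun s : S => s.1 ξ) '' Set.Ici s2, image_mem_map (Ici_mem_atTop s2), ?_⟩
    have hcl : ∀ t : S, s2 ≤ t → ‖t.1 ξ - s2.1 ξ‖ ≤ ε / 3 := by
      intro t ht
      have h1 := key s2.1 t.1 h22 ht t.2 ξ
      have h2 : qf t.1 ξ ≤ g := le_ciSup hbd t
      have h3 : qf s1.1 ξ ≤ qf s2.1 ξ := qf_mono h21 ξ
      have h5 : 0 ≤ qf t.1 ξ - qf s2.1 ξ := by linarith [qf_mono (show s2.1 ≤ t.1 from ht) ξ]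
      have h4 : ‖b - s0‖ * (qf t.1 ξ - qf s2.1 ξ) ≤ (ε/3)^2 := by
        calc _ ≤ C * (qf t.1 ξ - qf s2.1 ξ) := by gcongr; linarith
          _ ≤ C * ((ε/3)^2 / C) := by gcongr; linarith
          _ = _ := by field_simp
      exact le_of_sq_le_sq (h1.trans h4) (by positivity)
    rintro _ ⟨t, ht, rfl⟩ _ ⟨t', ht', rfl⟩
    calc dist (t.1 ξ) (t'.1 ξ) ≤ dist (t.1 ξ) (s2.1 ξ) + dist (t'.1 ξ) (s2.1 ξ) := dist_triangle_right _ _ _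
      _ ≤ ε/3 + ε/3 := by
        rw [dist_eq_norm, dist_eq_norm]; exact add_le_add (hcl t ht) (hcl t' ht')
      _ < ε := by linarith
  choose f hf using cau
  let lin : H →ₗ[ℂ] H := linearMapOfTendsto (l := (atTop : Filter S)) f (fun s : S => (s.1 : H →ₗ[ℂ] H))
    (tendsto_pi_nhds.2 hf)
  let x : BH H := lin.mkContinuous (‖s0‖ + ‖b - s0‖) (by
    intro ξ
    have : Tendsto (fun s : S => ‖s.1 ξ‖) atTop (𝓝 ‖f ξ‖) := (hf ξ).norm
    refine le_of_tendsto this ?_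
    filter_upwards [Ici_mem_atTop (⟨s0, hs0⟩ : S)] with s hs
    have hp : 0 ≤ s.1 - s0 := sub_nonneg.2 hs
    have h4 : ‖s.1 - s0‖ ≤ ‖b - s0‖ := norm_mono hp (sub_le_sub_right (hb s.2) _)
    calc ‖s.1 ξ‖ = ‖s0 ξ + (s.1 - s0) ξ‖ := by simp
      _ ≤ ‖s0 ξ‖ + ‖(s.1 - s0) ξ‖ := norm_add_le _ _
      _ ≤ ‖s0‖ * ‖ξ‖ + ‖s.1 - s0‖ * ‖ξ‖ := add_le_add (ContinuousLinearMap.le_opNorm _ _) (ContinuousLinearMap.le_opNorm _ _)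
      _ ≤ ‖s0‖ * ‖ξ‖ + ‖b - s0‖ * ‖ξ‖ := by gcongr
      _ = _ := by ring)
  have hx : ∀ ξ, Tendsto (fun s : S => s.1 ξ) atTop (𝓝 (x ξ)) := hf
  clear_value x
  refine ⟨x, ⟨fun s hs => ?_, fun y hy => ?_⟩, fun ξ ε hε => ?_⟩
  · rw [← sub_nonneg]
    refine nonneg_of_inner fun ξ => ?_
    have : Tendsto (fun t : S => ⟪(t.1 - s) ξ, ξ⟫_ℂ) atTop (𝓝 ⟪(x - s) ξ, ξ⟫_ℂ) := by
      simp only [sub_apply]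
      exact ((hx ξ).sub_const _).inner tendsto_const_nhds
    refine ge_of_tendsto this ?_
    filter_upwards [Ici_mem_atTop (⟨s, hs⟩ : S)] with t ht
    exact inner_nonneg_of (sub_nonneg.2 ht) ξ
  · rw [← sub_nonneg]
    refine nonneg_of_inner fun ξ => ?_
    have : Tendsto (fun t : S => ⟪(y - t.1) ξ, ξ⟫_ℂ) atTop (𝓝 ⟪(y - x) ξ, ξ⟫_ℂ) := by
      simp only [sub_apply]
      exact ((hx ξ).const_sub _).inner tendsto_const_nhds
    refine ge_of_tendsto' this fun t => ?_
    have hty : t.1 ≤ y := hy t.2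
    exact inner_nonneg_of (sub_nonneg.2 hty) ξ
  · obtain ⟨N, hN⟩ := eventually_atTop.1 ((hx ξ).eventually (Metric.ball_mem_nhds _ hε))
    refine ⟨N.1, N.2, fun t ht hle => ?_⟩
    have := hN ⟨t, ht⟩ hle
    rwa [dist_eq_norm, norm_sub_rev] at this

theorem lub_approx {S : Set (BH H)} (hne : S.Nonempty) (hd : DirectedOn (· ≤ ·) S)
    {x : BH H} (hx : IsLUB S x) (ξ : H) {ε : ℝ} (hε : 0 < ε) :
    ∃ s ∈ S, ∀ t ∈ S, s ≤ t → ‖x ξ - t ξ‖ < ε := by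
  obtain ⟨y, hy, h⟩ := directed_sup S hne hd ⟨x, hx.1⟩
  obtain rfl := hx.unique hy
  exact h ξ ε hε

/-- strong limits stay in a von Neumann algebra -/
theorem mem_of_approx (M : VonNeumannAlgebra H) (x : BH H)
    (h : ∀ ξ η : H, ∀ ε > 0, ∃ s ∈ M, ‖x ξ - s ξ‖ < ε ∧ ‖x η - s η‖ < ε) : x ∈ M := by
  rw [← M.commutant_commutant, VonNeumannAlgebra.mem_commutant_iff]
  intro t ht
  rw [VonNeumannAlgebra.mem_commutant_iff] at ht
  ext ξ
  simp only [mul_apply_eq_comp]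
  rw [← sub_eq_zero, ← norm_le_zero_iff]
  refine le_of_forall_pos_le_add fun ε hε => ?_
  set C := ‖t‖ + 1
  have hC : 0 < C := by positivity
  obtain ⟨s, hs, h1, h2⟩ := h ξ (t ξ) (ε / (2 * C)) (by positivity)
  have hcomm : t (s ξ) = s (t ξ) := (congrArg (fun T : BH H => T ξ) (ht s hs)).symm
  have : t (x ξ) - x (t ξ) = t (x ξ - s ξ) - (x (t ξ) - s (t ξ)) := by
    rw [map_sub, hcomm]; abel
  rw [this, zero_add]
  have h3 : ‖t (x ξ - s ξ)‖ ≤ C * (ε / (2*C)) := by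
    calc _ ≤ ‖t‖ * ‖x ξ - s ξ‖ := t.le_opNorm _
      _ ≤ C * (ε / (2*C)) := by
        have : ‖t‖ ≤ C := by simp [C]
        gcongr
  have h4 : ε / (2 * C) ≤ ε / 2 := by
    apply div_le_div_of_nonneg_left hε.le (by norm_num)
    have : 1 ≤ C := by simp [C]
    linarith
  have h5 : C * (ε / (2*C)) = ε / 2 := by field_simp
  calc _ ≤ ‖t (x ξ - s ξ)‖ + ‖x (t ξ) - s (t ξ)‖ := norm_sub_le _ _
    _ ≤ ε/2 + ε/2 := by linarith
    _ = ε := by ring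

theorem lub_mem (M : VonNeumannAlgebra H) {S : Set (BH H)} (hS : S ⊆ M) (hne : S.Nonempty)
    (hd : DirectedOn (· ≤ ·) S) {x : BH H} (hx : IsLUB S x) : x ∈ M := by
  refine mem_of_approx M x fun ξ η ε hε => ?_
  obtain ⟨s, hs, h1⟩ := lub_approx hne hd hx ξ hε
  obtain ⟨s', hs', h2⟩ := lub_approx hne hd hx η hε
  obtain ⟨t, ht, h3, h4⟩ := hd s hs s' hs'
  exact ⟨t, hS ht, h1 t ht h3, h2 t ht h4⟩

/-- To check IsLUB from strong approximation. -/
theorem isLUB_of_approx {S : Set (BH H)} {x : BH H} (hub : ∀ s ∈ S, s ≤ x)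
    (h : ∀ ξ, ∀ ε > 0, ∃ s ∈ S, qf x ξ - qf s ξ < ε) (hsa : IsSelfAdjoint x)
    (hS : ∀ s ∈ S, IsSelfAdjoint s) (hne : S.Nonempty) : IsLUB S x := by
  refine ⟨hub, fun y hy => ?_⟩
  obtain ⟨s0, hs0⟩ := hne
  have hysa : IsSelfAdjoint y := by
    have := (sa_of_nonneg (sub_nonneg.2 (hy hs0))).add (hS s0 hs0)
    simpa using this
  refine le_of_qf hsa hysa fun ξ => le_of_forall_pos_le_add fun ε hε => ?_
  obtain ⟨s, hs, h1⟩ := h ξ ε hε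
  linarith [qf_mono (hy hs) ξ]
end basics
end Part1

section Part2
open Filter Topology
section basics2
variable {H : Type*} [NormedAddCommGroup H] [InnerProductSpace ℂ H] [CompleteSpace H]

/-- projection onto the closure of a subspace -/
def pr (K : Submodule ℂ H) : BH H := K.topologicalClosure.starProjection

lemma pr_proj (K : Submodule ℂ H) : IsProjection (pr K) :=
  ⟨(isStarProjection_starProjection).isSelfAdjoint, (isStarProjection_starProjection).isIdempotentElem⟩
lemma pr_of_mem {K : Submodule ℂ H} {ξ : H} (h : ξ ∈ K.topologicalClosure) : pr K ξ = ξ :=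
  Submodule.starProjection_eq_self_iff.2 h
lemma pr_of_mem' {K : Submodule ℂ H} {ξ : H} (h : ξ ∈ K) : pr K ξ = ξ :=
  pr_of_mem (K.le_topologicalClosure h)
lemma pr_mem (K : Submodule ℂ H) (ξ : H) : pr K ξ ∈ K.topologicalClosure :=
  Submodule.starProjection_apply_mem _ _
lemma pr_eq_zero {K : Submodule ℂ H} {ξ : H} (h : ∀ k ∈ K, ⟪k, ξ⟫_ℂ = 0) : pr K ξ = 0 := by
  apply (Submodule.starProjection_apply_eq_zero_iff _).2
  rw [Submodule.orthogonal_closure]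
  exact (Submodule.mem_orthogonal K ξ).2 h

lemma closure_map {L : Type*} [NormedAddCommGroup L] [InnerProductSpace ℂ L] {K : Submodule ℂ H} {K' : Submodule ℂ L}
    {T : H →L[ℂ] L} (h : ∀ k ∈ K, T k ∈ K'.topologicalClosure)
    {ξ : H} (hξ : ξ ∈ K.topologicalClosure) : T ξ ∈ K'.topologicalClosure := by
  have hcl : IsClosed {ξ : H | T ξ ∈ K'.topologicalClosure} :=
    K'.isClosed_topologicalClosure.preimage T.continuous
  have : closure (K : Set H) ⊆ {ξ : H | T ξ ∈ K'.topologicalClosure} :=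
    closure_minimal h hcl
  exact this hξ

lemma pr_commute {K : Submodule ℂ H} {T : BH H} (h : ∀ k ∈ K, T k ∈ K.topologicalClosure)
    (h' : ∀ k ∈ K, star T k ∈ K.topologicalClosure) : pr K * T = T * pr K := by
  have e1 : ∀ T : BH H, (∀ k ∈ K, T k ∈ K.topologicalClosure) → pr K * T * pr K = T * pr K := by
    intro T h
    ext ξ
    exact pr_of_mem (closure_map h (pr_mem K ξ))
  have s := (pr_proj K).1.star_eq
  have h1 := e1 T h
  have h2 := congrArg star (e1 (star T) h')
  simp only [star_mul, star_star, s] at h2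
  rw [← h2, ← mul_assoc, h1]

/-- projections: qf facts -/
lemma IsProjection.nonneg {p : BH H} (hp : IsProjection p) : 0 ≤ p := by
  have : p = star p * p := by rw [hp.1.star_eq, hp.2.eq]
  rw [this]; exact star_mul_self_nonneg p
lemma IsProjection.qf {p : BH H} (hp : IsProjection p) (ξ : H) : AFP.qf p ξ = ‖p ξ‖ ^ 2 := by
  rw [← qf_star_mul, hp.1.star_eq, hp.2.eq]
lemma IsProjection.compl {p : BH H} (hp : IsProjection p) : IsProjection (1 - p) :=
  ⟨(IsSelfAdjoint.one _).sub hp.1, hp.2.one_sub⟩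
lemma IsProjection.le_one {p : BH H} (hp : IsProjection p) : p ≤ 1 := by
  rw [← sub_nonneg]; exact hp.compl.nonneg
lemma IsProjection.norm_apply_le {p : BH H} (hp : IsProjection p) (ξ : H) : ‖p ξ‖ ≤ ‖ξ‖ := by
  have := qf_mono hp.le_one ξ
  rw [hp.qf, qf_one] at this
  exact le_of_sq_le_sq this (by positivity)
lemma IsProjection.norm_le {p : BH H} (hp : IsProjection p) : ‖p‖ ≤ 1 :=
  p.opNorm_le_bound zero_le_one fun ξ => by rw [one_mul]; exact hp.norm_apply_le ξ
/-- Pythagoras -/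
lemma IsProjection.pyth {p : BH H} (hp : IsProjection p) (ξ : H) :
    ‖ξ‖ ^ 2 = ‖p ξ‖ ^ 2 + ‖ξ - p ξ‖ ^ 2 := by
  have h := hp.compl.qf ξ
  rw [qf_sub, qf_one, hp.qf] at h
  have : (1 - p) ξ = ξ - p ξ := by simp
  rw [this] at h; linarith

section vN
variable (M : VonNeumannAlgebra H)

lemma mem_of_comm {x : BH H} (h : ∀ t ∈ M.commutant, t * x = x * t) : x ∈ M := by
  rw [← M.commutant_commutant, VonNeumannAlgebra.mem_commutant_iff]
  exact h
variable {M}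
lemma comm_of_mem {x t : BH H} (hx : x ∈ M) (ht : t ∈ M.commutant) : t * x = x * t :=
  (VonNeumannAlgebra.mem_commutant_iff.1 ht x hx).symm
lemma vsmul_mem (c : ℂ) {x : BH H} (hx : x ∈ M) : c • x ∈ M :=
  M.toStarSubalgebra.smul_mem hx c
lemma vrsmul_mem (c : ℝ) {x : BH H} (hx : x ∈ M) : c • x ∈ M := by
  have : c • x = (c : ℂ) • x := (Complex.coe_smul c x).symm
  rw [this]; exact vsmul_mem _ hx
lemma vsqrt_mem {x : BH H} (hx : x ∈ M) (h0 : 0 ≤ x) : CFC.sqrt x ∈ M := by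
  refine mem_of_comm M fun t ht => ?_
  rw [CFC.sqrt_eq_real_sqrt x h0]
  exact ((show Commute x t from (comm_of_mem hx ht).symm).cfcₙ_real _).symm.eq
lemma vpos_mem {x : BH H} (hx : x ∈ M) : x⁺ ∈ M := by
  refine mem_of_comm M fun t ht => ?_
  rw [CFC.posPart_def]
  exact ((show Commute x t from (comm_of_mem hx ht).symm).cfcₙ_real _).symm.eq
lemma vinv_mem {x : BH H} (hx : x ∈ M) : Ring.inverse x ∈ M := by
  refine mem_of_comm M fun t ht => ?_
  have h : Commute t x := comm_of_mem hx ht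
  by_cases hu : IsUnit x
  · obtain ⟨u, rfl⟩ := hu
    rw [Ring.inverse_unit]
    exact h.units_inv_right.eq
  · rw [Ring.inverse_non_unit _ hu]; simp
lemma vstar_mem {x : BH H} (hx : x ∈ M) : star x ∈ M := star_mem hx
lemma pr_mem_vN (K : Submodule ℂ H) (h : ∀ t ∈ M.commutant, ∀ k ∈ K, t k ∈ K.topologicalClosure) :
    pr K ∈ M :=
  mem_of_comm M fun t ht => (pr_commute (h t ht) (h _ (star_mem ht))).symm

lemma pos_neg {D : BH H} (hsa : IsSelfAdjoint D) : ∃ A N : BH H, 0 ≤ A ∧ 0 ≤ N ∧ A - N = D ∧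
    A * N = 0 ∧ N * A = 0 ∧ ∀ X : BH H, X * D = D * X → X * A = A * X := by
  refine ⟨D⁺, D⁻, CFC.posPart_nonneg D, CFC.negPart_nonneg D, CFC.posPart_sub_negPart D hsa,
    CFC.posPart_mul_negPart D, CFC.negPart_mul_posPart D, fun X hX => ?_⟩
  rw [CFC.posPart_def]
  have : Commute D X := hX.symm
  exact (this.cfcₙ_real _).symm.eq

/-- spectral cut -/
theorem spectral_cut {T : BH H} (hT : T ∈ M) (h0 : 0 ≤ T) (δ : ℝ) :
    ∃ R ∈ M, IsProjection R ∧ R * T = T * R ∧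
      (∀ ξ, qf T (ξ - R ξ) ≤ δ * ‖ξ - R ξ‖ ^ 2) ∧ (∀ ξ, δ * ‖R ξ‖ ^ 2 ≤ qf T (R ξ)) ∧
      (R = 0 → ∀ ξ, qf T ξ ≤ δ * ‖ξ‖ ^ 2) ∧
      (∀ X : BH H, X * T = T * X → X * R = R * X) ∧ (0 ≤ δ → ∀ ξ, T ξ = 0 → R ξ = 0) := by
  set D : BH H := T - δ • 1 with hD
  have hone : IsSelfAdjoint (δ • (1 : BH H)) := IsSelfAdjoint.smul (by simp [IsSelfAdjoint]) (.one _)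
  have hsa : IsSelfAdjoint D := (sa_of_nonneg h0).sub hone
  have hDM : D ∈ M := sub_mem hT (vrsmul_mem _ (one_mem M))
  obtain ⟨A, Bn, hA, hB, hAB, hz', hz, hcomm0⟩ := pos_neg hsa
  have hAsa := (sa_of_nonneg hA).star_eq
  set K : Submodule ℂ H := (A : H →L[ℂ] H).range with hK
  have hKA : ∀ ξ, A ξ ∈ K := fun ξ => ⟨ξ, rfl⟩
  have hBK : ∀ ξ, Bn (pr K ξ) = 0 := by
    intro ξ
    have : Bn (pr K ξ) ∈ (⊥ : Submodule ℂ H).topologicalClosure := by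
      refine closure_map ?_ (pr_mem K ξ)
      rintro _ ⟨η, rfl⟩
      have h2 : Bn (A η) = 0 := congrArg (fun S : BH H => S η) hz
      refine Submodule.le_topologicalClosure _ ?_
      simpa using h2
    rw [IsClosed.submodule_topologicalClosure_eq (by simp)] at this
    simpa using this
  have hcomm : ∀ X : BH H, X * T = T * X → X * A = A * X := by
    intro X hX
    apply hcomm0
    rw [hD, sub_mul, mul_sub, hX]; simp
  have hcommR : ∀ X : BH H, X * T = T * X → X * pr K = pr K * X := by
    have hinv : ∀ X : BH H, X * T = T * X → ∀ k ∈ K, X k ∈ K.topologicalClosure := by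
      rintro X hX _ ⟨η, rfl⟩
      refine K.le_topologicalClosure ⟨X η, ?_⟩
      exact (congrArg (fun S : BH H => S η) (hcomm X hX)).symm
    intro X hX
    refine (pr_commute (hinv X hX) (hinv _ ?_)).symm
    have := congrArg star hX
    simp only [star_mul, (sa_of_nonneg h0).star_eq] at this
    exact this.symm
  have hAR : ∀ ξ, A (ξ - pr K ξ) = 0 := by
    intro ξ
    have hp : A * pr K = A := by
      have : pr K * A = A := by ext η; exact pr_of_mem' (hKA η)
      have := congrArg star this
      simpa only [star_mul, hAsa, (pr_proj K).1.star_eq] using this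
    have := congrArg (fun S : BH H => S ξ) hp
    simp only [mul_apply_eq_comp] at this
    rw [map_sub, this, sub_self]
  have hTq : ∀ ξ, qf T ξ = δ * ‖ξ‖ ^ 2 + qf A ξ - qf Bn ξ := by
    intro ξ
    have : T = δ • 1 + A - Bn := by rw [add_sub_assoc, hAB, hD]; abel
    conv_lhs => rw [this]
    rw [qf_sub, qf_add, qf_smul, qf_one]
  refine ⟨pr K, pr_mem_vN K ?_, pr_proj K, (hcommR T rfl).symm, ?_, ?_, ?_, hcommR, ?_⟩
  · rintro t ht _ ⟨η, rfl⟩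
    refine K.le_topologicalClosure ⟨t η, ?_⟩
    exact (congrArg (fun S : BH H => S η) (hcomm t (comm_of_mem hT ht))).symm
  · intro ξ
    rw [hTq]
    have h1 : qf A (ξ - pr K ξ) = 0 := by unfold qf; rw [hAR]; simp
    linarith [qf_nonneg hB (ξ - pr K ξ)]
  · intro ξ
    rw [hTq]
    have h1 : qf Bn (pr K ξ) = 0 := by unfold qf; rw [hBK]; simp
    linarith [qf_nonneg hA (pr K ξ)]
  · intro hR ξ
    have h1 : qf A ξ = 0 := by
      have := hAR ξ
      rw [hR] at this
      unfold qf
      simp at this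
      rw [this]; simp
    rw [hTq]; linarith [qf_nonneg hB ξ]
  · intro hδ ξ hξ
    apply pr_eq_zero
    rintro _ ⟨η, rfl⟩
    -- qf A ξ = 0
    have h3 : A ξ = 0 := by
      have e : D ξ = -(δ • ξ) := by simp [hD, hξ]
      have e2 : A (A ξ) = -(δ • A ξ) := by
        have : A * A = A * D := by
          conv_rhs => rw [← hAB, mul_sub, hz', sub_zero]
        have := congrArg (fun S : BH H => S ξ) this
        simp only [mul_apply_eq_comp] at this
        rw [this, e, map_neg, ← Complex.coe_smul, map_smul, Complex.coe_smul]
      have e3 : ‖A ξ‖ ^ 2 = - (δ * qf A ξ) := by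
        rw [← qf_star_mul, hAsa]
        unfold qf
        rw [mul_apply_eq_comp, e2, inner_neg_left, ← Complex.coe_smul, inner_smul_left]
        simp
      have e4 : 0 ≤ δ * qf A ξ := mul_nonneg hδ (qf_nonneg hA ξ)
      have : ‖A ξ‖ ^ 2 = 0 := le_antisymm (by linarith) (by positivity)
      simpa using this
    change ⟪A η, ξ⟫_ℂ = 0
    rw [← inner_star, hAsa, h3, inner_zero_right]
end vN

section ce
variable {M N : VonNeumannAlgebra H} {F : BH H → BH H} (hF : IsCondExp (M : Set (BH H)) (N : Set (BH H)) F)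
include hF
lemma ce_sub {x y : BH H} (hx : x ∈ M) (hy : y ∈ M) : F (x - y) = F x - F y := by
  have h := hF.map_add (x - y) (sub_mem hx hy) y hy
  rw [sub_add_cancel] at h; rw [h]; abel
lemma ce_one : F 1 = 1 := hF.fixes 1 (one_mem N)
lemma ce_zero : F 0 = 0 := hF.fixes 0 (zero_mem N)
lemma ce_mono {x y : BH H} (hx : x ∈ M) (hy : y ∈ M) (h : x ≤ y) : F x ≤ F y := by
  rw [← sub_nonneg, ← ce_sub hF hy hx]
  exact hF.pos _ (sub_mem hy hx) (sub_nonneg.2 h)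
lemma ce_sa {x : BH H} (hx : x ∈ M) (hs : IsSelfAdjoint x) : IsSelfAdjoint (F x) := by
  have hp : x⁺ ∈ M := vpos_mem hx
  have h : x = x⁺ - (x⁺ - x) := by abel
  have h2 : x⁺ - x = x⁻ := by
    have := CFC.posPart_sub_negPart x hs
    nth_rewrite 2 [← this]; abel
  have h3 : 0 ≤ F (x⁺ - x) := hF.pos _ (sub_mem hp hx) (by rw [h2]; exact CFC.negPart_nonneg x)
  rw [h, ce_sub hF hp (sub_mem hp hx)]
  exact (sa_of_nonneg (hF.pos _ hp (CFC.posPart_nonneg x))).sub (sa_of_nonneg h3)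
lemma ce_star {x : BH H} (hx : x ∈ M) : F (star x) = star (F x) := by
  have hs : star x ∈ M := star_mem hx
  have h1 := ce_sa hF (add_mem hx hs) (IsSelfAdjoint.add_star_self x)
  have h2 : IsSelfAdjoint (F (Complex.I • (x - star x))) := by
    refine ce_sa hF (vsmul_mem _ (sub_mem hx hs)) ?_
    rw [isSelfAdjoint_iff, star_smul, star_sub, star_star]
    simp only [Complex.star_def, Complex.conj_I, neg_smul, ← smul_neg, neg_sub]
  rw [hF.map_add _ hx _ hs] at h1
  rw [hF.map_smul _ _ (sub_mem hx hs), ce_sub hF hx hs] at h2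
  have e1 := h1.star_eq
  have e2 := h2.star_eq
  rw [star_smul, Complex.star_def, Complex.conj_I] at e2
  rw [star_add] at e1
  have e3 : star (F x - F (star x)) = -(F x - F (star x)) := by
    have := congrArg (fun z => Complex.I • z) e2
    simp only [smul_smul, mul_neg, Complex.I_mul_I, neg_neg, one_smul, neg_smul, smul_neg] at this
    exact this
  rw [star_sub] at e3
  have h2' : (2 : ℂ) • F (star x) = (2 : ℂ) • star (F x) := by
    rw [two_smul, two_smul]
    have := congrArg₂ (· + ·) e1 e3
    have e4 : star (F x) + star (F (star x)) + (star (F x) - star (F (star x))) = star (F x) + star (F x) := by abel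
    have e5 : F x + F (star x) + -(F x - F (star x)) = F (star x) + F (star x) := by abel
    rw [e4, e5] at this; exact this.symm
  exact smul_right_injective _ (two_ne_zero) h2'
lemma ce_left {a x : BH H} (ha : a ∈ N) (hx : x ∈ M) : F (a * x) = a * F x := by
  have := hF.bimod a ha 1 (one_mem N) x hx
  simpa using this
lemma ce_right {b x : BH H} (hb : b ∈ N) (hx : x ∈ M) : F (x * b) = F x * b := by
  have := hF.bimod 1 (one_mem N) b hb x hx
  simpa using this
lemma ce_ks {x : BH H} (hx : x ∈ M) : star (F x) * F x ≤ F (star x * x) := by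
  have hy : F x ∈ N := hF.maps_to x hx
  have hyM : F x ∈ M := hF.subset hy
  have hsx : star x ∈ M := star_mem hx
  have hsy : star (F x) ∈ N := star_mem hy
  have hsyM : star (F x) ∈ M := star_mem hyM
  have h := hF.pos (star (x - F x) * (x - F x)) (mul_mem (star_mem (sub_mem hx hyM)) (sub_mem hx hyM))
    (star_mul_self_nonneg _)
  have e : star (x - F x) * (x - F x) = star x * x - star x * F x - (star (F x) * x - star (F x) * F x) := by
    rw [star_sub]; noncomm_ring
  rw [e, ce_sub hF (sub_mem (mul_mem hsx hx) (mul_mem hsx hyM)) (sub_mem (mul_mem hsyM hx) (mul_mem hsyM hyM)),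
    ce_sub hF (mul_mem hsx hx) (mul_mem hsx hyM), ce_sub hF (mul_mem hsyM hx) (mul_mem hsyM hyM),
    ce_right hF hy hsx, ce_left hF hsy hx, ce_left hF hsy hyM, hF.fixes _ hy, ce_star hF hx] at h
  rw [sub_self, sub_zero, sub_nonneg] at h
  exact h
end ce
end basics2
end Part2

section Part3
open Filter Topology
section P3
variable {H : Type*} [NormedAddCommGroup H] [InnerProductSpace ℂ H] [CompleteSpace H]
variable {L : Type*} [NormedAddCommGroup L] [InnerProductSpace ℂ L] [CompleteSpace L]
variable {L' : Type*} [NormedAddCommGroup L'] [InnerProductSpace ℂ L'] [CompleteSpace L']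

/-- extension lemma -/
theorem exists_ext {X : Type*} [AddCommGroup X] [Module ℂ X] (e : X →ₗ[ℂ] L) (f : X →ₗ[ℂ] L') (C : ℝ)
    (h : ∀ x, ‖f x‖ ≤ C * ‖e x‖) :
    ∃ T : L →L[ℂ] L', (∀ x, T (e x) = f x) ∧ ∀ ζ, (∀ x, ⟪e x, ζ⟫_ℂ = 0) → T ζ = 0 := by
  set K := (LinearMap.range e).topologicalClosure with hK
  let e' : X →ₗ[ℂ] K := e.codRestrict K (fun x => Submodule.le_topologicalClosure _ ⟨x, rfl⟩)
  have hd : DenseRange e' := by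
    intro k
    rw [closure_subtype]
    have h1 : (k : L) ∈ closure ((LinearMap.range e : Submodule ℂ L) : Set L) := k.2
    have h2 : (Subtype.val '' Set.range e' : Set L) = ((LinearMap.range e : Submodule ℂ L) : Set L) := by
      ext y
      constructor
      · rintro ⟨_, ⟨x, rfl⟩, rfl⟩; exact ⟨x, rfl⟩
      · rintro ⟨x, rfl⟩; exact ⟨e' x, ⟨x, rfl⟩, rfl⟩
    rw [h2]; exact h1
  have hn : ∀ x, ‖f x‖ ≤ C * ‖e' x‖ := h
  refine ⟨(f.extendOfNorm e') ∘L K.orthogonalProjectionOnto, fun x => ?_, fun ζ hζ => ?_⟩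
  · have h3 : K.orthogonalProjectionOnto (e x) = e' x :=
      Submodule.orthogonalProjectionOnto_mem_subspace_eq_self (e' x)
    rw [ContinuousLinearMap.comp_apply, h3]
    exact LinearMap.extendOfNorm_eq hd ⟨C, hn⟩ x
  · have : K.orthogonalProjectionOnto ζ = 0 := by
      rw [Submodule.orthogonalProjectionOnto_eq_zero_iff, hK, Submodule.orthogonal_closure,
        Submodule.mem_orthogonal]
      rintro _ ⟨x, rfl⟩; exact hζ x
    rw [ContinuousLinearMap.comp_apply, this, map_zero]

/-- complete positivity -/
theorem ce_cp {M N : VonNeumannAlgebra H} {F : BH H → BH H}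
    (hF : IsCondExp (M : Set (BH H)) (N : Set (BH H)) F) {ι : Type*} (s : Finset ι) (x : ι → BH H)
    (hx : ∀ i, x i ∈ M) (t : Finset ι) : ∀ (ξ : ι → H) (_ : ∀ i ∈ s, i ∉ t → ξ i = 0),
    0 ≤ ∑ i ∈ s, ∑ j ∈ s, (⟪F (star (x i) * x j) (ξ j), ξ i⟫_ℂ).re := by
  classical
  induction t using Finset.induction_on with
  | empty =>
    intro ξ h
    refine (Finset.sum_eq_zero fun i hi => Finset.sum_eq_zero fun j hj => ?_).ge
    rw [h i hi (by simp)]; simp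
  | insert a t ha ih =>
    intro ξ h
    have hxx : ∀ i j, star (x i) * x j ∈ M := fun i j => mul_mem (star_mem (hx i)) (hx j)
    let ev : BH H →ₗ[ℂ] H := (ContinuousLinearMap.apply ℂ H (ξ a)).toLinearMap
    set K : Submodule ℂ H := (N.toStarSubalgebra.toSubalgebra.toSubmodule).map ev with hK
    have hKm : ∀ n ∈ N, n (ξ a) ∈ K := fun n hn => ⟨n, hn, rfl⟩
    have hP : ∀ n ∈ N, pr K * n = n * pr K := by
      have h0 : ∀ n ∈ N, ∀ k ∈ K, n k ∈ K.topologicalClosure := by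
        rintro n hn _ ⟨m, hm, rfl⟩
        exact K.le_topologicalClosure ⟨n * m, (mul_mem hn (show m ∈ N from hm) : n * m ∈ N), rfl⟩
      intro n hn
      exact pr_commute (h0 n hn) (h0 _ (star_mem hn))
    have hpp := pr_proj K
    have split : ∀ n ∈ N, ∀ η ζ : H, ⟪n η, ζ⟫_ℂ = ⟪n (pr K η), pr K ζ⟫_ℂ + ⟪n (η - pr K η), ζ - pr K ζ⟫_ℂ := by
      intro n hn η ζ
      have h1 : ∀ η, n (pr K η) = pr K (n η) := fun η => (congrArg (fun S : BH H => S η) (hP n hn)).symm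
      have h2 : ∀ η ζ, ⟪pr K η, ζ⟫_ℂ = ⟪η, pr K ζ⟫_ℂ := fun η ζ => by
        rw [← star_inner, hpp.1.star_eq]
      have h3 : ∀ η, pr K (pr K η) = pr K η := fun η => congrArg (fun S : BH H => S η) hpp.2.eq
      rw [map_sub, h1, h2, h3, inner_sub_left, inner_sub_right, inner_sub_right, h2, h2, h3]
      ring
    have e1 : ∑ i ∈ s, ∑ j ∈ s, (⟪F (star (x i) * x j) (ξ j), ξ i⟫_ℂ).re
        = (∑ i ∈ s, ∑ j ∈ s, (⟪F (star (x i) * x j) (pr K (ξ j)), pr K (ξ i)⟫_ℂ).re)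
        + ∑ i ∈ s, ∑ j ∈ s, (⟪F (star (x i) * x j) (ξ j - pr K (ξ j)), ξ i - pr K (ξ i)⟫_ℂ).re := by
      rw [← Finset.sum_add_distrib]
      refine Finset.sum_congr rfl fun i _ => ?_
      rw [← Finset.sum_add_distrib]
      refine Finset.sum_congr rfl fun j _ => ?_
      rw [split _ (hF.maps_to _ (hxx i j)), Complex.add_re]
    rw [e1]
    refine add_nonneg ?_ (ih _ ?_)
    · -- approximation
      let Φ : (ι → H) → ℝ := fun η => ∑ i ∈ s, ∑ j ∈ s, (⟪F (star (x i) * x j) (η j), η i⟫_ℂ).re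
      have hΦ : Continuous Φ := by
        refine continuous_finsetSum _ fun i _ => continuous_finsetSum _ fun j _ => ?_
        refine Complex.continuous_re.comp (Continuous.inner ?_ ?_)
        · exact (F (star (x i) * x j)).continuous.comp (continuous_apply j)
        · exact continuous_apply i
      have hcl : IsClosed {η : ι → H | 0 ≤ Φ η} := isClosed_le continuous_const hΦ
      have hsub : Set.pi Set.univ (fun _ : ι => (K : Set H)) ⊆ {η : ι → H | 0 ≤ Φ η} := by
        intro η hη
        have : ∀ i, ∃ n ∈ N, n (ξ a) = η i := by
          intro i
          obtain ⟨n, hn, h⟩ := hη i trivial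
          exact ⟨n, hn, h⟩
        choose n hn hnη using this
        set y := ∑ j ∈ s, x j * n j with hy
        have hyM : y ∈ M := sum_mem fun j _ => mul_mem (hx j) (hF.subset (hn j))
        have e2 : Φ η = qf (F (star y * y)) (ξ a) := by
          have hsum : ∀ (r : Finset ι) (g : ι → BH H), (∀ i, g i ∈ M) → F (∑ i ∈ r, g i) = ∑ i ∈ r, F (g i) := by
            intro r g hg
            induction r using Finset.induction_on with
            | empty => simpa using ce_zero hF
            | insert b r hb ih2 =>
              rw [Finset.sum_insert hb, Finset.sum_insert hb, hF.map_add _ (hg b) _ (sum_mem fun i _ => hg i), ih2]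
          have e3 : star y * y = ∑ i ∈ s, ∑ j ∈ s, star (n i) * (star (x i) * x j) * n j := by
            rw [hy, star_sum, Finset.sum_mul_sum]
            refine Finset.sum_congr rfl fun i _ => Finset.sum_congr rfl fun j _ => ?_
            rw [star_mul]; noncomm_ring
          have hm : ∀ i j, star (n i) * (star (x i) * x j) * n j ∈ M := fun i j =>
            mul_mem (mul_mem (star_mem (hF.subset (hn i))) (hxx i j)) (hF.subset (hn j))
          rw [e3, hsum _ _ (fun i => sum_mem fun j _ => hm i j), qf_sum]
          refine Finset.sum_congr rfl fun i _ => ?_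
          rw [hsum _ _ (fun j => hm i j), qf_sum]
          refine Finset.sum_congr rfl fun j _ => ?_
          rw [hF.bimod _ (star_mem (hn i)) _ (hn j) _ (hxx i j)]
          unfold qf
          rw [mul_apply_eq_comp, mul_apply_eq_comp, star_inner, hnη, hnη]
        change 0 ≤ Φ η
        rw [e2]
        exact qf_nonneg (hF.pos _ (mul_mem (star_mem hyM) hyM) (star_mul_self_nonneg y)) _
      have hmem : (fun i => pr K (ξ i)) ∈ closure (Set.pi Set.univ (fun _ : ι => (K : Set H))) := by
        rw [closure_pi_set]
        exact fun i _ => pr_mem K (ξ i)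
      exact closure_minimal hsub hcl hmem
    · intro i hi hit
      by_cases hia : i = a
      · subst hia
        rw [pr_of_mem' (by simpa using hKm 1 (one_mem N)), sub_self]
      · rw [h i hi (by simp [hia, hit])]; simp
end P3
end Part3

section Part4
open Filter Topology
section P4
universe u
variable {H : Type u} [NormedAddCommGroup H] [InnerProductSpace ℂ H] [CompleteSpace H]
variable {L : Type*} [NormedAddCommGroup L] [InnerProductSpace ℂ L] [CompleteSpace L]

/-- normal unital star representations of a von Neumann algebra -/
structure IsRep (M : VonNeumannAlgebra H) (π : BH H → BH L) : Prop where
  add : ∀ x ∈ M, ∀ y ∈ M, π (x + y) = π x + π y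
  smul : ∀ (c : ℂ), ∀ x ∈ M, π (c • x) = c • π x
  mul : ∀ x ∈ M, ∀ y ∈ M, π (x * y) = π x * π y
  star : ∀ x ∈ M, π (star x) = star (π x)
  one : π 1 = 1
  normal : ∀ S : Set (BH H), S ⊆ M → S.Nonempty → DirectedOn (· ≤ ·) S → ∀ x ∈ M, IsLUB S x →
    ∀ ζ, ∀ ε > 0, ∃ s ∈ S, ∀ t ∈ S, s ≤ t → qf (π x - π t) ζ < ε

namespace IsRep
variable {M : VonNeumannAlgebra H} {π : BH H → BH L} (h : IsRep M π)
include h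
lemma zero : π 0 = 0 := by
  have := h.smul 0 0 (zero_mem M); simpa using this
lemma neg {x : BH H} (hx : x ∈ M) : π (-x) = - π x := by
  have := h.smul (-1) x hx; simpa using this
lemma sub {x y : BH H} (hx : x ∈ M) (hy : y ∈ M) : π (x - y) = π x - π y := by
  rw [sub_eq_add_neg, h.add x hx _ (neg_mem hy), h.neg hy, sub_eq_add_neg]
lemma rsmul (c : ℝ) {x : BH H} (hx : x ∈ M) : π (c • x) = c • π x := by
  have := h.smul (c : ℂ) x hx
  rwa [Complex.coe_smul, Complex.coe_smul] at this
lemma nonneg {x : BH H} (hx : x ∈ M) (h0 : 0 ≤ x) : 0 ≤ π x := by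
  obtain ⟨-, h2, h3⟩ := sqrt_fac h0
  have hm := vsqrt_mem hx h0
  rw [← h3, h.mul _ hm _ hm]
  nth_rewrite 1 [← h2]
  rw [h.star _ hm]
  exact star_mul_self_nonneg _
lemma mono {x y : BH H} (hx : x ∈ M) (hy : y ∈ M) (hxy : x ≤ y) : π x ≤ π y := by
  rw [← sub_nonneg, ← h.sub hy hx]
  exact h.nonneg (sub_mem hy hx) (sub_nonneg.2 hxy)
end IsRep

lemma qf_add_le {T : BH H} (h : 0 ≤ T) (a b : H) : qf T (a + b) ≤ 2 * qf T a + 2 * qf T b := by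
  rw [← norm_sqrt_apply h, ← norm_sqrt_apply h, ← norm_sqrt_apply h, map_add]
  have h1 := norm_add_le (CFC.sqrt T a) (CFC.sqrt T b)
  nlinarith [sq_nonneg (‖CFC.sqrt T a‖ - ‖CFC.sqrt T b‖), norm_nonneg (CFC.sqrt T a + CFC.sqrt T b), norm_nonneg (CFC.sqrt T a), norm_nonneg (CFC.sqrt T b)]

/-- conjugation preserves suprema (shifted version) -/
lemma conj_lub {S : Set (BH H)} (hne : S.Nonempty) (hd : DirectedOn (· ≤ ·) S)
    {x : BH H} (hx : IsLUB S x) {s0 : BH H} (hs0 : s0 ∈ S) (y : BH H) :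
    let S' := {z | ∃ s ∈ S, s0 ≤ s ∧ z = star y * (s - s0) * y}
    S'.Nonempty ∧ DirectedOn (· ≤ ·) S' ∧ IsLUB S' (star y * (x - s0) * y) := by
  intro S'
  have hne' : S'.Nonempty := ⟨_, s0, hs0, le_rfl, rfl⟩
  have hp : ∀ s, s0 ≤ s → IsSelfAdjoint (star y * (s - s0) * y) := fun s hs =>
    sa_of_nonneg (star_left_conjugate_nonneg (sub_nonneg.2 hs) y)
  refine ⟨hne', ?_, ?_⟩
  · rintro _ ⟨s, hs, h1, rfl⟩ _ ⟨t, ht, h2, rfl⟩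
    obtain ⟨r, hr, h3, h4⟩ := hd s hs t ht
    refine ⟨_, ⟨r, hr, h1.trans h3, rfl⟩, ?_, ?_⟩
    · exact star_left_conjugate_le_conjugate (sub_le_sub_right h3 _) y
    · exact star_left_conjugate_le_conjugate (sub_le_sub_right h4 _) y
  · refine isLUB_of_approx ?_ ?_ (hp x (hx.1 hs0)) ?_ hne'
    · rintro _ ⟨s, hs, h1, rfl⟩
      exact star_left_conjugate_le_conjugate (sub_le_sub_right (hx.1 hs) _) y
    · intro ξ ε hε
      obtain ⟨s, hs, h1⟩ := lub_approx hne hd hx (y ξ) (show 0 < ε / (‖y ξ‖ + 1) by positivity)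
      obtain ⟨t, ht, h2, h3⟩ := hd s hs s0 hs0
      refine ⟨_, ⟨t, ht, h3, rfl⟩, ?_⟩
      rw [qf_conj, qf_conj, qf_sub, qf_sub]
      have h4 := h1 t ht h2
      have : qf x (y ξ) - qf t (y ξ) ≤ ‖x (y ξ) - t (y ξ)‖ * ‖y ξ‖ := by
        rw [← qf_sub]
        unfold qf
        exact (Complex.re_le_norm _).trans (norm_inner_le_norm _ _)
      have h5 : ‖x (y ξ) - t (y ξ)‖ * ‖y ξ‖ ≤ ε / (‖y ξ‖ + 1) * ‖y ξ‖ := by gcongr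
      have h6 : ε / (‖y ξ‖ + 1) * ‖y ξ‖ < ε := by
        rw [div_mul_eq_mul_div, div_lt_iff₀ (by positivity)]
        nlinarith
      linarith
    · rintro _ ⟨s, hs, h1, rfl⟩
      exact hp s h1


/-- total sets -/
def Tot (G : Set L) : Prop := (Submodule.span ℂ G).topologicalClosure = ⊤

lemma Tot.top {G : Set L} (h : Tot G) (K : Submodule ℂ L) (hK : G ⊆ K) (hc : IsClosed (K : Set L)) : K = ⊤ := by
  rw [eq_top_iff, ← h]
  exact Submodule.topologicalClosure_minimal _ (Submodule.span_le.2 hK) hc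

lemma Tot.ext {L' : Type*} [NormedAddCommGroup L'] [InnerProductSpace ℂ L'] {G : Set L} (h : Tot G)
    {T1 T2 : L →L[ℂ] L'} (hT : ∀ g ∈ G, T1 g = T2 g) : T1 = T2 := by
  have := h.top (LinearMap.ker (T1 - T2 : L →L[ℂ] L').toLinearMap) (fun g hg => by simp [hT g hg])
    (ContinuousLinearMap.isClosed_ker _)
  ext ζ
  have h2 : ζ ∈ LinearMap.ker (T1 - T2 : L →L[ℂ] L').toLinearMap := by rw [this]; trivial
  simpa [sub_eq_zero] using h2

lemma Tot.zero {G : Set L} (h : Tot G) {ζ : L} (hT : ∀ g ∈ G, ⟪g, ζ⟫_ℂ = 0) : ζ = 0 := by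
  have : innerSL ℂ ζ = 0 := h.ext (fun g hg => by
    rw [innerSL_apply_apply, ← inner_conj_symm, hT g hg]; simp)
  have h2 : innerSL ℂ ζ ζ = 0 := by rw [this]; rfl
  simpa using h2

lemma qf_vsmul (T : BH H) (c : ℂ) (ξ : H) : qf T (c • ξ) = ‖c‖ ^ 2 * qf T ξ := by
  unfold qf
  rw [map_smul, inner_smul_left, inner_smul_right, ← mul_assoc, ← Complex.normSq_eq_conj_mul_self,
    Complex.re_ofReal_mul, Complex.normSq_eq_norm_sq]

lemma qf_le_apply (T : BH H) (ξ : H) : qf T ξ ≤ ‖T ξ‖ * ‖ξ‖ :=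
  (Complex.re_le_norm _).trans (norm_inner_le_norm _ _)

def vset (M : VonNeumannAlgebra H) (V : BH H → (H →L[ℂ] L)) : Set L := {ζ | ∃ x ∈ M, ∃ ξ, ζ = V x ξ}

lemma kolm_add {M N : VonNeumannAlgebra H} {F : BH H → BH H}
    (hF : IsCondExp (M : Set (BH H)) (N : Set (BH H)) F)
    {V : BH H → (H →L[ℂ] L)}
    (hV : ∀ x ∈ M, ∀ y ∈ M, ∀ ξ η, ⟪V x ξ, V y η⟫_ℂ = ⟪F (star y * x) ξ, η⟫_ℂ)
    (hd : Tot (vset M V)) {x y : BH H} (hx : x ∈ M) (hy : y ∈ M) : V (x + y) = V x + V y := by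
  ext ξ
  rw [← sub_eq_zero]
  refine hd.zero ?_
  rintro _ ⟨z, hz, η, rfl⟩
  rw [add_apply, inner_sub_right, inner_add_right, hV z hz _ (add_mem hx hy), hV z hz _ hx, hV z hz _ hy,
    star_add, add_mul, hF.map_add _ (mul_mem (star_mem hx) hz) _ (mul_mem (star_mem hy) hz), add_apply,
    inner_add_left, sub_self]

lemma kolm_smul {M N : VonNeumannAlgebra H} {F : BH H → BH H}
    (hF : IsCondExp (M : Set (BH H)) (N : Set (BH H)) F)
    {V : BH H → (H →L[ℂ] L)}
    (hV : ∀ x ∈ M, ∀ y ∈ M, ∀ ξ η, ⟪V x ξ, V y η⟫_ℂ = ⟪F (star y * x) ξ, η⟫_ℂ)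
    (hd : Tot (vset M V)) (c : ℂ) {x : BH H} (hx : x ∈ M) : V (c • x) = c • V x := by
  ext ξ
  rw [← sub_eq_zero]
  refine hd.zero ?_
  rintro _ ⟨z, hz, η, rfl⟩
  rw [smul_apply, inner_sub_right, inner_smul_right, hV z hz _ (vsmul_mem c hx), hV z hz _ hx,
    star_smul, smul_mul_assoc, hF.map_smul _ _ (mul_mem (star_mem hx) hz), smul_apply,
    inner_smul_left]
  simp

theorem kolm_rep {M N : VonNeumannAlgebra H} {F : BH H → BH H}
    (hF : IsCondExp (M : Set (BH H)) (N : Set (BH H)) F) (hn : IsNormalOn (M : Set (BH H)) F)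
    {V : BH H → (H →L[ℂ] L)}
    (hV : ∀ x ∈ M, ∀ y ∈ M, ∀ ξ η, ⟪V x ξ, V y η⟫_ℂ = ⟪F (star y * x) ξ, η⟫_ℂ)
    (hd : Tot (vset M V)) :
    ∃ π : BH H → BH L, IsRep M π ∧ ∀ a ∈ M, ∀ x ∈ M, ∀ ξ, π a (V x ξ) = V (a * x) ξ := by
  classical
  let A : BH H → ((M →₀ H) →ₗ[ℂ] L) := fun a =>
    Finsupp.lsum ℂ (fun x : M => (V (a * x)).toLinearMap)
  have hA1 : ∀ a (x : M) ξ, A a (Finsupp.single x ξ) = V (a * x) ξ := fun a x ξ => by simp [A]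
  have hAn : ∀ a ∈ M, ∀ f : M →₀ H, ‖A a f‖ ^ 2 = (∑ x ∈ f.support, ∑ y ∈ f.support,
      ⟪F (star (y : BH H) * (star a * a) * x) (f x), f y⟫_ℂ).re := by
    intro a ha f
    rw [← inner_self_eq_norm_sq (𝕜 := ℂ)]
    have : A a f = ∑ x ∈ f.support, V (a * x) (f x) := by simp [A, Finsupp.lsum_apply, Finsupp.sum]
    rw [this, sum_inner]
    simp_rw [inner_sum]
    change Complex.re _ = _
    congr 1
    refine Finset.sum_congr rfl fun x _ => Finset.sum_congr rfl fun y _ => ?_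
    rw [hV _ (mul_mem ha x.2) _ (mul_mem ha y.2), star_mul]
    simp only [mul_assoc]
  have hT : ∀ a ∈ M, ∃ T : BH L, ∀ x ∈ M, ∀ ξ, T (V x ξ) = V (a * x) ξ := by
    intro a ha
    have hpos : 0 ≤ (‖a‖ ^ 2 : ℝ) • (1 : BH H) - star a * a := by
      have h1 := le_norm_smul (star_mul_self_nonneg a)
      rw [CStarRing.norm_star_mul_self, ← pow_two] at h1
      exact sub_nonneg.2 h1
    have haM : star a * a ∈ M := mul_mem (star_mem ha) ha
    have hcM : (‖a‖ ^ 2 : ℝ) • (1 : BH H) - star a * a ∈ M := sub_mem (vrsmul_mem _ (one_mem M)) haM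
    obtain ⟨-, hc1, hc2⟩ := sqrt_fac hpos
    have hcc := vsqrt_mem hcM hpos
    generalize hc : CFC.sqrt ((‖a‖ ^ 2 : ℝ) • (1 : BH H) - star a * a) = c at *
    have key : ∀ f, ‖A a f‖ ≤ ‖a‖ * ‖A 1 f‖ := by
      intro f
      have : ‖A a f‖ ^ 2 + ‖A c f‖ ^ 2 = ‖a‖ ^ 2 * ‖A 1 f‖ ^ 2 := by
        rw [hAn a ha, hAn c hcc, hAn 1 (one_mem M), ← Complex.add_re, ← Complex.re_ofReal_mul]
        congr 1
        rw [← Finset.sum_add_distrib, Finset.mul_sum]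
        refine Finset.sum_congr rfl fun x _ => ?_
        rw [← Finset.sum_add_distrib, Finset.mul_sum]
        refine Finset.sum_congr rfl fun y _ => ?_
        rw [← inner_add_left, ← add_apply, ← hF.map_add _
          (mul_mem (mul_mem (star_mem y.2) haM) x.2) _
          (mul_mem (mul_mem (star_mem y.2) (mul_mem (star_mem hcc) hcc)) x.2), ← add_mul, ← mul_add, hc1, hc2]
        have : star (y : BH H) * (star a * a + ((‖a‖ ^ 2 : ℝ) • (1 : BH H) - star a * a)) * x =
          ((‖a‖ ^ 2 : ℝ) : ℂ) • (star (y : BH H) * (star 1 * 1) * x) := by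
          rw [Complex.coe_smul]; simp
        rw [this, hF.map_smul _ _ (mul_mem (mul_mem (star_mem y.2) (by simp [one_mem M])) x.2), smul_apply,
          inner_smul_left]
        simp
      have h2 := sq_nonneg ‖A c f‖
      refine abs_le_of_sq_le_sq' (by rw [mul_pow]; linarith) (by positivity) |>.2
    obtain ⟨T, hT, -⟩ := exists_ext (A 1) (A a) ‖a‖ key
    refine ⟨T, fun x hx ξ => ?_⟩
    have := hT (Finsupp.single ⟨x, hx⟩ ξ)
    rw [hA1, hA1] at this
    simpa using this
  clear_value A
  clear hA1 hAn A
  choose! π hπ using hT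
  have hadd : ∀ x ∈ M, ∀ y ∈ M, π (x + y) = π x + π y := by
    intro x hx y hy
    refine hd.ext ?_
    rintro _ ⟨z, hz, ξ, rfl⟩
    rw [add_apply, hπ _ (add_mem hx hy) _ hz, hπ _ hx _ hz, hπ _ hy _ hz, add_mul,
      kolm_add hF hV hd (mul_mem hx hz) (mul_mem hy hz), add_apply]
  have hsmul : ∀ (c : ℂ), ∀ x ∈ M, π (c • x) = c • π x := by
    intro c x hx
    refine hd.ext ?_
    rintro _ ⟨z, hz, ξ, rfl⟩
    rw [smul_apply, hπ _ (vsmul_mem c hx) _ hz, hπ _ hx _ hz, smul_mul_assoc,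
      kolm_smul hF hV hd c (mul_mem hx hz), smul_apply]
  have hmul : ∀ x ∈ M, ∀ y ∈ M, π (x * y) = π x * π y := by
    intro x hx y hy
    refine hd.ext ?_
    rintro _ ⟨z, hz, ξ, rfl⟩
    rw [mul_apply_eq_comp, hπ _ (mul_mem hx hy) _ hz, hπ _ hy _ hz, hπ _ hx _ (mul_mem hy hz), mul_assoc]
  have hstar : ∀ x ∈ M, π (star x) = star (π x) := by
    intro x hx
    refine hd.ext ?_
    rintro _ ⟨z, hz, ξ, rfl⟩
    rw [← sub_eq_zero]
    refine hd.zero ?_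
    rintro _ ⟨y, hy, η, rfl⟩
    rw [inner_sub_right, inner_star, hπ _ (star_mem hx) _ hz, hπ _ hx _ hy, hV _ hy _ (mul_mem (star_mem hx) hz),
      hV _ (mul_mem hx hy) _ hz, star_mul, star_star, mul_assoc, sub_self]
  have hone : π 1 = 1 := by
    refine hd.ext ?_
    rintro _ ⟨z, hz, ξ, rfl⟩
    rw [hπ _ (one_mem M) _ hz, one_mul]; rfl
  have hnn : ∀ x ∈ M, 0 ≤ x → 0 ≤ π x := by
    intro x hx h0
    obtain ⟨-, h2, h3⟩ := sqrt_fac h0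
    have hm := vsqrt_mem hx h0
    rw [← h3, hmul _ hm _ hm]
    nth_rewrite 1 [← h2]
    rw [hstar _ hm]
    exact star_mul_self_nonneg _
  have hsub : ∀ x ∈ M, ∀ y ∈ M, π (x - y) = π x - π y := by
    intro x hx y hy
    have h1 := hsmul (-1) y hy
    rw [neg_one_smul, neg_one_smul] at h1
    rw [sub_eq_add_neg, hadd x hx _ (neg_mem hy), h1, sub_eq_add_neg]
  have hmono : ∀ x ∈ M, ∀ y ∈ M, x ≤ y → π x ≤ π y := fun x hx y hy hxy => by
    rw [← sub_nonneg, ← hsub y hy x hx]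
    exact hnn _ (sub_mem hy hx) (sub_nonneg.2 hxy)
  refine ⟨π, ⟨hadd, hsmul, hmul, hstar, hone, ?_⟩, hπ⟩
  intro S hS hne hdir x hx hlub
  let K : Submodule ℂ L :=
    { carrier := {ζ | ∀ ε > 0, ∃ s ∈ S, ∀ t ∈ S, s ≤ t → qf (π x - π t) ζ < ε}
      zero_mem' := by
        intro ε hε
        obtain ⟨s, hs⟩ := hne
        exact ⟨s, hs, fun t _ _ => by simpa [qf] using hε⟩
      add_mem' := by
        intro a b ha hb ε hε
        obtain ⟨s, hs, h1⟩ := ha (ε / 4) (by positivity)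
        obtain ⟨s', hs', h2⟩ := hb (ε / 4) (by positivity)
        obtain ⟨r, hr, h3, h4⟩ := hdir s hs s' hs'
        refine ⟨r, hr, fun t ht hrt => ?_⟩
        have := qf_add_le (sub_nonneg.2 (hmono t (hS ht) x hx (hlub.1 ht))) a b
        have h5 := h1 t ht (h3.trans hrt)
        have h6 := h2 t ht (h4.trans hrt)
        linarith
      smul_mem' := by
        intro c a ha ε hε
        obtain ⟨s, hs, h1⟩ := ha (ε / (‖c‖ ^ 2 + 1)) (by positivity)
        refine ⟨s, hs, fun t ht hst => ?_⟩
        have h2 := h1 t ht hst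
        rw [qf_vsmul]
        rw [lt_div_iff₀ (by positivity)] at h2
        have := qf_nonneg (sub_nonneg.2 (hmono t (hS ht) x hx (hlub.1 ht))) a
        nlinarith }
  have hK : K = ⊤ := by
    refine hd.top K ?_ ?_
    · rintro _ ⟨y, hy, ξ, rfl⟩ ε hε
      obtain ⟨s0, hs0⟩ := hne
      obtain ⟨h1, h2, h3⟩ := conj_lub ⟨s0, hs0⟩ hdir hlub hs0 y
      have hM' : {z | ∃ s ∈ S, s0 ≤ s ∧ z = star y * (s - s0) * y} ⊆ (M : Set (BH H)) := by
        rintro _ ⟨s, hs, -, rfl⟩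
        exact mul_mem (mul_mem (star_mem hy) (sub_mem (hS hs) (hS hs0))) hy
      have hxM : star y * (x - s0) * y ∈ M := mul_mem (mul_mem (star_mem hy) (sub_mem hx (hS hs0))) hy
      have h4 := hn _ hM' h1 h2 _ hxM h3
      have hdF : DirectedOn (· ≤ ·) (F '' {z | ∃ s ∈ S, s0 ≤ s ∧ z = star y * (s - s0) * y}) := by
        rintro _ ⟨u, hu, rfl⟩ _ ⟨v, hv, rfl⟩
        obtain ⟨w, hw, h5, h6⟩ := h2 u hu v hv
        exact ⟨_, ⟨w, hw, rfl⟩, ce_mono hF (hM' hu) (hM' hw) h5, ce_mono hF (hM' hv) (hM' hw) h6⟩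
      obtain ⟨_, ⟨_, ⟨s, hs, hss, rfl⟩, rfl⟩, h6⟩ := lub_approx (h1.image _) hdF h4 ξ
        (show 0 < ε / (‖ξ‖ + 1) by positivity)
      refine ⟨s, hs, fun t ht hst => ?_⟩
      have htm : star y * (t - s0) * y ∈ {z | ∃ s ∈ S, s0 ≤ s ∧ z = star y * (s - s0) * y} :=
        ⟨t, ht, hss.trans hst, rfl⟩
      have hsm : star y * (s - s0) * y ∈ {z | ∃ s ∈ S, s0 ≤ s ∧ z = star y * (s - s0) * y} :=
        ⟨s, hs, hss, rfl⟩
      have h7 := h6 _ ⟨_, htm, rfl⟩ (ce_mono hF (hM' hsm) (hM' htm)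
        (star_left_conjugate_le_conjugate (sub_le_sub_right hst _) y))
      have h8 : qf (π x - π t) (V y ξ) = qf (F (star y * (x - s0) * y) - F (star y * (t - s0) * y)) ξ := by
        rw [← hsub x hx t (hS ht), ← ce_sub hF hxM (hM' htm)]
        unfold qf
        rw [hπ _ (sub_mem hx (hS ht)) _ hy, hV _ (mul_mem (sub_mem hx (hS ht)) hy) _ hy]
        congr 5
        noncomm_ring
      rw [h8]
      have h9 := qf_le_apply (F (star y * (x - s0) * y) - F (star y * (t - s0) * y)) ξ
      rw [sub_apply] at h9
      rw [lt_div_iff₀ (by positivity)] at h7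
      nlinarith [norm_nonneg (F (star y * (x - s0) * y) ξ - F (star y * (t - s0) * y) ξ)]
    · refine isClosed_of_closure_subset ?_
      intro ζ hζ ε hε
      obtain ⟨s0, hs0⟩ := hne
      have hCn := norm_nonneg (π x - π s0)
      obtain ⟨ζ', hζ', h1⟩ := Metric.mem_closure_iff.1 hζ (min 1 (ε / (4 * (‖π x - π s0‖ + 1)))) (by positivity)
      obtain ⟨s, hs, h2⟩ := hζ' (ε / 4) (by positivity)
      obtain ⟨r, hr, h3, h4⟩ := hdir s hs s0 hs0
      refine ⟨r, hr, fun t ht hrt => ?_⟩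
      have h5 := h2 t ht (h3.trans hrt)
      have hp := sub_nonneg.2 (hmono t (hS ht) x hx (hlub.1 ht))
      have h6 := qf_add_le hp ζ' (ζ - ζ')
      rw [add_sub_cancel] at h6
      have h7 := qf_mono (sub_le_sub_left (hmono s0 (hS hs0) t (hS ht) (h4.trans hrt)) (π x)) (ζ - ζ')
      have h8 := qf_le_norm (π x - π s0) (ζ - ζ')
      rw [dist_eq_norm, lt_min_iff, lt_div_iff₀ (by positivity)] at h1
      have h9 := norm_nonneg (ζ - ζ')
      have h10 : ‖ζ - ζ'‖ ^ 2 ≤ ‖ζ - ζ'‖ := by nlinarith [h1.1]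
      have h11 : ‖π x - π s0‖ * ‖ζ - ζ'‖ ^ 2 ≤ ‖π x - π s0‖ * ‖ζ - ζ'‖ := by gcongr
      nlinarith [h1.2]
  intro ζ
  have : ζ ∈ K := by rw [hK]; trivial
  exact this

lemma kolm_faithful {M N : VonNeumannAlgebra H} {F : BH H → BH H}
    (hF : IsCondExp (M : Set (BH H)) (N : Set (BH H)) F) (hf : FaithfulOn (M : Set (BH H)) F)
    {V : BH H → (H →L[ℂ] L)} {π : BH H → BH L}
    (hV : ∀ x ∈ M, ∀ y ∈ M, ∀ ξ η, ⟪V x ξ, V y η⟫_ℂ = ⟪F (star y * x) ξ, η⟫_ℂ)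
    (hπ : ∀ a ∈ M, ∀ x ∈ M, ∀ ξ, π a (V x ξ) = V (a * x) ξ) {x : BH H} (hx : x ∈ M) (h0 : π x = 0) : x = 0 := by
  have h1 : F (star x * x) = 0 := by
    ext ξ
    refine ext_inner_right ℂ fun η => ?_
    have h2 := hπ x hx 1 (one_mem M) ξ
    have h3 := hV x hx x hx ξ η
    rw [h0, mul_one] at h2
    rw [← h3, ← h2]; simp
  have h2 := hf _ (mul_mem (star_mem hx) hx) (star_mul_self_nonneg x) h1
  rwa [CStarRing.star_mul_self_eq_zero_iff] at h2

theorem kolm {M N : VonNeumannAlgebra H} {F : BH H → BH H}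
    (hF : IsCondExp (M : Set (BH H)) (N : Set (BH H)) F) (hn : IsNormalOn (M : Set (BH H)) F) :
    ∃ (L : Type u) (_ : NormedAddCommGroup L) (_ : InnerProductSpace ℂ L) (_ : CompleteSpace L)
      (V : BH H → (H →L[ℂ] L)) (π : BH H → BH L), IsRep M π ∧
      (∀ x ∈ M, ∀ y ∈ M, ∀ ξ η, ⟪V x ξ, V y η⟫_ℂ = ⟪F (star y * x) ξ, η⟫_ℂ) ∧
      (∀ a ∈ M, ∀ x ∈ M, ∀ ξ, π a (V x ξ) = V (a * x) ξ) ∧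
      Tot (vset M V) := by
  classical
  let K : Matrix M M (H →L[ℂ] H) := fun y x => F (star (y : BH H) * x)
  have hmm : ∀ x y : M, star (y : BH H) * x ∈ M := fun x y => mul_mem (star_mem y.2) x.2
  have hK : K.PosSemidef := by
    have key : K.IsHermitian ∧ ∀ vv : M →₀ H, 0 ≤ RCLike.re
        (vv.sum fun i xi => vv.sum fun j xj => ⟪K j i xi, xj⟫_ℂ) := ?_
    · exact ((RKHS.posSemidef_tfae (K := K)).out 0 2).2 key
    refine ⟨?_, ?_⟩
    · ext1 i j
      change star (K j i) = K i j
      change star (F (star (j : BH H) * i)) = F (star (i : BH H) * j)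
      rw [← ce_star hF (hmm _ _), star_mul, star_star]
    · intro vv
      have := ce_cp hF vv.support (fun i : M => (i : BH H)) (fun i => i.2) vv.support vv
        (fun i hi h => absurd hi h)
      rw [Finset.sum_comm] at this
      simp only [Finsupp.sum, map_sum]
      exact this
  haveI : Fact K.PosSemidef := ⟨hK⟩
  let L := RKHS.OfKernel K
  let V0 : M → (H →L[ℂ] L) := fun x => RKHS.kerFun L x
  have hV0 : ∀ (x y : M) (ξ η : H), ⟪V0 x ξ, V0 y η⟫_ℂ = ⟪F (star (y : BH H) * x) ξ, η⟫_ℂ := by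
    intro x y ξ η
    have := RKHS.kernel_inner L y x ξ η
    rw [RKHS.OfKernel.kernel_ofKernel] at this
    exact this.symm
  have hd0 := RKHS.kerFun_dense (𝕜 := ℂ) (X := M) (V := H) L
  let V : BH H → (H →L[ℂ] L) := fun x => if hx : x ∈ M then V0 ⟨x, hx⟩ else 0
  have hVV0 : ∀ x : M, V x = V0 x := fun x => by simp [V]
  have hV : ∀ x ∈ M, ∀ y ∈ M, ∀ ξ η, ⟪V x ξ, V y η⟫_ℂ = ⟪F (star y * x) ξ, η⟫_ℂ := by
    intro x hx y hy ξ η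
    have := hV0 ⟨x, hx⟩ ⟨y, hy⟩ ξ η
    rw [← hVV0, ← hVV0] at this
    exact this
  have hdense : Tot (vset M V) := by
    unfold Tot
    rw [eq_top_iff, ← hd0]
    refine Submodule.topologicalClosure_mono (Submodule.span_mono ?_)
    rintro _ ⟨x, v, rfl⟩
    exact ⟨x, x.2, v, by rw [hVV0]⟩
  obtain ⟨π, h1, h2⟩ := kolm_rep hF hn hV hdense
  exact ⟨L, inferInstance, inferInstance, inferInstance, V, π, h1, hV, h2, hdense⟩
end P4
end Part4

section Part5
open Filter Topology
section P5
variable {H : Type*} [NormedAddCommGroup H] [InnerProductSpace ℂ H] [CompleteSpace H]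
variable {L : Type*} [NormedAddCommGroup L] [InnerProductSpace ℂ L] [CompleteSpace L]
variable {L' : Type*} [NormedAddCommGroup L'] [InnerProductSpace ℂ L'] [CompleteSpace L']

lemma Tot.of_zero {G : Set L} (h : ∀ ζ, (∀ g ∈ G, ⟪g, ζ⟫_ℂ = 0) → ζ = 0) : Tot G := by
  unfold Tot
  rw [Submodule.topologicalClosure_eq_top_iff, Submodule.eq_bot_iff]
  intro ζ hζ
  exact h ζ fun g hg => hζ g (Submodule.subset_span hg)

def Intw (M : VonNeumannAlgebra H) (π : BH H → BH L) (ρ : BH H → BH L') (X : L →L[ℂ] L') : Prop :=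
  ∀ a ∈ M, ∀ ζ, X (π a ζ) = ρ a (X ζ)

lemma IsRep.lub_norm {M : VonNeumannAlgebra H} {ρ : BH H → BH L} (hρ : IsRep M ρ)
    {S : Set (BH H)} (hS : S ⊆ M) (hne : S.Nonempty) (hd : DirectedOn (· ≤ ·) S) (h0 : ∀ s ∈ S, 0 ≤ s)
    {x : BH H} (hx : x ∈ M) (hlub : IsLUB S x) (ζ : L) {ε : ℝ} (hε : 0 < ε) :
    ∃ s ∈ S, ‖ρ x ζ - ρ s ζ‖ < ε := by
  obtain ⟨s, hs, h1⟩ := hρ.normal S hS hne hd x hx hlub ζ (ε ^ 2 / (‖ρ x‖ + 1)) (by positivity)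
  refine ⟨s, hs, ?_⟩
  have h2 := h1 s hs le_rfl
  have h3 : 0 ≤ ρ x - ρ s := sub_nonneg.2 (hρ.mono (hS hs) hx (hlub.1 hs))
  have h4 := norm_apply_sq_le h3 ζ
  have h5 : ‖ρ x - ρ s‖ ≤ ‖ρ x‖ := norm_mono h3 (sub_le_self _ (hρ.nonneg (hS hs) (h0 s hs)))
  have h6 := qf_nonneg h3 ζ
  rw [lt_div_iff₀ (by positivity)] at h2
  rw [sub_apply] at h4
  refine lt_of_pow_lt_pow_left₀ 2 hε.le ?_
  nlinarith

theorem dominated_intw {M : VonNeumannAlgebra H} {π : BH H → BH L} {ρ : BH H → BH L'}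
    (hπ : IsRep M π) (hρ : IsRep M ρ) {c : BH H} (hc : c ∈ M) (hc0 : 0 ≤ c) (ξ : L) (ζ : L')
    (h : ∀ u ∈ M, 0 ≤ u → u ≤ c → qf (ρ u) ζ ≤ qf (π u) ξ) :
    ∃ X : L →L[ℂ] L', Intw M π ρ X ∧ ∃ ω, ρ c ζ = X ω := by
  obtain ⟨-, hk1, hk2⟩ := sqrt_fac hc0
  have hk := vsqrt_mem hc hc0
  generalize CFC.sqrt c = k at *
  let e : M.toStarSubalgebra →ₗ[ℂ] L :=
    { toFun := fun z => π z (π k ξ)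
      map_add' := fun a b => by
        change π ((a : BH H) + b) _ = _
        rw [hπ.add _ a.2 _ b.2]; rfl
      map_smul' := fun r b => by
        change π (r • (b : BH H)) _ = _
        rw [hπ.smul r _ b.2]; rfl }
  let f : M.toStarSubalgebra →ₗ[ℂ] L' :=
    { toFun := fun z => ρ z (ρ k ζ)
      map_add' := fun a b => by
        change ρ ((a : BH H) + b) _ = _
        rw [hρ.add _ a.2 _ b.2]; rfl
      map_smul' := fun r b => by
        change ρ (r • (b : BH H)) _ = _
        rw [hρ.smul r _ b.2]; rfl }
  have he : ∀ z (hz : z ∈ M), e ⟨z, hz⟩ = π z (π k ξ) := fun z hz => rfl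
  have hf : ∀ z (hz : z ∈ M), f ⟨z, hz⟩ = ρ z (ρ k ζ) := fun z hz => rfl
  clear_value e f
  have key : ∀ x, ‖f x‖ ≤ 1 * ‖e x‖ := by
    rintro ⟨z, hz'⟩
    have hz : z ∈ M := hz'
    rw [one_mul, he z hz, hf z hz]
    refine abs_le_of_sq_le_sq' ?_ (norm_nonneg _) |>.2
    have hzk : z * k ∈ M := mul_mem hz hk
    have e1 : ‖ρ z (ρ k ζ)‖ ^ 2 = qf (ρ (star (z * k) * (z * k))) ζ := by
      rw [hρ.mul _ (star_mem hzk) _ hzk, hρ.star _ hzk, qf_star_mul, hρ.mul _ hz _ hk]; rfl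
    have e2 : ‖π z (π k ξ)‖ ^ 2 = qf (π (star (z * k) * (z * k))) ξ := by
      rw [hπ.mul _ (star_mem hzk) _ hzk, hπ.star _ hzk, qf_star_mul, hπ.mul _ hz _ hk]; rfl
    rw [e1, e2]
    have hu : star (z * k) * (z * k) ∈ M := mul_mem (star_mem hzk) hzk
    have ht : 0 < (‖z‖ ^ 2 + 1)⁻¹ := by positivity
    have h1 := h ((‖z‖ ^ 2 + 1)⁻¹ • (star (z * k) * (z * k))) (vrsmul_mem _ hu)
      (smul_nonneg ht.le (star_mul_self_nonneg _)) (by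
        have : star (z * k) * (z * k) ≤ (‖z‖ ^ 2 + 1) • c := by
          refine le_of_qf (sa_of_nonneg (star_mul_self_nonneg _)) (sa_of_nonneg (smul_nonneg (by positivity) hc0)) ?_
          intro η
          have hck : qf c η = ‖k η‖ ^ 2 := by rw [← hk2, ← qf_star_mul, hk1]
          rw [qf_star_mul, qf_smul, hck]
          change ‖z (k η)‖ ^ 2 ≤ _
          have := z.le_opNorm (k η)
          nlinarith [norm_nonneg (z (k η)), sq_nonneg ‖k η‖, mul_self_le_mul_self (norm_nonneg (z (k η))) this]
        calc _ ≤ (‖z‖ ^ 2 + 1)⁻¹ • ((‖z‖ ^ 2 + 1) • c) := smul_le_smul_of_nonneg_left this ht.le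
          _ = c := by rw [smul_smul, inv_mul_cancel₀ (by positivity), one_smul])
    rw [hρ.rsmul _ hu, hπ.rsmul _ hu, qf_smul, qf_smul] at h1
    exact le_of_mul_le_mul_left h1 ht
  obtain ⟨X, hX1, hX2⟩ := exists_ext e f 1 key
  refine ⟨X, ?_, π k (π k ξ), ?_⟩
  · intro a ha ζ'
    have hT : Tot (Set.range e ∪ {ζ | ∀ x, ⟪e x, ζ⟫_ℂ = 0}) := by
      refine Tot.of_zero fun ω hω => ?_
      have h1 : ∀ x, ⟪e x, ω⟫_ℂ = 0 := fun x => hω _ (Or.inl ⟨x, rfl⟩)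
      exact inner_self_eq_zero.1 (hω ω (Or.inr h1))
    have : X ∘L π a = ρ a ∘L X := by
      refine hT.ext ?_
      rintro _ (⟨⟨z, hz'⟩, rfl⟩ | hg)
      · have hz : z ∈ M := hz'
        change X (π a (e ⟨z, hz⟩)) = ρ a (X (e ⟨z, hz⟩))
        rw [hX1, hf, he]
        have := hX1 ⟨a * z, mul_mem ha hz⟩
        rw [he _ (mul_mem ha hz), hf _ (mul_mem ha hz), hπ.mul _ ha _ hz, hρ.mul _ ha _ hz] at this
        exact this
      · rename_i g
        change X (π a g) = ρ a (X g)
        rw [hX2 g hg, map_zero]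
        refine hX2 _ ?_
        rintro ⟨z, hz'⟩
        have hz : z ∈ M := hz'
        have := hg ⟨star a * z, mul_mem (star_mem ha) hz⟩
        rw [he _ (mul_mem (star_mem ha) hz), hπ.mul _ (star_mem ha) _ hz, hπ.star _ ha] at this
        rw [he _ hz, ← this, ← star_inner]
        rfl
    exact congrArg (fun T => T ζ') this
  · have := hX1 ⟨k, hk⟩
    rw [he k hk, hf k hk] at this
    rw [this, ← hk2, hρ.mul _ hk _ hk]; rfl

theorem master {M : VonNeumannAlgebra H} {π : BH H → BH L} {ρ : BH H → BH L'}
    (hπ : IsRep M π) (hf : ∀ x ∈ M, π x = 0 → x = 0) (hρ : IsRep M ρ) :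
    Tot {ω : L' | ∃ X : L →L[ℂ] L', Intw M π ρ X ∧ ∃ ζ, ω = X ζ} := by
  unfold Tot
  set D := (Submodule.span ℂ {ω : L' | ∃ X : L →L[ℂ] L', Intw M π ρ X ∧ ∃ ζ, ω = X ζ}).topologicalClosure with hD
  have hDX : ∀ X : L →L[ℂ] L', Intw M π ρ X → ∀ ζ, X ζ ∈ D := fun X hX ζ =>
    Submodule.le_topologicalClosure _ (Submodule.subset_span ⟨X, hX, ζ, rfl⟩)
  have hDc : IsClosed (D : Set L') := Submodule.isClosed_topologicalClosure _
  clear_value D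
  rw [eq_top_iff]
  intro ζ _
  let Z : Set (BH H) := {x | x ∈ M ∧ 0 ≤ x ∧ x ≤ 1 ∧ ρ x ζ ∈ D}
  have hZ0 : (0 : BH H) ∈ Z := ⟨zero_mem M, le_rfl, zero_le_one, by rw [hρ.zero]; simp⟩
  obtain ⟨x, -, hx⟩ := zorn_le_nonempty₀ Z (by
    intro S hS hch y hy
    have hd := hch.directedOn
    obtain ⟨x, hx, -⟩ := directed_sup S ⟨y, hy⟩ hd ⟨1, fun s hs => (hS hs).2.2.1⟩
    have hSM : S ⊆ M := fun s hs => (hS hs).1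
    have hxM := lub_mem M hSM ⟨y, hy⟩ hd hx
    refine ⟨x, ⟨hxM, (hS hy).2.1.trans (hx.1 hy), hx.2 fun s hs => (hS hs).2.2.1, ?_⟩, hx.1⟩
    rw [← SetLike.mem_coe, ← hDc.closure_eq, Metric.mem_closure_iff]
    intro ε hε
    obtain ⟨s, hs, h1⟩ := hρ.lub_norm hSM ⟨y, hy⟩ hd (fun s hs => (hS hs).2.1) hxM hx ζ hε
    exact ⟨_, (hS hs).2.2.2, by rwa [dist_eq_norm]⟩) 0 hZ0
  obtain ⟨hxM, hx0, hx1, hxD⟩ := hx.prop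
  by_cases hx1' : x = 1
  · rw [hx1', hρ.one] at hxD; exact hxD
  exfalso
  have hpM : 1 - x ∈ M := sub_mem (one_mem M) hxM
  have hp0 : 0 ≤ 1 - x := sub_nonneg.2 hx1
  obtain ⟨ξ, hξ⟩ : ∃ ξ : L, qf (ρ (1 - x)) ζ < qf (π (1 - x)) ξ := by
    by_contra hcon
    push Not at hcon
    have h1 : π (1 - x) = 0 := by
      refine eq_zero_of_qf (hπ.nonneg hpM hp0) fun ξ => ?_
      by_contra h2
      have h3 : 0 < qf (π (1 - x)) ξ := lt_of_le_of_ne (qf_nonneg (hπ.nonneg hpM hp0) ξ) (Ne.symm h2)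
      have h4 := qf_nonneg (hρ.nonneg hpM hp0) ζ
      generalize qf (ρ (1 - x)) ζ = a at *
      generalize hb : qf (π (1 - x)) ξ = b at *
      have := hcon ((((a / b + 1 : ℝ)) : ℂ) • ξ)
      rw [qf_vsmul, hb, Complex.norm_real, Real.norm_of_nonneg (by positivity)] at this
      have h5 : a / b * b = a := div_mul_cancel₀ _ h3.ne'
      have h6 : 0 ≤ a / b := by positivity
      nlinarith [mul_nonneg h6 (mul_nonneg h6 h3.le)]
    exact hx1' (sub_eq_zero.1 (hf _ hpM h1)).symm
  generalize hpp : 1 - x = p at *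
  let Cc : Set (BH H) := {y | y ∈ M ∧ 0 ≤ y ∧ y ≤ p ∧ qf (π y) ξ ≤ qf (ρ y) ζ}
  have hC0 : (0 : BH H) ∈ Cc := ⟨zero_mem M, le_rfl, hp0, by rw [hρ.zero, hπ.zero, qf_zero, qf_zero]⟩
  obtain ⟨y, -, hy⟩ := zorn_le_nonempty₀ Cc (by
    intro S hS hch y hy
    have hd := hch.directedOn
    obtain ⟨x, hx, -⟩ := directed_sup S ⟨y, hy⟩ hd ⟨p, fun s hs => (hS hs).2.2.1⟩
    have hSM : S ⊆ M := fun s hs => (hS hs).1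
    have hxM := lub_mem M hSM ⟨y, hy⟩ hd hx
    refine ⟨x, ⟨hxM, (hS hy).2.1.trans (hx.1 hy), hx.2 fun s hs => (hS hs).2.2.1, ?_⟩, hx.1⟩
    refine le_of_forall_pos_le_add fun ε hε => ?_
    obtain ⟨s, hs, h1⟩ := hπ.normal S hSM ⟨y, hy⟩ hd x hxM hx ξ ε hε
    have h2 := h1 s hs le_rfl
    have h3 := (hS hs).2.2.2
    have h4 := qf_mono (hρ.mono (hSM hs) hxM (hx.1 hs)) ζ
    rw [qf_sub] at h2
    linarith) 0 hC0
  obtain ⟨hyM, hy0, hyp, hyq⟩ := hy.prop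
  have hc0 : 0 ≤ p - y := sub_nonneg.2 hyp
  have hcM : p - y ∈ M := sub_mem hpM hyM
  have hcne : p - y ≠ 0 := by
    intro h
    rw [sub_eq_zero] at h
    rw [← h] at hyq
    linarith
  obtain ⟨X, hX, ω, hω⟩ := dominated_intw hπ hρ hcM hc0 ξ ζ (by
    intro u hu hu0 huc
    by_contra! hlt
    have h1 : y + u ∈ Cc := by
      refine ⟨add_mem hyM hu, add_nonneg hy0 hu0, ?_, ?_⟩
      · have := add_le_add_left huc y
        simpa [add_comm] using this
      · rw [hπ.add _ hyM _ hu, hρ.add _ hyM _ hu, qf_add, qf_add]; linarith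
    have h2 := hy.le_of_ge h1 (le_add_of_nonneg_right hu0)
    have h3 : u = 0 := le_antisymm (by simpa using h2) hu0
    rw [h3, hπ.zero, hρ.zero, qf_zero, qf_zero] at hlt
    exact lt_irrefl _ hlt)
  have h1 : x + (p - y) ∈ Z := by
    refine ⟨add_mem hxM hcM, add_nonneg hx0 hc0, ?_, ?_⟩
    · rw [← hpp]; have := hy0
      calc x + (1 - x - y) = 1 - y := by abel
        _ ≤ 1 := sub_le_self _ hy0
    · rw [hρ.add _ hxM _ hcM, add_apply, hω]
      exact D.add_mem hxD (hDX X hX ω)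
  have h2 := hx.le_of_ge h1 (le_add_of_nonneg_right hc0)
  exact hcne (le_antisymm (by simpa using h2) hc0)
end P5
end Part5

section Part6
open Filter Topology
section P6
variable {H : Type*} [NormedAddCommGroup H] [InnerProductSpace ℂ H] [CompleteSpace H]
variable {L : Type*} [NormedAddCommGroup L] [InnerProductSpace ℂ L] [CompleteSpace L]
variable {L' : Type*} [NormedAddCommGroup L'] [InnerProductSpace ℂ L'] [CompleteSpace L']
variable {L'' : Type*} [NormedAddCommGroup L''] [InnerProductSpace ℂ L''] [CompleteSpace L'']

lemma inner_self_nonneg' (x : L) : 0 ≤ ⟪x, x⟫_ℂ := by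
  have := inner_nonneg_of (zero_le_one : (0 : BH L) ≤ 1) x
  exact this

lemma Intw.adjoint {M : VonNeumannAlgebra H} {π : BH H → BH L} {ρ : BH H → BH L'}
    (hπ : IsRep M π) (hρ : IsRep M ρ) {X : L →L[ℂ] L'} (hX : Intw M π ρ X) :
    Intw M ρ π (ContinuousLinearMap.adjoint X) := by
  intro a ha ζ
  refine ext_inner_right ℂ fun η => ?_
  have h1 := hX (star a) (star_mem ha) η
  rw [hπ.star a ha, hρ.star a ha] at h1
  rw [ContinuousLinearMap.adjoint_inner_left, ← inner_star (ρ a), ← h1, ← ContinuousLinearMap.adjoint_inner_left,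
    inner_star]

lemma Intw.comp {M : VonNeumannAlgebra H} {π : BH H → BH L} {ρ : BH H → BH L'} {σ : BH H → BH L''}
    {X : L →L[ℂ] L'} (hX : Intw M π ρ X) {Y : L' →L[ℂ] L''} (hY : Intw M ρ σ Y) : Intw M π σ (Y ∘L X) := by
  intro a ha ζ
  simp [hX a ha, hY a ha]

lemma lub_commute {S : Set (BH L)} (hne : S.Nonempty) (hd : DirectedOn (· ≤ ·) S) {x : BH L} (hx : IsLUB S x)
    {T : BH L} (h : ∀ s ∈ S, T * s = s * T) : T * x = x * T := by
  ext ξ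
  rw [← sub_eq_zero, ← norm_le_zero_iff]
  refine le_of_forall_pos_le_add fun ε hε => ?_
  obtain ⟨s, hs, h1⟩ := lub_approx hne hd hx ξ (show 0 < ε / (2 * (‖T‖ + 1)) by positivity)
  obtain ⟨s', hs', h2⟩ := lub_approx hne hd hx (T ξ) (show 0 < ε / 2 by positivity)
  obtain ⟨t, ht, h3, h4⟩ := hd s hs s' hs'
  have h5 := h1 t ht h3
  have h6 := h2 t ht h4
  have h7 : T (t ξ) = t (T ξ) := congrArg (fun A : BH L => A ξ) (h t ht)
  have h8 : (T * x) ξ - (x * T) ξ = T (x ξ - t ξ) - (x (T ξ) - t (T ξ)) := by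
    rw [map_sub, h7]; simp
  rw [h8]
  have h9 := norm_sub_le (T (x ξ - t ξ)) (x (T ξ) - t (T ξ))
  have h10 := T.le_opNorm (x ξ - t ξ)
  rw [lt_div_iff₀ (by positivity)] at h5
  nlinarith [norm_nonneg (x ξ - t ξ), norm_nonneg T]

theorem transfer_family {M : VonNeumannAlgebra H} {π : BH H → BH L} {ρ : BH H → BH L'}
    (hπ : IsRep M π) (hf : ∀ x ∈ M, π x = 0 → x = 0) (hρ : IsRep M ρ) :
    ∃ I : Set (L' →L[ℂ] L), (∀ U ∈ I, Intw M ρ π U) ∧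
      ∀ ζ, HasSum (fun U : I => ‖(U : L' →L[ℂ] L) ζ‖ ^ 2) (‖ζ‖ ^ 2) := by
  classical
  let Z : Set (Set (L' →L[ℂ] L)) := {I | (∀ U ∈ I, Intw M ρ π U) ∧
    ∀ F : Finset (L' →L[ℂ] L), (F : Set (L' →L[ℂ] L)) ⊆ I → ∀ ζ, ∑ U ∈ F, ‖U ζ‖ ^ 2 ≤ ‖ζ‖ ^ 2}
  have h0 : (∅ : Set (L' →L[ℂ] L)) ∈ Z := by
    refine ⟨fun U hU => hU.elim, fun F hF ζ => ?_⟩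
    have : F = ∅ := by rw [← Finset.coe_eq_empty]; exact Set.subset_empty_iff.1 hF
    simp [this]
  obtain ⟨I, -, hI⟩ := zorn_subset_nonempty Z (by
    intro c hc hch hne
    refine ⟨⋃₀ c, ⟨?_, ?_⟩, fun s hs => Set.subset_sUnion_of_mem hs⟩
    · rintro U ⟨s, hs, hU⟩
      exact (hc hs).1 U hU
    · intro F hF
      obtain ⟨s, hs, h1⟩ := hch.directedOn.exists_mem_subset_of_finite_of_subset_sUnion hne F.finite_toSet hF
      exact (hc hs).2 F h1) ∅ h0
  obtain ⟨hI1, hI2⟩ := hI.prop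
  refine ⟨I, hI1, ?_⟩
  let sm : Finset (L' →L[ℂ] L) → BH L' := fun F => ∑ U ∈ F, (ContinuousLinearMap.adjoint U ∘L U)
  have hsm : ∀ F ζ, qf (sm F) ζ = ∑ U ∈ F, ‖U ζ‖ ^ 2 := by
    intro F ζ
    simp only [sm, qf_sum]
    refine Finset.sum_congr rfl fun U _ => ?_
    unfold qf
    rw [ContinuousLinearMap.comp_apply, ContinuousLinearMap.adjoint_inner_left, inner_self_eq_norm_sq_to_K]
    norm_cast
  have hpos1 : ∀ U : L' →L[ℂ] L, 0 ≤ (ContinuousLinearMap.adjoint U ∘L U) := fun U =>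
    nonneg_of_inner fun ξ => by
      rw [ContinuousLinearMap.comp_apply, ContinuousLinearMap.adjoint_inner_left]
      exact inner_self_nonneg' _
  have hsmpos : ∀ F, 0 ≤ sm F := fun F => Finset.sum_nonneg fun U _ => hpos1 U
  have hsmmono : ∀ F G, F ⊆ G → sm F ≤ sm G := fun F G h =>
    Finset.sum_le_sum_of_subset_of_nonneg h fun U _ _ => hpos1 U
  have hsmc : ∀ F : Finset (L' →L[ℂ] L), (F : Set (L' →L[ℂ] L)) ⊆ I → ∀ a ∈ M, ρ a * sm F = sm F * ρ a := by
    intro F hF a ha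
    simp only [sm]
    rw [Finset.mul_sum, Finset.sum_mul]
    refine Finset.sum_congr rfl fun U hU => ?_
    have h1 := hI1 U (hF hU)
    have h2 := (h1.comp (h1.adjoint hρ hπ)) a ha
    ext ζ
    exact (h2 ζ).symm
  clear_value sm
  let S : Set (BH L') := {s | ∃ F : Finset (L' →L[ℂ] L), (F : Set (L' →L[ℂ] L)) ⊆ I ∧ s = sm F}
  have hSne : S.Nonempty := ⟨_, ∅, by simp, rfl⟩
  have hSd : DirectedOn (· ≤ ·) S := by
    rintro _ ⟨F, hF, rfl⟩ _ ⟨G, hG, rfl⟩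
    exact ⟨_, ⟨F ∪ G, by simp [hF, hG], rfl⟩, hsmmono _ _ Finset.subset_union_left, hsmmono _ _ Finset.subset_union_right⟩
  have hS1 : ∀ s ∈ S, s ≤ 1 := by
    rintro _ ⟨F, hF, rfl⟩
    refine le_of_qf (sa_of_nonneg (hsmpos F)) (IsSelfAdjoint.one _) fun ζ => ?_
    rw [hsm, qf_one]; exact hI2 F hF ζ
  obtain ⟨d, hd, hd'⟩ := directed_sup S hSne hSd ⟨1, hS1⟩
  have hd1 : d ≤ 1 := hd.2 hS1
  have hdc : ∀ a ∈ M, ρ a * d = d * ρ a := fun a ha => lub_commute hSne hSd hd (by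
    rintro _ ⟨F, hF, rfl⟩; exact hsmc F hF a ha)
  by_cases hdone : d = 1
  · intro ζ
    refine hasSum_of_isLUB_of_nonneg _ (fun U => by positivity) ⟨?_, ?_⟩
    · rintro _ ⟨F, rfl⟩
      have := hI2 (F.map (Function.Embedding.subtype _)) (by intro x hx; simp at hx; exact hx.1) ζ
      rw [Finset.sum_map] at this
      exact this
    · intro b hb
      refine le_of_forall_pos_le_add fun ε hε => ?_
      obtain ⟨_, ⟨F, hF, rfl⟩, h1⟩ := hd' ζ (ε / (‖ζ‖ + 1)) (by positivity)
      have h2 := h1 _ ⟨F, hF, rfl⟩ le_rfl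
      have h3 := qf_le_apply (d - sm F) ζ
      rw [qf_sub, hsm, hdone, qf_one, sub_apply] at h3
      rw [hdone, lt_div_iff₀ (by positivity)] at h2
      have h4 : ∑ U ∈ F, ‖U ζ‖ ^ 2 ≤ b := by
        refine hb ⟨F.subtype (· ∈ I), ?_⟩
        exact Finset.sum_subtype_of_mem (fun U : L' →L[ℂ] L => ‖U ζ‖ ^ 2) (fun x hx => hF hx)
      nlinarith [norm_nonneg ((1 : BH L') ζ - sm F ζ)]
  · exfalso
    have hD0 : 0 ≤ 1 - d := sub_nonneg.2 hd1
    have hDne : 1 - d ≠ 0 := fun h => hdone (sub_eq_zero.1 h).symm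
    obtain ⟨-, hk1, hk2⟩ := sqrt_fac hD0
    have hkn : ∀ ζ, ‖CFC.sqrt (1 - d) ζ‖ ^ 2 = qf (1 - d) ζ := norm_sqrt_apply hD0
    have hkc : ∀ a ∈ M, ρ a * CFC.sqrt (1 - d) = CFC.sqrt (1 - d) * ρ a := by
      intro a ha
      rw [CFC.sqrt_eq_real_sqrt _ hD0]
      have : Commute (1 - d) (ρ a) := by
        change (1 - d) * ρ a = ρ a * (1 - d)
        rw [sub_mul, mul_sub, hdc a ha, one_mul, mul_one]
      exact (this.cfcₙ_real _).symm.eq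
    generalize CFC.sqrt (1 - d) = k at *
    obtain ⟨X, hX, ζ, hζ⟩ : ∃ X : L →L[ℂ] L', Intw M π ρ X ∧ ∃ ζ, ContinuousLinearMap.adjoint X (k ζ) ≠ 0 := by
      by_contra! hcon
      have : k = 0 := by
        ext ζ
        refine (master hπ hf hρ).zero ?_
        rintro _ ⟨X, hX, ω, rfl⟩
        rw [← ContinuousLinearMap.adjoint_inner_right, hcon X hX ζ, inner_zero_right]
      rw [this] at hk2
      exact hDne (by rw [← hk2]; simp)
    obtain ⟨A, hA, hAle, ζ, hAζ⟩ : ∃ A : L' →L[ℂ] L, Intw M ρ π A ∧ (∀ ζ, ‖A ζ‖ ^ 2 ≤ qf (1 - d) ζ) ∧ ∃ ζ, A ζ ≠ 0 := by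
      set X' := ContinuousLinearMap.adjoint X with hX'
      have hpos : 0 < (‖X'‖ + 1)⁻¹ := by positivity
      have hX'i : Intw M ρ π X' := hX.adjoint hπ hρ
      clear_value X'
      refine ⟨((‖X'‖ + 1)⁻¹ : ℝ) • (X' ∘L k), ?_, ?_, ζ, ?_⟩
      · intro a ha ω
        have h1 : k (ρ a ω) = ρ a (k ω) := congrArg (fun T : BH L' => T ω) (hkc a ha).symm
        simp only [smul_apply, ContinuousLinearMap.comp_apply]
        rw [h1, hX'i a ha, ContinuousLinearMap.map_smul_of_tower]
      · intro ω
        rw [← hkn]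
        simp only [smul_apply, ContinuousLinearMap.comp_apply]
        rw [norm_smul, Real.norm_of_nonneg hpos.le]
        gcongr
        rw [inv_mul_le_iff₀ (by positivity)]
        nlinarith [X'.le_opNorm (k ω), norm_nonneg (k ω)]
      · simp only [smul_apply, ContinuousLinearMap.comp_apply]
        exact smul_ne_zero hpos.ne' hζ
    have hAn : 0 < ‖A ζ‖ := norm_pos_iff.2 hAζ
    have hlow : ∀ k : ℕ, (1 / 2 : ℝ) ≤ 1 / 2 + 1 / (k + 2) := fun k => by
      have : 0 < 1 / ((k : ℝ) + 2) := by positivity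
      linarith
    obtain ⟨n, hn⟩ : ∃ n : ℕ, (1 / 2 + 1 / ((n : ℝ) + 2) : ℝ) • A ∉ I := by
      by_contra! hcon
      have hinj : Function.Injective (fun n : ℕ => (1 / 2 + 1 / ((n : ℝ) + 2) : ℝ) • A) := by
        intro m n hmn
        have h1 := congrArg (fun T : L' →L[ℂ] L => T ζ) hmn
        simp only [smul_apply] at h1
        have h2 := smul_left_injective ℝ hAζ h1
        have h3 : (1 : ℝ) / (m + 2) = 1 / (n + 2) := by linarith
        rw [div_eq_div_iff (by positivity) (by positivity)] at h3
        have : (m : ℝ) = n := by linarith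
        exact_mod_cast this
      obtain ⟨N, hN⟩ := exists_nat_gt (‖ζ‖ ^ 2 / ((1 / 4) * ‖A ζ‖ ^ 2))
      have h1 := hI2 ((Finset.range N).image (fun n : ℕ => (1 / 2 + 1 / ((n : ℝ) + 2) : ℝ) • A))
        (by intro x hx; simp at hx; obtain ⟨m, -, rfl⟩ := hx; simpa using hcon m) ζ
      rw [Finset.sum_image (fun a _ b _ h => hinj h)] at h1
      have h2 : ∑ x ∈ Finset.range N, (1 / 4) * ‖A ζ‖ ^ 2 ≤
          ∑ x ∈ Finset.range N, ‖((1 / 2 + 1 / ((x : ℝ) + 2) : ℝ) • A) ζ‖ ^ 2 := by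
        refine Finset.sum_le_sum fun m _ => ?_
        rw [smul_apply, norm_smul, Real.norm_of_nonneg (by positivity), mul_pow]
        gcongr
        have := hlow m
        nlinarith
      rw [Finset.sum_const, Finset.card_range, nsmul_eq_mul] at h2
      rw [div_lt_iff₀ (by positivity)] at hN
      linarith
    have hc1 : (1 / 2 + 1 / ((n : ℝ) + 2) : ℝ) ≤ 1 := by
      have : 1 / ((n : ℝ) + 2) ≤ 1 / 2 := by
        apply one_div_le_one_div_of_le (by norm_num); linarith [Nat.cast_nonneg (α := ℝ) n]
      linarith
    have hc0 := hlow n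
    generalize (1 / 2 + 1 / ((n : ℝ) + 2) : ℝ) = c at *
    have hmem : insert (c • A) I ∈ Z := by
      refine ⟨?_, ?_⟩
      · rintro U (rfl | hU)
        · intro a ha ω
          simp only [smul_apply]
          rw [hA a ha, ContinuousLinearMap.map_smul_of_tower]
        · exact hI1 U hU
      · intro F hF ω
        have h1 : ∑ U ∈ F, ‖U ω‖ ^ 2 ≤ ∑ U ∈ insert (c • A) (F.erase (c • A)), ‖U ω‖ ^ 2 :=
          Finset.sum_le_sum_of_subset_of_nonneg (Finset.insert_erase_subset _ _) (fun _ _ _ => by positivity)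
        refine h1.trans ?_
        rw [Finset.sum_insert (Finset.notMem_erase _ _)]
        have hFI : ((F.erase (c • A) : Finset _) : Set (L' →L[ℂ] L)) ⊆ I := by
          intro U hU
          rw [Finset.coe_erase] at hU
          rcases hF hU.1 with h | h
          · exact absurd h hU.2
          · exact h
        rw [← hsm]
        have h2 := qf_mono (hd.1 ⟨_, hFI, rfl⟩) ω
        have h3 := hAle ω
        rw [qf_sub, qf_one] at h3
        have h4 : ‖(c • A) ω‖ ^ 2 ≤ ‖A ω‖ ^ 2 := by
          rw [smul_apply, norm_smul, Real.norm_of_nonneg (by linarith)]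
          gcongr
          exact mul_le_of_le_one_left (norm_nonneg _) hc1
        linarith
    exact hn (hI.le_of_ge hmem (Set.subset_insert _ _) (Set.mem_insert _ _))

/-- the map `T ↦ ∑ U* T U` -/
theorem sum_op {ι : Type*} (U : ι → L' →L[ℂ] L) (hU : ∀ ζ, HasSum (fun i => ‖U i ζ‖ ^ 2) (‖ζ‖ ^ 2)) (T : BH L) :
    ∃ A : BH L', ∀ ζ η, HasSum (fun i => ⟪T (U i ζ), U i η⟫_ℂ) ⟪A ζ, η⟫_ℂ := by
  have hmem : ∀ (T : BH L) ζ, Memℓp (fun i => T (U i ζ)) 2 := by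
    intro T ζ
    refine memℓp_gen ?_
    simp only [ENNReal.toReal_ofNat, Real.rpow_two]
    refine Summable.of_nonneg_of_le (fun i => by positivity) (fun i => ?_) ((hU ζ).summable.mul_left (‖T‖ ^ 2))
    rw [← mul_pow]
    gcongr
    exact T.le_opNorm _
  have hS : ∀ T : BH L, ∃ S : L' →L[ℂ] lp (fun _ : ι => L) 2, ∀ ζ i, S ζ i = T (U i ζ) := by
    intro T
    let S0 : L' →ₗ[ℂ] lp (fun _ : ι => L) 2 :=
      { toFun := fun ζ => ⟨fun i => T (U i ζ), hmem T ζ⟩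
        map_add' := fun a b => by
          ext i
          change T (U i (a + b)) = T (U i a) + T (U i b)
          rw [map_add, map_add]
        map_smul' := fun c b => by
          ext i
          change T (U i (c • b)) = c • T (U i b)
          rw [map_smul, map_smul] }
    refine ⟨S0.mkContinuous ‖T‖ fun ζ => ?_, fun ζ i => rfl⟩
    refine abs_le_of_sq_le_sq' ?_ (by positivity) |>.2
    have h1 := lp.hasSum_norm (p := 2) (by simp) (S0 ζ)
    simp only [ENNReal.toReal_ofNat, Real.rpow_two] at h1
    rw [mul_pow]
    refine hasSum_le (fun i => ?_) h1 ((hU ζ).mul_left (‖T‖ ^ 2))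
    rw [← mul_pow]
    gcongr
    exact T.le_opNorm _
  obtain ⟨S, hS1⟩ := hS T
  obtain ⟨S', hS2⟩ := hS 1
  refine ⟨ContinuousLinearMap.adjoint S' ∘L S, fun ζ η => ?_⟩
  have := lp.hasSum_inner (𝕜 := ℂ) (S ζ) (S' η)
  rw [ContinuousLinearMap.comp_apply, ContinuousLinearMap.adjoint_inner_left]
  simpa only [hS1, hS2, ContinuousLinearMap.one_apply] using this

lemma hasSum_congr' {ι : Type*} {f g : ι → ℂ} {a : ℂ} (h : ∀ i, f i = g i) : HasSum f a ↔ HasSum g a := by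
  rw [funext h]

structure IsTransfer (M : VonNeumannAlgebra H) (π : BH H → BH L) (ρ : BH H → BH L') (α : BH L → BH L') : Prop where
  add : ∀ S T, α (S + T) = α S + α T
  smul : ∀ (c : ℂ) T, α (c • T) = c • α T
  pos : ∀ T, 0 ≤ T → 0 ≤ α T
  one : α 1 = 1
  bimod : ∀ a ∈ M, ∀ b ∈ M, ∀ T, α (π a * T * π b) = ρ a * α T * ρ b
  comm : ∀ z : BH L, (∀ W, Intw M π π W → W * z = z * W) → ∀ Y, Intw M π ρ Y → α z ∘L Y = Y ∘L z

theorem transfer {M : VonNeumannAlgebra H} {π : BH H → BH L} {ρ : BH H → BH L'}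
    (hπ : IsRep M π) (hf : ∀ x ∈ M, π x = 0 → x = 0) (hρ : IsRep M ρ) :
    ∃ α, IsTransfer M π ρ α := by
  obtain ⟨I, hI, hU⟩ := transfer_family hπ hf hρ
  choose α hα using sum_op (fun U : I => (U : L' →L[ℂ] L)) hU
  have hone : α 1 = 1 := by
    rw [← ContinuousLinearMap.coe_inj, ← ext_inner_map]
    intro ζ
    refine (hα 1 ζ ζ).unique ?_
    have := (Complex.hasSum_ofReal.2 (hU ζ))
    simp only [ContinuousLinearMap.one_apply, ContinuousLinearMap.coe_coe]
    simp only [inner_self_eq_norm_sq_to_K]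
    simpa using this
  refine ⟨α, ?_, ?_, ?_, hone, ?_, ?_⟩
  · intro S T
    ext ζ
    refine ext_inner_right ℂ fun η => ?_
    rw [add_apply, inner_add_left]
    refine (hα (S + T) ζ η).unique ?_
    simpa [inner_add_left] using (hα S ζ η).add (hα T ζ η)
  · intro c T
    ext ζ
    refine ext_inner_right ℂ fun η => ?_
    rw [smul_apply, inner_smul_left]
    refine (hα (c • T) ζ η).unique ?_
    simpa [inner_smul_left, mul_comm] using (hα T ζ η).mul_left ((starRingEnd ℂ) c)
  · intro T hT
    refine nonneg_of_inner fun ζ => ?_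
    exact (hα T ζ ζ).nonneg fun i => inner_nonneg_of hT _
  · intro a ha b hb T
    ext ζ
    refine ext_inner_right ℂ fun η => ?_
    refine (hα _ ζ η).unique ?_
    have := hα T (ρ b ζ) (star (ρ a) η)
    rw [inner_star] at this
    change HasSum _ ⟪ρ a (α T (ρ b ζ)), η⟫_ℂ
    refine (hasSum_congr' fun i => ?_).1 this
    have h1 := hI i i.2 b hb ζ
    have h2 := hI i i.2 (star a) (star_mem ha) η
    rw [hρ.star a ha, hπ.star a ha] at h2
    rw [h1, h2, inner_star]
    rfl
  · intro z hz Y hY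
    ext ζ
    refine ext_inner_right ℂ fun η => ?_
    rw [ContinuousLinearMap.comp_apply, ContinuousLinearMap.comp_apply]
    have h1 := hα z (Y ζ) η
    have h2 := hα 1 (Y (z ζ)) η
    rw [hone, ContinuousLinearMap.one_apply] at h2
    refine h1.unique ((hasSum_congr' fun i => ?_).1 h2)
    have h3 : ((i : L' →L[ℂ] L) ∘L Y) * z = z * ((i : L' →L[ℂ] L) ∘L Y) := hz _ (hY.comp (hI i i.2))
    have h4 := congrArg (fun T : BH L => T ζ) h3
    rw [ContinuousLinearMap.one_apply]
    exact congrArg (fun v => ⟪v, (i : L' →L[ℂ] L) η⟫_ℂ) h4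
end P6
end Part6

section Part7
open Filter Topology
section P7
variable {H : Type*} [NormedAddCommGroup H] [InnerProductSpace ℂ H] [CompleteSpace H]
variable {L : Type*} [NormedAddCommGroup L] [InnerProductSpace ℂ L] [CompleteSpace L]

lemma isRep_id (M : VonNeumannAlgebra H) : IsRep M (fun x => x) where
  add := fun _ _ _ _ => rfl
  smul := fun _ _ _ => rfl
  mul := fun _ _ _ _ => rfl
  star := fun _ _ => rfl
  one := rfl
  normal := by
    intro S hS hne hd x hx hlub ζ ε hε
    obtain ⟨s, hs, h⟩ := lub_approx hne hd hlub ζ (show 0 < ε / (‖ζ‖ + 1) by positivity)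
    refine ⟨s, hs, fun t ht hst => ?_⟩
    have h1 := h t ht hst
    have h2 := qf_le_apply (x - t) ζ
    rw [sub_apply] at h2
    rw [lt_div_iff₀ (by positivity)] at h1
    nlinarith [norm_nonneg (x ζ - t ζ)]

lemma IsRep.mono_alg {M N : VonNeumannAlgebra H} (h : (N : Set (BH H)) ⊆ M) {π : BH H → BH L} (hπ : IsRep M π) :
    IsRep N π where
  add := fun x hx y hy => hπ.add x (h hx) y (h hy)
  smul := fun c x hx => hπ.smul c x (h hx)
  mul := fun x hx y hy => hπ.mul x (h hx) y (h hy)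
  star := fun x hx => hπ.star x (h hx)
  one := hπ.one
  normal := fun S hS hne hd x hx hlub => hπ.normal S (hS.trans h) hne hd x (h hx) hlub

theorem comm_gen {M M₁ M₂ : VonNeumannAlgebra H}
    (hg : Set.centralizer (Set.centralizer ((M₁ : Set (BH H)) ∪ (M₂ : Set (BH H)))) = M)
    {σ : BH H → BH L} (hσ : IsRep M σ) (h1M : (M₁ : Set (BH H)) ⊆ M) (h2M : (M₂ : Set (BH H)) ⊆ M) {T : BH L}
    (hT : ∀ x, x ∈ M₁ ∨ x ∈ M₂ → T * σ x = σ x * T) {x : BH H} (hx : x ∈ M) : T * σ x = σ x * T := by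
  have htot := master (isRep_id M) (fun x _ h => h) hσ
  refine htot.ext ?_
  rintro _ ⟨Y, hY, ω, rfl⟩
  rw [← sub_eq_zero]
  refine htot.zero ?_
  rintro _ ⟨Y', hY', η, rfl⟩
  have hY'a := hY'.adjoint (isRep_id M) hσ
  have hA : (ContinuousLinearMap.adjoint Y' ∘L T ∘L Y : BH H) ∈
      Set.centralizer ((M₁ : Set (BH H)) ∪ (M₂ : Set (BH H))) := by
    intro y hy
    have hyM : y ∈ M := by
      rcases hy with h | h
      · exact h1M h
      · exact h2M h
    ext ζ
    have h1 := hY'a y hyM (T (Y ζ))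
    have h2 := hY y hyM ζ
    have h3 : T (σ y (Y ζ)) = σ y (T (Y ζ)) := congrArg (fun A : BH L => A (Y ζ)) (hT y hy)
    change y ((ContinuousLinearMap.adjoint Y') (T (Y ζ))) = (ContinuousLinearMap.adjoint Y') (T (Y (y ζ)))
    rw [h2, h3, h1]
  have hx' : x ∈ Set.centralizer (Set.centralizer ((M₁ : Set (BH H)) ∪ (M₂ : Set (BH H)))) := by
    rw [hg]; exact hx
  have h1 := hx' _ hA
  have h2 := congrArg (fun A : BH H => A ω) h1
  have h3 : (ContinuousLinearMap.adjoint Y') (T (Y (x ω))) = x ((ContinuousLinearMap.adjoint Y') (T (Y ω))) := h2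
  rw [← ContinuousLinearMap.adjoint_inner_right]
  rw [mul_apply_eq_comp, mul_apply_eq_comp, ← hY x hx, map_sub, h3, hY'a x hx, sub_self, inner_zero_right]

theorem lemmaW {M M₁ M₂ : VonNeumannAlgebra H}
    (hg : Set.centralizer (Set.centralizer ((M₁ : Set (BH H)) ∪ (M₂ : Set (BH H)))) = M)
    {σ : BH H → BH L} (hσ : IsRep M σ) (h1M : (M₁ : Set (BH H)) ⊆ M) (h2M : (M₂ : Set (BH H)) ⊆ M)
    {W : Set (BH H)} (hWM : W ⊆ M) (hW1 : (1 : BH H) ∈ W)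
    (hW : ∀ m, m ∈ M₁ ∨ m ∈ M₂ → ∀ w ∈ W, m * w ∈ Submodule.span ℂ W) (α : L)
    (K : Submodule ℂ L) (hK : IsClosed (K : Set L)) (hKW : ∀ w ∈ W, σ w α ∈ K) {x : BH H} (hx : x ∈ M) :
    σ x α ∈ K := by
  set G : Submodule ℂ L := Submodule.span ℂ {v | ∃ w ∈ W, v = σ w α} with hGdef
  have hG : ∀ u ∈ Submodule.span ℂ W, u ∈ M ∧ σ u α ∈ G := by
    intro u hu
    induction hu using Submodule.span_induction with
    | mem u hu => exact ⟨hWM hu, Submodule.subset_span ⟨u, hu, rfl⟩⟩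
    | zero => exact ⟨zero_mem M, by rw [hσ.zero]; simp⟩
    | add u v _ _ h1 h2 =>
      refine ⟨add_mem h1.1 h2.1, ?_⟩
      rw [hσ.add _ h1.1 _ h2.1]; exact G.add_mem h1.2 h2.2
    | smul c u _ h1 =>
      refine ⟨vsmul_mem c h1.1, ?_⟩
      rw [hσ.smul c _ h1.1]; exact G.smul_mem c h1.2
  have hinv : ∀ m, m ∈ M₁ ∨ m ∈ M₂ → ∀ v ∈ G, σ m v ∈ G := by
    intro m hm v hv
    have hmM : m ∈ M := hm.elim (fun h => h1M h) (fun h => h2M h)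
    induction hv using Submodule.span_induction with
    | mem u hu =>
      obtain ⟨w, hw, rfl⟩ := hu
      have := (hG _ (hW m hm w hw)).2
      rw [hσ.mul _ hmM _ (hWM hw)] at this
      exact this
    | zero => simp
    | add u v _ _ h1 h2 => rw [map_add]; exact G.add_mem h1 h2
    | smul c u _ h1 => rw [map_smul]; exact G.smul_mem c h1
  have hc : ∀ m, m ∈ M₁ ∨ m ∈ M₂ → pr G * σ m = σ m * pr G := by
    intro m hm
    have hmM : m ∈ M := hm.elim (fun h => h1M h) (fun h => h2M h)
    refine pr_commute (fun v hv => G.le_topologicalClosure (hinv m hm v hv)) ?_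
    intro v hv
    rw [← hσ.star m hmM]
    exact G.le_topologicalClosure (hinv (star m) (hm.imp (fun h => star_mem h) (fun h => star_mem h)) v hv)
  have h1 := comm_gen hg hσ h1M h2M hc hx
  have hα : α ∈ G := by
    have := (hG 1 (Submodule.subset_span hW1)).2
    rwa [hσ.one] at this
  have h2 : pr G (σ x α) = σ x α := by
    have := congrArg (fun A : BH L => A α) h1
    simp only [mul_apply_eq_comp] at this
    rw [this, pr_of_mem' hα]
  have h3 : σ x α ∈ G.topologicalClosure := by rw [← h2]; exact pr_mem G _
  refine Submodule.topologicalClosure_minimal G ?_ hK h3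
  rw [hGdef, Submodule.span_le]
  rintro _ ⟨w, hw, rfl⟩
  exact hKW w hw

abbrev L2 (L : Type*) := PiLp 2 (fun _ : Bool => L)

def dg (A : BH L) : BH (L2 L) :=
  (PiLp.continuousLinearEquiv 2 ℂ (fun _ : Bool => L)).symm.toContinuousLinearMap ∘L
    (ContinuousLinearMap.pi fun i => A ∘L ContinuousLinearMap.proj i) ∘L
    (PiLp.continuousLinearEquiv 2 ℂ (fun _ : Bool => L)).toContinuousLinearMap

lemma dg_apply (A : BH L) (v : L2 L) (i : Bool) : dg A v i = A (v i) := rfl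

lemma dg_rep {M : VonNeumannAlgebra H} {σ : BH H → BH L} (hσ : IsRep M σ) : IsRep M (fun x => dg (σ x)) where
  add := fun x hx y hy => by ext v i; simp [dg_apply, hσ.add x hx y hy]
  smul := fun c x hx => by ext v i; simp [dg_apply, hσ.smul c x hx]
  mul := fun x hx y hy => by ext v i; simp [dg_apply, hσ.mul x hx y hy]
  star := fun x hx => by
    ext1 v
    refine ext_inner_right ℂ fun w => ?_
    rw [star_inner, PiLp.inner_apply, PiLp.inner_apply]
    refine Finset.sum_congr rfl fun i _ => ?_
    rw [dg_apply, dg_apply, hσ.star x hx, star_inner]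
  one := by ext v i; simp [dg_apply, hσ.one]
  normal := by
    intro S hS hne hd x hx hlub ζ ε hε
    obtain ⟨s, hs, h1⟩ := hσ.normal S hS hne hd x hx hlub (ζ false) (ε / 2) (by positivity)
    obtain ⟨s', hs', h2⟩ := hσ.normal S hS hne hd x hx hlub (ζ true) (ε / 2) (by positivity)
    obtain ⟨r, hr, h3, h4⟩ := hd s hs s' hs'
    refine ⟨r, hr, fun t ht hrt => ?_⟩
    have h5 := h1 t ht (h3.trans hrt)
    have h6 := h2 t ht (h4.trans hrt)
    have h7 : qf (dg (σ x) - dg (σ t)) ζ = qf (σ x - σ t) (ζ true) + qf (σ x - σ t) (ζ false) := by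
      unfold qf
      rw [PiLp.inner_apply, Fintype.sum_bool, Complex.add_re]
      rfl
    rw [h7]; linarith

theorem lemmaW2 {M M₁ M₂ : VonNeumannAlgebra H}
    (hg : Set.centralizer (Set.centralizer ((M₁ : Set (BH H)) ∪ (M₂ : Set (BH H)))) = M)
    {σ : BH H → BH L} (hσ : IsRep M σ) (h1M : (M₁ : Set (BH H)) ⊆ M) (h2M : (M₂ : Set (BH H)) ⊆ M)
    {W : Set (BH H)} (hWM : W ⊆ M) (hW1 : (1 : BH H) ∈ W)
    (hW : ∀ m, m ∈ M₁ ∨ m ∈ M₂ → ∀ w ∈ W, m * w ∈ Submodule.span ℂ W) (α β α' β' : L)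
    (h : ∀ w ∈ W, ⟪β, σ w α⟫_ℂ = ⟪β', σ w α'⟫_ℂ) {x : BH H} (hx : x ∈ M) :
    ⟪β, σ x α⟫_ℂ = ⟪β', σ x α'⟫_ℂ := by
  let v : L2 L := WithLp.toLp 2 (fun b => if b then α else α')
  let u : L2 L := WithLp.toLp 2 (fun b => if b then β else -β')
  have hin : ∀ x, ⟪u, dg (σ x) v⟫_ℂ = ⟪β, σ x α⟫_ℂ - ⟪β', σ x α'⟫_ℂ := by
    intro x
    rw [PiLp.inner_apply, Fintype.sum_bool, dg_apply, dg_apply]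
    simp [u, v, sub_eq_add_neg]
  have := lemmaW hg (dg_rep hσ) h1M h2M hWM hW1 hW v (LinearMap.ker (innerSL ℂ u).toLinearMap)
    (ContinuousLinearMap.isClosed_ker _) (by
      intro w hw
      rw [LinearMap.mem_ker]
      change ⟪u, dg (σ w) v⟫_ℂ = 0
      rw [hin, h w hw, sub_self]) hx
  rw [LinearMap.mem_ker] at this
  change ⟪u, dg (σ x) v⟫_ℂ = 0 at this
  rw [hin, sub_eq_zero] at this
  exact this
end P7
end Part7

section Part8
open Filter Topology
section P8
variable {H : Type*} [NormedAddCommGroup H] [InnerProductSpace ℂ H] [CompleteSpace H]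

inductive Alt (P : Bool → Set (BH H)) : Bool → List (BH H) → Prop
  | single (i : Bool) (x : BH H) (hx : x ∈ P i) : Alt P i [x]
  | cons (i : Bool) (x : BH H) (l : List (BH H)) (hx : x ∈ P i) (hl : Alt P (!i) l) : Alt P i (x :: l)

lemma Alt.get {P : Bool → Set (BH H)} {i : Bool} {l : List (BH H)} (h : Alt P i l) :
    ∀ (k : ℕ) (hk : k < l.length), l[k] ∈ P (if k % 2 = 0 then i else !i) := by
  induction h with
  | single i x hx => 
    intro k hk
    have : k = 0 := by simpa using hk
    subst this
    simpa using hx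
  | cons i x l hx hl ih =>
    intro k hk
    cases k with
    | zero => simpa using hx
    | succ k =>
      have h1 := ih k (by simpa using hk)
      have h2 : (if k % 2 = 0 then !i else !!i) = (if (k+1) % 2 = 0 then i else !i) := by
        rcases Nat.mod_two_eq_zero_or_one k with h | h
        · have : (k+1) % 2 = 1 := by omega
          simp [h, this]
        · have : (k+1) % 2 = 0 := by omega
          simp [h, this]
      rw [h2] at h1
      simpa using h1

lemma Alt.pos {P : Bool → Set (BH H)} {i : Bool} {l : List (BH H)} (h : Alt P i l) : 0 < l.length := by
  cases h <;> simp

/-- kernel letters -/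
def ker1 (N : VonNeumannAlgebra H) (E : BH H → BH H) : Set (BH H) := {x | x ∈ N ∧ E x = 0}

variable {M M₁ M₂ B : VonNeumannAlgebra H} {E : BH H → BH H}

lemma Alt.zero (hA : IsAFP M M₁ M₂ B E) {i : Bool} {l : List (BH H)}
    (h : Alt (fun b => if b then ker1 M₁ E else ker1 M₂ E) i l) : E l.prod = 0 := by
  have h1 := hA.free l.length (fun k => l[k]) (fun k => if k.1 % 2 = 0 then i else !i) h.pos (by
    intro k
    have h2 := h.get k.1 k.2
    revert h2
    generalize (if k.1 % 2 = 0 then i else !i) = c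
    cases c
    · intro h2; exact h2
    · intro h2; exact h2) (by
    intro k hk
    dsimp only
    rcases Nat.mod_two_eq_zero_or_one k with h | h
    · have : (k+1) % 2 = 1 := by omega
      simp [h, this]
    · have : (k+1) % 2 = 0 := by omega
      simp [h, this])
  rwa [show List.ofFn (fun k : Fin l.length => l[k]) = l from List.ofFn_getElem] at h1

inductive R22 (M₁ M₂ : VonNeumannAlgebra H) (E : BH H → BH H) : BH H → Prop
  | single (y : BH H) (hy : y ∈ ker1 M₂ E) : R22 M₁ M₂ E y
  | cons (y x r : BH H) (hy : y ∈ ker1 M₂ E) (hx : x ∈ ker1 M₁ E) (hr : R22 M₁ M₂ E r) : R22 M₁ M₂ E (y * x * r)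

lemma ker1_star (hE : IsCondExp (M : Set (BH H)) (B : Set (BH H)) E) {N : VonNeumannAlgebra H}
    (hN : (N : Set (BH H)) ⊆ M) {x : BH H} (hx : x ∈ ker1 N E) : star x ∈ ker1 N E :=
  ⟨star_mem hx.1, by rw [ce_star hE (hN hx.1), hx.2, star_zero]⟩

lemma ker1_left (hE : IsCondExp (M : Set (BH H)) (B : Set (BH H)) E) {N : VonNeumannAlgebra H}
    (hN : (N : Set (BH H)) ⊆ M) (hB : (B : Set (BH H)) ⊆ N) {b x : BH H} (hb : b ∈ B) (hx : x ∈ ker1 N E) :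
    b * x ∈ ker1 N E :=
  ⟨mul_mem (hB hb) hx.1, by rw [ce_left hE hb (hN hx.1), hx.2, mul_zero]⟩

lemma ker1_right (hE : IsCondExp (M : Set (BH H)) (B : Set (BH H)) E) {N : VonNeumannAlgebra H}
    (hN : (N : Set (BH H)) ⊆ M) (hB : (B : Set (BH H)) ⊆ N) {b x : BH H} (hb : b ∈ B) (hx : x ∈ ker1 N E) :
    x * b ∈ ker1 N E :=
  ⟨mul_mem hx.1 (hB hb), by rw [ce_right hE hb (hN hx.1), hx.2, zero_mul]⟩

lemma ker1_dec (hE : IsCondExp (M : Set (BH H)) (B : Set (BH H)) E) {N : VonNeumannAlgebra H}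
    (hN : (N : Set (BH H)) ⊆ M) (hB : (B : Set (BH H)) ⊆ N) {x : BH H} (hx : x ∈ N) :
    x - E x ∈ ker1 N E :=
  ⟨sub_mem hx (hB (hE.maps_to x (hN hx))), by
    have h := hE.maps_to x (hN hx)
    rw [ce_sub hE (hN hx) (hE.subset h), hE.fixes _ h, sub_self]⟩

lemma R22.mem (hA : IsAFP M M₁ M₂ B E) {r : BH H} (hr : R22 M₁ M₂ E r) : r ∈ M := by
  induction hr with
  | single y hy => exact hA.le₂M hy.1
  | cons y x r hy hx _ ih => exact mul_mem (mul_mem (hA.le₂M hy.1) (hA.le₁M hx.1)) ih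

lemma R22.join {r r' x : BH H} (hr : R22 M₁ M₂ E r) (hr' : R22 M₁ M₂ E r') (hx : x ∈ ker1 M₁ E) :
    R22 M₁ M₂ E (r * x * r') := by
  induction hr with
  | single y hy => exact R22.cons y x r' hy hx hr'
  | cons y x' r hy hx' _ ih =>
    have := R22.cons y x' _ hy hx' ih
    rwa [show y * x' * (r * x * r') = y * x' * r * x * r' by simp only [mul_assoc]] at this

lemma R22.star (hA : IsAFP M M₁ M₂ B E) {r : BH H} (hr : R22 M₁ M₂ E r) : R22 M₁ M₂ E (star r) := by
  induction hr with
  | single y hy => exact R22.single _ (ker1_star hA.condExp hA.le₂M hy)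
  | cons y x r hy hx _ ih =>
    rw [star_mul, star_mul, ← mul_assoc]
    exact ih.join (R22.single _ (ker1_star hA.condExp hA.le₂M hy)) (ker1_star hA.condExp hA.le₁M hx)

lemma R22.left (hA : IsAFP M M₁ M₂ B E) {r b : BH H} (hr : R22 M₁ M₂ E r) (hb : b ∈ B) : R22 M₁ M₂ E (b * r) := by
  cases hr with
  | single y hy => exact R22.single _ (ker1_left hA.condExp hA.le₂M hA.le₂ hb hy)
  | cons y x r hy hx hr =>
    rw [← mul_assoc, ← mul_assoc]
    exact R22.cons _ _ _ (ker1_left hA.condExp hA.le₂M hA.le₂ hb hy) hx hr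

lemma R22.list {r : BH H} (hr : R22 M₁ M₂ E r) : ∃ l : List (BH H), l.prod = r ∧
    Alt (fun b => if b then ker1 M₁ E else ker1 M₂ E) false l ∧
    ∀ x ∈ ker1 M₁ E, Alt (fun b => if b then ker1 M₁ E else ker1 M₂ E) false (l ++ [x]) := by
  induction hr with
  | single y hy =>
    exact ⟨[y], by simp, Alt.single _ _ hy, fun x hx => Alt.cons _ _ _ hy (Alt.single _ _ hx)⟩
  | cons y x r hy hx _ ih =>
    obtain ⟨l, h1, h2, h3⟩ := ih
    refine ⟨y :: x :: l, by simp [h1, mul_assoc], Alt.cons _ _ _ hy (Alt.cons _ _ _ hx h2), fun x' hx' => ?_⟩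
    exact Alt.cons _ _ _ hy (Alt.cons _ _ _ hx (h3 x' hx'))

lemma R22.zero (hA : IsAFP M M₁ M₂ B E) {r a b : BH H} (hr : R22 M₁ M₂ E r) (ha : a ∈ M₁) (hb : b ∈ M₁) :
    E (a * r * b) = 0 := by
  have hE := hA.condExp
  obtain ⟨l, h1, h2, h3⟩ := hr.list
  have hrM := hr.mem hA
  have haM := hA.le₁M ha
  have hbM := hA.le₁M hb
  have ha' := ker1_dec hE hA.le₁M hA.le₁ ha
  have hb' := ker1_dec hE hA.le₁M hA.le₁ hb
  have hEa := hE.maps_to a haM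
  have hEb := hE.maps_to b hbM
  have e0 : E r = 0 := by rw [← h1]; exact h2.zero hA
  have e1 : E ((a - E a) * r) = 0 := by
    have := Alt.zero hA (Alt.cons true _ _ ha' h2)
    rwa [List.prod_cons, h1] at this
  have e2 : E (r * (b - E b)) = 0 := by
    have := Alt.zero hA (h3 _ hb')
    rwa [List.prod_append, h1, List.prod_singleton] at this
  have e3 : E ((a - E a) * (r * (b - E b))) = 0 := by
    have := Alt.zero hA (Alt.cons true _ _ ha' (h3 _ hb'))
    rwa [List.prod_cons, List.prod_append, h1, List.prod_singleton] at this
  have d : a * r * b = E a * r * E b + E a * (r * (b - E b)) + (a - E a) * r * E b + (a - E a) * (r * (b - E b)) := by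
    noncomm_ring
  have m1 : E a ∈ M := hE.subset hEa
  have m2 : E b ∈ M := hE.subset hEb
  have m3 : a - E a ∈ M := sub_mem haM m1
  have m4 : b - E b ∈ M := sub_mem hbM m2
  rw [d, hE.map_add _ (add_mem (add_mem (mul_mem (mul_mem m1 hrM) m2) (mul_mem m1 (mul_mem hrM m4))) (mul_mem (mul_mem m3 hrM) m2)) _ (mul_mem m3 (mul_mem hrM m4)),
    hE.map_add _ (add_mem (mul_mem (mul_mem m1 hrM) m2) (mul_mem m1 (mul_mem hrM m4))) _ (mul_mem (mul_mem m3 hrM) m2),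
    hE.map_add _ (mul_mem (mul_mem m1 hrM) m2) _ (mul_mem m1 (mul_mem hrM m4)), e3,
    hE.bimod _ hEa _ hEb _ hrM, e0, ce_left hE hEa (mul_mem hrM m4), e2, ce_right hE hEb (mul_mem m3 hrM), e1]
  simp

def Wd (M₁ M₂ : VonNeumannAlgebra H) (E : BH H → BH H) : Set (BH H) :=
  {w | w ∈ M₁ ∨ ∃ a b r, a ∈ M₁ ∧ b ∈ M₁ ∧ R22 M₁ M₂ E r ∧ w = a * r * b}

lemma Wd_sub (hA : IsAFP M M₁ M₂ B E) : Wd M₁ M₂ E ⊆ M := by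
  rintro w (h | ⟨a, b, r, ha, hb, hr, rfl⟩)
  · exact hA.le₁M h
  · exact mul_mem (mul_mem (hA.le₁M ha) (hr.mem hA)) (hA.le₁M hb)

lemma Wd_one : (1 : BH H) ∈ Wd M₁ M₂ E := Or.inl (one_mem M₁)

lemma Wd_mul (hA : IsAFP M M₁ M₂ B E) : ∀ m, m ∈ M₁ ∨ m ∈ M₂ → ∀ w ∈ Wd M₁ M₂ E,
    m * w ∈ Submodule.span ℂ (Wd M₁ M₂ E) := by
  have hE := hA.condExp
  have h1 : ∀ m ∈ M₁, ∀ w ∈ Wd M₁ M₂ E, m * w ∈ Wd M₁ M₂ E := by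
    rintro m hm w (h | ⟨a, b, r, ha, hb, hr, rfl⟩)
    · exact Or.inl (mul_mem hm h)
    · exact Or.inr ⟨m * a, b, r, mul_mem hm ha, hb, hr, by simp only [mul_assoc]⟩
  have hR : ∀ r b, R22 M₁ M₂ E r → b ∈ M₁ → r * b ∈ Wd M₁ M₂ E := fun r b hr hb =>
    Or.inr ⟨1, b, r, one_mem _, hb, hr, by rw [one_mul]⟩
  have sp : ∀ w ∈ Wd M₁ M₂ E, w ∈ Submodule.span ℂ (Wd M₁ M₂ E) := fun w hw => Submodule.subset_span hw
  -- y r b with y in M₂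
  have h2 : ∀ y ∈ M₂, ∀ r, R22 M₁ M₂ E r → ∀ b ∈ M₁, y * r * b ∈ Submodule.span ℂ (Wd M₁ M₂ E) := by
    intro y hy r hr b hb
    cases hr with
    | single _ hz =>
      have hm : y * r ∈ M₂ := mul_mem hy hz.1
      have hd := ker1_dec hE hA.le₂M hA.le₂ hm
      rw [show y * r * b = E (y * r) * b + (y * r - E (y * r)) * b by noncomm_ring]
      exact Submodule.add_mem _ (sp _ (Or.inl (mul_mem (hA.le₁ (hE.maps_to _ (hA.le₂M hm))) hb)))
        (sp _ (hR _ _ (R22.single _ hd) hb))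
    | cons z x r hz hx hr =>
      have hm : y * z ∈ M₂ := mul_mem hy hz.1
      have hd := ker1_dec hE hA.le₂M hA.le₂ hm
      rw [show y * (z * x * r) * b = (E (y * z) * x) * r * b + ((y * z - E (y * z)) * x * r) * b by noncomm_ring]
      exact Submodule.add_mem _ (sp _ (Or.inr ⟨_, b, r, (mul_mem (hA.le₁ (hE.maps_to _ (hA.le₂M hm))) hx.1), hb, hr, rfl⟩))
        (sp _ (hR _ _ (R22.cons _ _ _ hd hx hr) hb))
  rintro m (hm | hm) w hw
  · exact sp _ (h1 m hm w hw)
  · have hd := ker1_dec hE hA.le₂M hA.le₂ hm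
    have hEm := hA.le₁ (hE.maps_to m (hA.le₂M hm))
    rcases hw with h | ⟨a, b, r, ha, hb, hr, rfl⟩
    · rw [show m * w = E m * w + (m - E m) * w by noncomm_ring]
      exact Submodule.add_mem _ (sp _ (Or.inl (mul_mem hEm h))) (sp _ (hR _ _ (R22.single _ hd) h))
    · have ha' := ker1_dec hE hA.le₁M hA.le₁ ha
      have hEa := hE.maps_to a (hA.le₁M ha)
      rw [show m * (a * r * b) = (m * E a) * r * b + (E m * (a - E a)) * r * b + ((m - E m) * (a - E a) * r) * b by noncomm_ring]
      refine Submodule.add_mem _ (Submodule.add_mem _ (h2 _ (mul_mem hm (hA.le₂ hEa)) r hr b hb) ?_) ?_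
      · exact sp _ (Or.inr ⟨_, b, r, mul_mem hEm ha'.1, hb, hr, rfl⟩)
      · exact sp _ (hR _ _ (R22.cons _ _ _ hd ha' hr) hb)
end P8
end Part8

section Part9
open Filter Topology
section P9
variable {H : Type*} [NormedAddCommGroup H] [InnerProductSpace ℂ H] [CompleteSpace H]
variable {L : Type*} [NormedAddCommGroup L] [InnerProductSpace ℂ L] [CompleteSpace L]

structure IsKolm (M : VonNeumannAlgebra H) (F : BH H → BH H) (V : BH H → (H →L[ℂ] L)) (π : BH H → BH L) : Prop where
  rep : IsRep M π
  inn : ∀ x ∈ M, ∀ y ∈ M, ∀ ξ η, ⟪V x ξ, V y η⟫_ℂ = ⟪F (star y * x) ξ, η⟫_ℂ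
  act : ∀ a ∈ M, ∀ x ∈ M, ∀ ξ, π a (V x ξ) = V (a * x) ξ
  tot : Tot (vset M V)

variable {M M₁ M₂ B : VonNeumannAlgebra H} {E : BH H → BH H}

theorem exists_e (hA : IsAFP M M₁ M₂ B E) {V : BH H → (H →L[ℂ] L)} {π : BH H → BH L} (hk : IsKolm M E V π) :
    ∃ e : BH L, IsProjection e ∧ (∀ b ∈ B, e * π b = π b * e) ∧ (∀ x ∈ M₁, e * π x * e = π (E x) * e) ∧
      (∀ r, R22 M₁ M₂ E r → e * π r * (1 - e) = π r * (1 - e)) := by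
  have hE := hA.condExp
  have hπ := hk.rep
  have hadd : ∀ x ∈ M, ∀ y ∈ M, ∀ ξ, V (x + y) ξ = V x ξ + V y ξ := fun x hx y hy ξ => by
    rw [kolm_add hE hk.inn hk.tot hx hy]; rfl
  let K : Submodule ℂ L := Submodule.span ℂ {v | ∃ r b ξ, R22 M₁ M₂ E r ∧ b ∈ M₁ ∧ v = V (r * b) ξ}
  let K0 : Submodule ℂ L := Submodule.span ℂ ({v | ∃ m ξ, m ∈ M₁ ∧ v = V m ξ} ∪
    {v | ∃ a r b ξ, a ∈ ker1 M₁ E ∧ R22 M₁ M₂ E r ∧ b ∈ M₁ ∧ v = V (a * r * b) ξ})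
  have hKm : ∀ r b ξ, R22 M₁ M₂ E r → b ∈ M₁ → V (r * b) ξ ∈ K := fun r b ξ hr hb =>
    Submodule.subset_span ⟨r, b, ξ, hr, hb, rfl⟩
  have hK0m : ∀ m ξ, m ∈ M₁ → V m ξ ∈ K0 := fun m ξ hm => Submodule.subset_span (Or.inl ⟨m, ξ, hm, rfl⟩)
  have hK0a : ∀ a r b ξ, a ∈ ker1 M₁ E → R22 M₁ M₂ E r → b ∈ M₁ → V (a * r * b) ξ ∈ K0 := fun a r b ξ ha hr hb =>
    Submodule.subset_span (Or.inr ⟨a, r, b, ξ, ha, hr, hb, rfl⟩)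
  -- K ⟂ K0
  have horth : ∀ k ∈ K, ∀ k' ∈ K0, ⟪k, k'⟫_ℂ = 0 := by
    intro k hk1 k' hk'
    have : K ≤ LinearMap.ker (innerSL ℂ k').toLinearMap := by
      refine Submodule.span_le.2 ?_
      rintro _ ⟨r, b, ξ, hr, hb, rfl⟩
      rw [SetLike.mem_coe, LinearMap.mem_ker]
      change ⟪k', V (r * b) ξ⟫_ℂ = 0
      rw [← inner_conj_symm]
      suffices h : ⟪V (r * b) ξ, k'⟫_ℂ = 0 by rw [h]; simp
      have hM : r * b ∈ M := mul_mem (hr.mem hA) (hA.le₁M hb)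
      have : K0 ≤ LinearMap.ker (innerSL ℂ (V (r * b) ξ)).toLinearMap := by
        refine Submodule.span_le.2 ?_
        rintro _ (⟨m, η, hm, rfl⟩ | ⟨a, r', b', η, ha, hr', hb', rfl⟩)
        · rw [SetLike.mem_coe, LinearMap.mem_ker]
          change ⟪V (r * b) ξ, V m η⟫_ℂ = 0
          rw [hk.inn _ hM _ (hA.le₁M hm), ← mul_assoc, hr.zero hA (star_mem hm) hb]
          simp
        · rw [SetLike.mem_coe, LinearMap.mem_ker]
          change ⟪V (r * b) ξ, V (a * r' * b') η⟫_ℂ = 0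
          have hM' : a * r' * b' ∈ M := mul_mem (mul_mem (hA.le₁M ha.1) (hr'.mem hA)) (hA.le₁M hb')
          have hj := (hr'.star hA).join hr (ker1_star hE hA.le₁M ha)
          rw [hk.inn _ hM _ hM', show star (a * r' * b') * (r * b) = star b' * (star r' * star a * r) * b by
            simp only [star_mul, mul_assoc], hj.zero hA (star_mem hb') hb]
          simp
      exact this hk'
    have h2 := this hk1
    rw [LinearMap.mem_ker] at h2
    change ⟪k', k⟫_ℂ = 0 at h2
    rw [← inner_conj_symm, h2]; simp
  have hK0z : ∀ k ∈ K0, pr K k = 0 := fun k hk' => pr_eq_zero fun k1 hk1 => horth k1 hk1 k hk'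
  have hK0c : ∀ k ∈ K0.topologicalClosure, pr K k = 0 := by
    intro k hk'
    have h0 : K0.topologicalClosure ≤ LinearMap.ker (pr K).toLinearMap :=
      Submodule.topologicalClosure_minimal _ (fun k hk1 => by rw [LinearMap.mem_ker]; exact hK0z k hk1)
        (ContinuousLinearMap.isClosed_ker _)
    exact h0 hk'
  have hdense : ∀ ζ : L, ζ - pr K ζ ∈ K0.topologicalClosure := by
    let D : Submodule ℂ L := K0.topologicalClosure.comap (1 - pr K : BH L).toLinearMap
    have hDc : IsClosed (D : Set L) := by
      have : (D : Set L) = (1 - pr K : BH L) ⁻¹' (K0.topologicalClosure : Set L) := rfl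
      rw [this]
      exact (Submodule.isClosed_topologicalClosure K0).preimage (1 - pr K : BH L).continuous
    have hDm : ∀ ζ, ζ ∈ D ↔ ζ - pr K ζ ∈ K0.topologicalClosure := fun ζ => Iff.rfl
    have hDK : ∀ k ∈ K, k ∈ D := fun k hk => by rw [hDm, pr_of_mem' hk, sub_self]; exact zero_mem _
    have hDK0 : ∀ k ∈ K0, k ∈ D := fun k hk => by
      rw [hDm, hK0z k hk, sub_zero]; exact K0.le_topologicalClosure hk
    have htop : D = ⊤ := by
      refine hk.tot.top D ?_ hDc
      rintro _ ⟨x, hx, ξ, rfl⟩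
      have h1 := hk.act x hx 1 (one_mem M) ξ
      rw [mul_one] at h1
      rw [← h1]
      refine lemmaW hA.generated hπ hA.le₁M hA.le₂M (Wd_sub hA) Wd_one (Wd_mul hA) (V 1 ξ) D hDc ?_ hx
      intro w hw
      have h1 := hk.act w (Wd_sub hA hw) 1 (one_mem M) ξ
      rw [mul_one] at h1
      rw [h1]
      rcases hw with h | ⟨a, b, r, ha, hb, hr, rfl⟩
      · exact hDK0 _ (hK0m _ _ h)
      · have hd := ker1_dec hE hA.le₁M hA.le₁ ha
        have hEa := hE.maps_to a (hA.le₁M ha)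
        have hrM := hr.mem hA
        rw [show a * r * b = E a * r * b + (a - E a) * r * b by noncomm_ring,
          hadd _ (mul_mem (mul_mem (hE.subset hEa) hrM) (hA.le₁M hb)) _ (mul_mem (mul_mem (hA.le₁M hd.1) hrM) (hA.le₁M hb))]
        exact D.add_mem (hDK _ (hKm _ _ _ (hr.left hA hEa) hb)) (hDK0 _ (hK0a _ _ _ _ hd hr hb))
    intro ζ
    have : ζ ∈ D := by rw [htop]; trivial
    exact this
  have hBK : ∀ b ∈ B, ∀ k ∈ K, π b k ∈ K.topologicalClosure := by
    intro b hb k hk1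
    refine K.le_topologicalClosure ?_
    have : K ≤ K.comap (π b).toLinearMap := by
      refine Submodule.span_le.2 ?_
      rintro _ ⟨r, c, ξ, hr, hc, rfl⟩
      change π b (V (r * c) ξ) ∈ K
      rw [hk.act b (hE.subset hb) _ (mul_mem (hr.mem hA) (hA.le₁M hc)), ← mul_assoc]
      exact hKm _ _ _ (hr.left hA hb) hc
    exact this hk1
  have hcomm : ∀ b ∈ B, pr K * π b = π b * pr K := fun b hb =>
    pr_commute (hBK b hb) (by rw [← hπ.star b (hE.subset hb)]; exact hBK _ (star_mem hb))
  have hx0 : ∀ x ∈ ker1 M₁ E, ∀ k ∈ K.topologicalClosure, π x k ∈ K0.topologicalClosure := by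
    intro x hx k hk1
    refine closure_map ?_ hk1
    intro k hk1
    refine K0.le_topologicalClosure ?_
    have : K ≤ K0.comap (π x).toLinearMap := by
      refine Submodule.span_le.2 ?_
      rintro _ ⟨r, c, ξ, hr, hc, rfl⟩
      change π x (V (r * c) ξ) ∈ K0
      rw [hk.act x (hA.le₁M hx.1) _ (mul_mem (hr.mem hA) (hA.le₁M hc)), ← mul_assoc]
      exact hK0a _ _ _ _ hx hr hc
    exact this hk1
  have hy0 : ∀ y ∈ ker1 M₂ E, ∀ k ∈ K0.topologicalClosure, π y k ∈ K.topologicalClosure := by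
    intro x hx k hk1
    refine closure_map ?_ hk1
    intro k hk1
    refine K.le_topologicalClosure ?_
    have : K0 ≤ K.comap (π x).toLinearMap := by
      refine Submodule.span_le.2 ?_
      rintro _ (⟨m, η, hm, rfl⟩ | ⟨a, r, b, ξ, ha, hr, hb, rfl⟩)
      · change π x (V m η) ∈ K
        rw [hk.act x (hA.le₂M hx.1) _ (hA.le₁M hm)]
        exact hKm _ _ _ (R22.single _ hx) hm
      · change π x (V (a * r * b) ξ) ∈ K
        rw [hk.act x (hA.le₂M hx.1) _ (mul_mem (mul_mem (hA.le₁M ha.1) (hr.mem hA)) (hA.le₁M hb)),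
          show x * (a * r * b) = (x * a * r) * b by simp only [mul_assoc]]
        exact hKm _ _ _ (R22.cons _ _ _ hx ha hr) hb
    exact this hk1
  have hr0 : ∀ r, R22 M₁ M₂ E r → ∀ k ∈ K0.topologicalClosure, π r k ∈ K.topologicalClosure := by
    intro r hr
    induction hr with
    | single y hy => exact hy0 y hy
    | cons y x r hy hx hr ih =>
      intro k hk1
      rw [hπ.mul _ (mul_mem (hA.le₂M hy.1) (hA.le₁M hx.1)) _ (hr.mem hA), hπ.mul _ (hA.le₂M hy.1) _ (hA.le₁M hx.1)]
      exact hy0 y hy _ (hx0 x hx _ (ih k hk1))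
  clear_value K K0
  refine ⟨pr K, pr_proj K, hcomm, ?_, ?_⟩
  · intro x hx
    have hd := ker1_dec hE hA.le₁M hA.le₁ hx
    have hEx := hE.maps_to x (hA.le₁M hx)
    have h1 : π x = π (E x) + π (x - E x) := by
      rw [← hπ.add _ (hE.subset hEx) _ (hA.le₁M hd.1)]; congr 1; abel
    ext ζ
    rw [h1, mul_add, add_mul, hcomm _ hEx, mul_assoc (π (E x)), (pr_proj K).2.eq, add_apply,
      show (pr K * π (x - E x) * pr K) ζ = pr K (π (x - E x) (pr K ζ)) from rfl,
      hK0c _ (hx0 _ hd _ (pr_mem K ζ)), add_zero]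
  · intro r hr
    ext ζ
    have h1 : (1 - pr K : BH L) ζ ∈ K0.topologicalClosure := hdense ζ
    exact pr_of_mem (hr0 r hr _ h1)
end P9
end Part9

section Part10
open Filter Topology
section P10
variable {H : Type*} [NormedAddCommGroup H] [InnerProductSpace ℂ H] [CompleteSpace H]
variable {L : Type*} [NormedAddCommGroup L] [InnerProductSpace ℂ L] [CompleteSpace L]
variable {L1 : Type*} [NormedAddCommGroup L1] [InnerProductSpace ℂ L1] [CompleteSpace L1]
variable {M M₁ M₂ B : VonNeumannAlgebra H} {E : BH H → BH H}

lemma exists_J (h1M : (M₁ : Set (BH H)) ⊆ M) {V : BH H → (H →L[ℂ] L)} {π : BH H → BH L} (hk : IsKolm M E V π)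
    {V1 : BH H → (H →L[ℂ] L1)} {π1 : BH H → BH L1} (hk1 : IsKolm M₁ E V1 π1) :
    ∃ J : L1 →L[ℂ] L, ∀ m ∈ M₁, ∀ ξ, J (V1 m ξ) = V m ξ := by
  classical
  let e : (M₁ →₀ H) →ₗ[ℂ] L1 := Finsupp.lsum ℂ (fun m : M₁ => (V1 m).toLinearMap)
  let f : (M₁ →₀ H) →ₗ[ℂ] L := Finsupp.lsum ℂ (fun m : M₁ => (V m).toLinearMap)
  have he : ∀ x, e x = ∑ m ∈ x.support, V1 m (x m) := fun x => rfl
  have hf : ∀ x, f x = ∑ m ∈ x.support, V m (x m) := fun x => rfl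
  have hn : ∀ x, ‖f x‖ = ‖e x‖ := by
    intro x
    have h : ⟪f x, f x⟫_ℂ = ⟪e x, e x⟫_ℂ := by
      rw [he, hf, sum_inner, sum_inner]
      refine Finset.sum_congr rfl fun m _ => ?_
      rw [inner_sum, inner_sum]
      refine Finset.sum_congr rfl fun n _ => ?_
      rw [hk.inn _ (h1M m.2) _ (h1M n.2), hk1.inn _ m.2 _ n.2]
    rw [inner_self_eq_norm_sq_to_K, inner_self_eq_norm_sq_to_K] at h
    have h2 : ‖f x‖ ^ 2 = ‖e x‖ ^ 2 := by exact_mod_cast h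
    exact (sq_eq_sq₀ (norm_nonneg _) (norm_nonneg _)).1 h2
  obtain ⟨J, hJ, -⟩ := exists_ext e f 1 (fun x => by rw [hn, one_mul])
  refine ⟨J, fun m hm ξ => ?_⟩
  have := hJ (Finsupp.single ⟨m, hm⟩ ξ)
  simpa [e, f] using this

theorem exists_F1 (hA : IsAFP M M₁ M₂ B E) {V : BH H → (H →L[ℂ] L)} {π : BH H → BH L} (hk : IsKolm M E V π)
    {V1 : BH H → (H →L[ℂ] L1)} {π1 : BH H → BH L1} (hk1 : IsKolm M₁ E V1 π1)
    (hf1 : ∀ x ∈ M₁, π1 x = 0 → x = 0) :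
    ∃ F : BH H → BH H, IsCondExp (M : Set (BH H)) (M₁ : Set (BH H)) F ∧ FaithfulOn (M : Set (BH H)) F := by
  have h1M := hA.le₁M
  obtain ⟨J, hJ⟩ := exists_J h1M hk hk1
  obtain ⟨α, hα⟩ := transfer hk1.rep hf1 (isRep_id M₁)
  have hπ := hk.rep
  have hπ1 := hk1.rep
  have hJi : Intw M₁ π1 π J := by
    intro a ha ζ
    have h : (J ∘L π1 a : L1 →L[ℂ] L) = π a ∘L J := by
      refine hk1.tot.ext ?_
      rintro _ ⟨m, hm, ξ, rfl⟩
      change J (π1 a (V1 m ξ)) = π a (J (V1 m ξ))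
      rw [hk1.act a ha m hm, hJ _ (mul_mem ha hm), hJ m hm, hk.act a (h1M ha) m (h1M hm)]
    exact congrArg (fun T : L1 →L[ℂ] L => T ζ) h
  have hJa := Intw.adjoint hπ1 (hπ.mono_alg h1M) hJi
  generalize hJs : ContinuousLinearMap.adjoint J = Js at hJa
  have hJin : ∀ ζ η, ⟪ζ, Js η⟫_ℂ = ⟪J ζ, η⟫_ℂ := fun ζ η => by
    rw [← hJs, ContinuousLinearMap.adjoint_inner_right]
  have hJJ : ∀ ζ, Js (J ζ) = ζ := by
    intro ζ
    have h : (Js ∘L J : L1 →L[ℂ] L1) = 1 := by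
      refine hk1.tot.ext ?_
      rintro _ ⟨m, hm, ξ, rfl⟩
      change Js (J (V1 m ξ)) = V1 m ξ
      rw [← sub_eq_zero]
      refine hk1.tot.zero ?_
      rintro _ ⟨n, hn, η, rfl⟩
      rw [inner_sub_right, hJin, hJ m hm, hJ n hn, hk.inn _ (h1M hn) _ (h1M hm), hk1.inn _ hn _ hm, sub_self]
    exact congrArg (fun T : L1 →L[ℂ] L1 => T ζ) h
  let z : BH H → BH L1 := fun x => Js ∘L π x ∘L J
  have hz : ∀ x ζ, z x ζ = Js (π x (J ζ)) := fun x ζ => rfl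
  clear_value z
  have hzin : ∀ x ζ η, ⟪η, z x ζ⟫_ℂ = ⟪J η, π x (J ζ)⟫_ℂ := fun x ζ η => by rw [hz, hJin]
  have hz1 : ∀ m ∈ M₁, z m = π1 m := by
    intro m hm
    ext ζ
    rw [hz, ← hJi m hm, hJJ]
  have hzr : ∀ a b r, a ∈ M₁ → b ∈ M₁ → R22 M₁ M₂ E r → z (a * r * b) = 0 := by
    intro a b r ha hb hr
    refine hk1.tot.ext ?_
    rintro _ ⟨m, hm, ξ, rfl⟩
    rw [ContinuousLinearMap.zero_apply]
    refine hk1.tot.zero ?_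
    rintro _ ⟨n, hn, η, rfl⟩
    have hM : a * r * b ∈ M := mul_mem (mul_mem (h1M ha) (hr.mem hA)) (h1M hb)
    rw [hzin, hJ m hm, hJ n hn, hk.act _ hM _ (h1M hm), ← inner_conj_symm, hk.inn _ (mul_mem hM (h1M hm)) _ (h1M hn),
      show star n * (a * r * b * m) = (star n * a) * r * (b * m) by simp only [mul_assoc],
      hr.zero hA (mul_mem (star_mem hn) ha) (mul_mem hb hm)]
    simp
  have hzW : ∀ x ∈ M, ∀ W, Intw M₁ π1 π1 W → W * z x = z x * W := by
    intro x hx W hW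
    ext ζ
    refine ext_inner_left ℂ fun η => ?_
    rw [mul_apply_eq_comp, mul_apply_eq_comp, ← star_inner, hzin, hzin]
    refine lemmaW2 hA.generated hπ h1M hA.le₂M (Wd_sub hA) Wd_one (Wd_mul hA) _ _ _ _ ?_ hx
    intro w hw
    rw [← hzin, ← hzin, star_inner]
    rcases hw with h | ⟨a, b, r, ha, hb, hr, rfl⟩
    · rw [hz1 w h, hW w h]
    · rw [hzr a b r ha hb hr]; simp
  have hcomm : ∀ x ∈ M, ∀ Y, Intw M₁ π1 (fun x => x) Y → ∀ ζ, α (z x) (Y ζ) = Y (z x ζ) := fun x hx Y hY ζ =>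
    congrArg (fun T : L1 →L[ℂ] H => T ζ) (hα.comm (z x) (hzW x hx) Y hY)
  have hmaster := master hπ1 hf1 (isRep_id M₁)
  have hmaster2 := master (isRep_id M₁) (fun x _ h => h) hπ1
  have hbim : ∀ a ∈ M₁, ∀ b ∈ M₁, ∀ x ∈ M, α (z (a * x * b)) = a * α (z x) * b := by
    intro a ha b hb x hx
    rw [← hα.bimod a ha b hb]
    congr 1
    ext ζ
    rw [hz, mul_apply_eq_comp, mul_apply_eq_comp, hz, hJi b hb, hπ.mul _ (mul_mem (h1M ha) hx) _ (h1M hb),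
      hπ.mul _ (h1M ha) _ hx, mul_apply_eq_comp, mul_apply_eq_comp, hJa a ha]
  refine ⟨fun x => α (z x), ⟨h1M, ?_, ?_, ?_, ?_, ?_, ?_⟩, ?_⟩
  · intro x hx y hy
    rw [← hα.add]; congr 1
    ext ζ; rw [add_apply, hz, hz, hz, hπ.add x hx y hy, add_apply, map_add]
  · intro c x hx
    rw [← hα.smul]; congr 1
    ext ζ; rw [smul_apply, hz, hz, hπ.smul c x hx, smul_apply, map_smul]
  · intro x hx
    refine mem_of_comm M₁ fun t ht => ?_
    refine hmaster.ext ?_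
    rintro _ ⟨Y, hY, ζ, rfl⟩
    have h2 := hcomm x hx (t ∘L Y) (by
      intro a ha ω
      change t (Y (π1 a ω)) = a (t (Y ω))
      rw [hY a ha]
      exact congrArg (fun T : BH H => T (Y ω)) (comm_of_mem ha ht)) ζ
    change t (α (z x) (Y ζ)) = α (z x) (t (Y ζ))
    rw [hcomm x hx Y hY]
    exact h2.symm
  · intro x hx
    have := hbim x hx 1 (one_mem _) 1 (one_mem M)
    have h1 : z 1 = 1 := by rw [hz1 1 (one_mem _), hπ1.one]
    rw [h1, hα.one] at this
    simpa using this
  · intro x hx h0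
    refine hα.pos _ ?_
    refine nonneg_of_inner fun ζ => ?_
    have h1 := inner_nonneg_of (hπ.nonneg hx h0) (J ζ)
    have h2 : ⟪z x ζ, ζ⟫_ℂ = ⟪π x (J ζ), J ζ⟫_ℂ := by
      rw [← inner_conj_symm, hzin, inner_conj_symm]
    rw [h2]; exact h1
  · exact hbim
  · intro x hx h0 hF
    have h1 : z x = 0 := by
      ext ζ
      rw [ContinuousLinearMap.zero_apply]
      refine hmaster2.zero ?_
      rintro _ ⟨Y, hY, η, rfl⟩
      have h2 := hcomm x hx _ (hY.adjoint (isRep_id M₁) hπ1) ζ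
      change α (z x) = 0 at hF
      rw [hF, ContinuousLinearMap.zero_apply] at h2
      rw [← ContinuousLinearMap.adjoint_inner_right, ← h2, inner_zero_right]
    refine hA.faithful x hx h0 ?_
    ext ξ
    refine ext_inner_left ℂ fun η => ?_
    have h2 := hzin x (V1 1 ξ) (V1 1 η)
    rw [h1, hJ 1 (one_mem _), hJ 1 (one_mem _), hk.act x hx 1 (one_mem _), mul_one, ← inner_conj_symm (V 1 η),
      hk.inn x hx 1 (one_mem _), inner_conj_symm, star_one, one_mul, ContinuousLinearMap.zero_apply, inner_zero_right] at h2
    rw [← h2]; simp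
end P10
end Part10

section Part11
open Filter Topology
section P11
variable {H : Type*} [NormedAddCommGroup H] [InnerProductSpace ℂ H] [CompleteSpace H]
variable {L : Type*} [NormedAddCommGroup L] [InnerProductSpace ℂ L] [CompleteSpace L]
variable {L1 : Type*} [NormedAddCommGroup L1] [InnerProductSpace ℂ L1] [CompleteSpace L1]
variable {M Q : VonNeumannAlgebra H} {F : BH H → BH H}

structure IsPhi (M Q : VonNeumannAlgebra H) (π : BH H → BH L) (F : BH H → BH H) (Φ : BH L → BH H) : Prop where
  mem : ∀ T, Φ T ∈ Q
  add : ∀ S T, Φ (S + T) = Φ S + Φ T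
  smul : ∀ (c : ℂ) T, Φ (c • T) = c • Φ T
  pos : ∀ T, 0 ≤ T → 0 ≤ Φ T
  bimod : ∀ a ∈ Q, ∀ b ∈ Q, ∀ T, Φ (π a * T * π b) = a * Φ T * b
  map : ∀ x ∈ M, Φ (π x) = F x

theorem exists_Phi (hF : IsCondExp (M : Set (BH H)) (Q : Set (BH H)) F) {π : BH H → BH L} (hπ : IsRep M π)
    (hf : ∀ x ∈ M, π x = 0 → x = 0) {VQ : BH H → (H →L[ℂ] L1)} {πQ : BH H → BH L1} (hk : IsKolm M F VQ πQ)
    {Φ₀ : BH H → BH H} (hΦ : IsCondExp (Set.univ) (Q : Set (BH H)) Φ₀) : ∃ Φ, IsPhi M Q π F Φ := by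
  obtain ⟨β, hβ⟩ := transfer hπ hf hk.rep
  have hQM := hF.subset
  generalize hv : VQ 1 = v
  have hva : ∀ a ∈ Q, ∀ ξ, πQ a (v ξ) = v (a ξ) := by
    intro a ha ξ
    rw [← hv, hk.act a (hQM ha) 1 (one_mem _), mul_one, ← sub_eq_zero]
    refine hk.tot.zero ?_
    rintro _ ⟨y, hy, η, rfl⟩
    rw [inner_sub_right, sub_eq_zero, ← inner_conj_symm, ← inner_conj_symm (VQ y η) (VQ 1 (a ξ)), hk.inn _ (hQM ha) _ hy,
      hk.inn _ (one_mem _) _ hy, mul_one, ce_right hF ha (star_mem hy)]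
    rfl
  generalize hvs : ContinuousLinearMap.adjoint v = vs
  have hvin : ∀ ξ ζ, ⟪ξ, vs ζ⟫_ℂ = ⟪v ξ, ζ⟫_ℂ := fun ζ η => by
    rw [← hvs, ContinuousLinearMap.adjoint_inner_right]
  have hvsa : ∀ a ∈ Q, ∀ ζ, vs (πQ a ζ) = a (vs ζ) := by
    intro a ha ζ
    refine ext_inner_left ℂ fun ξ => ?_
    rw [hvin, ← star_inner, ← hk.rep.star a (hQM ha), hva _ (star_mem ha), ← hvin, star_inner]
  let c : BH L1 → BH H := fun T => vs ∘L T ∘L v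
  have hc : ∀ T ξ, c T ξ = vs (T (v ξ)) := fun T ξ => rfl
  clear_value c
  have hcu : ∀ T : BH H, T ∈ (Set.univ : Set (BH H)) := fun T => trivial
  refine ⟨fun T => Φ₀ (c (β T)), ⟨fun T => hΦ.maps_to _ (hcu _), ?_, ?_, ?_, ?_, ?_⟩⟩
  · intro S T
    rw [← hΦ.map_add _ (hcu _) _ (hcu _)]; congr 1
    ext ξ; rw [add_apply, hc, hc, hc, hβ.add, add_apply, map_add]
  · intro a T
    rw [← hΦ.map_smul _ _ (hcu _)]; congr 1
    ext ξ; rw [smul_apply, hc, hc, hβ.smul, smul_apply, map_smul]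
  · intro T hT
    refine hΦ.pos _ (hcu _) (nonneg_of_inner fun ξ => ?_)
    have h1 := inner_nonneg_of (hβ.pos T hT) (v ξ)
    rw [hc, ← inner_conj_symm, hvin, inner_conj_symm]
    exact h1
  · intro a ha b hb T
    rw [← hΦ.bimod a ha b hb _ (hcu _)]; congr 1
    ext ξ
    rw [hc, hβ.bimod a (hQM ha) b (hQM hb), mul_apply_eq_comp, mul_apply_eq_comp, hva b hb, hvsa a ha, mul_apply_eq_comp, mul_apply_eq_comp, hc]
  · intro x hx
    have h1 : β (π x) = πQ x := by
      have := hβ.bimod x hx 1 (one_mem _) 1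
      rwa [hπ.one, mul_one, mul_one, hβ.one, hk.rep.one, mul_one, mul_one] at this
    have h2 : c (πQ x) = F x := by
      ext ξ
      refine ext_inner_left ℂ fun η => ?_
      rw [hc, hvin, ← hv, hk.act x hx 1 (one_mem _), mul_one, ← inner_conj_symm, hk.inn x hx 1 (one_mem _), inner_conj_symm, star_one, one_mul]
    rw [h1, h2]
    exact hΦ.fixes _ (hF.maps_to x hx)
end P11
end Part11

section Part12
open Filter Topology
section P12
variable {H : Type*} [NormedAddCommGroup H] [InnerProductSpace ℂ H] [CompleteSpace H]
variable {B : VonNeumannAlgebra H}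

lemma isUnit_of_lb {a : BH H} {c : ℝ} (hc : 0 < c) (h : ∀ ξ, c * ‖ξ‖ ^ 2 ≤ qf a ξ) : IsUnit a := by
  refine ContinuousLinearMap.isUnit_of_forall_le_norm_inner_map a (c := c.toNNReal) (by simpa using hc) fun ξ => ?_
  have h1 := h ξ
  have h2 : qf a ξ ≤ ‖⟪a ξ, ξ⟫_ℂ‖ := (Complex.re_le_norm _)
  rw [Real.coe_toNNReal c hc.le]
  linarith

/-- shift construction -/
theorem shift_contra {p : BH H} (hp : IsFiniteProjection (B : Set (BH H)) p) (t : ℕ → BH H) (htB : ∀ j, t j ∈ B)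
    {R : BH H} (h1 : ∀ j, star (t j) * t j = R) (h2 : ∀ i j, i ≠ j → star (t i) * t j = 0) (hpt : ∀ j, p * t j = t j) :
    t 0 = 0 := by
  classical
  have hin : ∀ i j ξ η, ⟪t i ξ, t j η⟫_ℂ = if i = j then ⟪ξ, R η⟫_ℂ else 0 := by
    intro i j ξ η
    rw [← inner_star, ← mul_apply_eq_comp]
    split_ifs with h
    · rw [h, h1]
    · rw [h2 i j h]; simp
  let e : (ℕ →₀ H) →ₗ[ℂ] H := Finsupp.lsum ℂ (fun m : ℕ => (t m).toLinearMap)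
  let f : (ℕ →₀ H) →ₗ[ℂ] H := Finsupp.lsum ℂ (fun m : ℕ => (t (m+1)).toLinearMap)
  have he : ∀ x, e x = ∑ m ∈ x.support, t m (x m) := fun x => rfl
  have hf : ∀ x, f x = ∑ m ∈ x.support, t (m+1) (x m) := fun x => rfl
  have hn : ∀ x, ‖f x‖ = ‖e x‖ := by
    intro x
    have h : ⟪f x, f x⟫_ℂ = ⟪e x, e x⟫_ℂ := by
      rw [he, hf, sum_inner, sum_inner]
      refine Finset.sum_congr rfl fun m _ => ?_
      rw [inner_sum, inner_sum]
      refine Finset.sum_congr rfl fun n _ => ?_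
      rw [hin, hin]
      simp
    rw [inner_self_eq_norm_sq_to_K, inner_self_eq_norm_sq_to_K] at h
    have h2 : ‖f x‖ ^ 2 = ‖e x‖ ^ 2 := by exact_mod_cast h
    exact (sq_eq_sq₀ (norm_nonneg _) (norm_nonneg _)).1 h2
  obtain ⟨T, hT, hT0⟩ := exists_ext e f 1 (fun x => by rw [hn, one_mul])
  have hTt : ∀ j η, T (t j η) = t (j+1) η := by
    intro j η
    have := hT (Finsupp.single j η)
    simpa [e, f] using this
  let K : Submodule ℂ H := Submodule.span ℂ {v | ∃ j η, v = t j η}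
  have hKm : ∀ j η, t j η ∈ K := fun j η => Submodule.subset_span ⟨j, η, rfl⟩
  have hKle : ∀ K' : Submodule ℂ H, (∀ j η, t j η ∈ K') → K ≤ K' := fun K' h => Submodule.span_le.2 (by
    rintro _ ⟨j, η, rfl⟩; exact h j η)
  clear_value K
  generalize hP : pr K = P
  have hPp : IsProjection P := hP ▸ pr_proj K
  have hPt : ∀ j, P * t j = t j := fun j => by ext η; rw [← hP]; exact pr_of_mem' (hKm j η)
  have hKcl : ∀ ζ, P ζ ∈ K.topologicalClosure := fun ζ => hP ▸ pr_mem K ζ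
  -- two operators agreeing on t j and killed by 1 - P agree
  have hext : ∀ X Y : BH H, (∀ j, X * t j = Y * t j) → X * P = Y * P := by
    intro X Y hXY
    ext ζ
    have h0 : K.topologicalClosure ≤ LinearMap.ker (X - Y).toLinearMap := by
      refine Submodule.topologicalClosure_minimal _ (hKle _ fun j η => ?_) (ContinuousLinearMap.isClosed_ker _)
      rw [LinearMap.mem_ker]
      change (X - Y) (t j η) = 0
      rw [sub_apply, sub_eq_zero]
      exact congrArg (fun A : BH H => A η) (hXY j)
    have := h0 (hKcl ζ)
    rw [LinearMap.mem_ker] at this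
    change (X - Y) (P ζ) = 0 at this
    rw [sub_apply, sub_eq_zero] at this
    exact this
  have hTj : ∀ j, T * t j = t (j+1) := fun j => by ext η; exact hTt j η
  have hst : ∀ j, star (t j) * P = star (t j) := fun j => by
    have := congrArg star (hPt j)
    rwa [star_mul, hPp.1.star_eq] at this
  have hTP : T * P = T := by
    ext ζ
    have h0 : T (ζ - P ζ) = 0 := by
      refine hT0 _ fun x => ?_
      rw [he, sum_inner]
      refine Finset.sum_eq_zero fun j _ => ?_
      rw [← inner_star, map_sub]
      have := congrArg (fun A : BH H => A ζ) (hst j)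
      simp only [mul_apply_eq_comp] at this
      rw [this, sub_self, inner_zero_right]
    rw [map_sub, sub_eq_zero] at h0
    exact h0.symm
  have hPB : P ∈ B := by
    rw [← hP]
    refine pr_mem_vN K fun s hs k hk => K.le_topologicalClosure ?_
    refine hKle (K.comap s.toLinearMap) (fun j η => ?_) hk
    change s (t j η) ∈ K
    have := congrArg (fun A : BH H => A η) (comm_of_mem (htB j) hs)
    simp only [mul_apply_eq_comp] at this
    rw [this]; exact hKm _ _
  have hTB : T ∈ B := by
    refine mem_of_comm B fun s hs => ?_
    have h3 := hext (s * T) (T * s) (fun j => by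
      rw [mul_assoc, hTj, mul_assoc, comm_of_mem (htB j) hs, ← mul_assoc, hTj, comm_of_mem (htB _) hs])
    rw [mul_assoc, hTP, mul_assoc, comm_of_mem hPB hs, ← mul_assoc, hTP] at h3
    exact h3
  have hPT : P * T = T := by
    have h3 := hext (P * T) T (fun j => by rw [mul_assoc, hTj, hPt])
    rwa [mul_assoc, hTP] at h3
  have hpP : p * P = P := by
    have h3 := hext p 1 (fun j => by rw [hpt, one_mul])
    rwa [one_mul] at h3
  have hPpr : P * p = P := by
    have := congrArg star hpP
    rwa [star_mul, hPp.1.star_eq, hp.1.1.star_eq] at this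
  have hTsT : star T * T = P := by
    have h3 : star T * T * P = P * P := by
      refine hext _ _ fun j => ?_
      rw [hPt, mul_assoc, hTj]
      have h4 : star (star T * t (j+1)) * P = star (t j) * P := by
        refine hext _ _ fun k => ?_
        rw [star_mul, star_star, mul_assoc, hTj]
        by_cases hjk : j = k
        · rw [hjk, h1, h1]
        · rw [h2 _ _ hjk, h2 _ _ (by omega)]
      have h5 := congrArg star h4
      simp only [star_mul, star_star, hPp.1.star_eq] at h5
      rw [hPt, ← mul_assoc] at h5
      have h6 : P * star T = star T := by
        have := congrArg star hTP
        rwa [star_mul, hPp.1.star_eq] at this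
      rwa [h6] at h5
    rwa [mul_assoc, hTP, hPp.2.eq] at h3
  have hsPT : star T * P = star T := by
    have := congrArg star hPT
    rwa [star_mul, hPp.1.star_eq] at this
  have hpT : p * T = T := by rw [← hPT, ← mul_assoc, hpP]
  have hsTp : star T * p = star T := by
    have := congrArg star hpT
    rwa [star_mul, hp.1.1.star_eq] at this
  have hu : star (T + (p - P)) * (T + (p - P)) = p := by
    rw [star_add, star_sub, hPp.1.star_eq, hp.1.1.star_eq]
    have : (star T + (p - P)) * (T + (p - P)) = star T * T + (star T * p - star T * P) + (p * T - P * T) +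
      (p * p - p * P - P * p + P * P) := by noncomm_ring
    rw [this, hTsT, hsPT, hsTp, hpT, hPT, hp.1.2.eq, hpP, hPpr, hPp.2.eq]
    abel
  generalize huu : T + (p - P) = u at hu
  have huB : u ∈ B := huu ▸ add_mem hTB (sub_mem hp.2.1 hPB)
  have hpu : p * u = u := by rw [← huu, mul_add, mul_sub, hpT, hp.1.2.eq, hpP]
  have hup : u * p = u := by
    rw [← huu, add_mul, sub_mul, hp.1.2.eq, hPpr, ← hTP, mul_assoc, hPpr]
  have hq := hp.2.2 (u * star u) ⟨IsSelfAdjoint.mul_star_self u, by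
    change u * star u * (u * star u) = u * star u
    rw [show u * star u * (u * star u) = u * (star u * u) * star u by simp only [mul_assoc], hu, hup]⟩
    (mul_mem huB (star_mem huB)) (by
      have := congrArg star hpu
      rw [star_mul, hp.1.1.star_eq] at this
      rw [mul_assoc, this]) ⟨u, huB, hu, rfl⟩
  have hz : star (t 0) * u = 0 := by
    have h3 : star (t 0) * T = 0 := by
      have := hext (star (t 0) * T) 0 (fun j => by rw [mul_assoc, hTj, h2 _ _ (by omega), zero_mul])
      rwa [mul_assoc, hTP, zero_mul] at this
    have h4 : star (t 0) * p = star (t 0) := by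
      have := congrArg star (hpt 0)
      rwa [star_mul, hp.1.1.star_eq] at this
    rw [← huu, mul_add, h3, mul_sub, h4, hst]; simp
  have h5 : star (t 0) * p = 0 := by rw [← hq, ← mul_assoc, hz, zero_mul]
  have h6 := congrArg star h5
  rwa [star_mul, star_star, hp.1.1.star_eq, hpt, star_zero] at h6

lemma partial_iso {s R : BH H} (hs : s ∈ B) (hR : R ∈ B) (hRp : IsProjection R) {c : ℝ} (hc : 0 < c)
    (h : ∀ ξ, c * ‖R ξ‖ ^ 2 ≤ qf (star s * s) (R ξ)) : ∃ g ∈ B, star (s * g) * (s * g) = R := by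
  have h0 : 0 ≤ R * (star s * s) * R + (1 - R) := by
    have := hRp.compl.nonneg
    have h2 : 0 ≤ R * (star s * s) * R := by
      have := star_mul_self_nonneg (s * R)
      rwa [star_mul, hRp.1.star_eq, show R * star s * (s * R) = R * (star s * s) * R by simp only [mul_assoc]] at this
    exact add_nonneg h2 this
  have haB : R * (star s * s) * R + (1 - R) ∈ B :=
    add_mem (mul_mem (mul_mem hR (mul_mem (star_mem hs) hs)) hR) (sub_mem (one_mem B) hR)
  have hRR := hRp.2.eq
  have haR : (R * (star s * s) * R + (1 - R)) * R = R * (star s * s) * R := by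
    rw [add_mul, mul_assoc _ R R, hRR, sub_mul, one_mul, hRR, sub_self, add_zero]
  have hRa : R * (R * (star s * s) * R + (1 - R)) = R * (star s * s) * R := by
    rw [mul_add, ← mul_assoc, ← mul_assoc, hRR, mul_sub, mul_one, hRR, sub_self, add_zero]
  have hu : IsUnit (R * (star s * s) * R + (1 - R)) := by
    refine isUnit_of_lb (c := min c 1) (by positivity) fun ξ => ?_
    have h1 : qf (R * (star s * s) * R) ξ = qf (star s * s) (R ξ) := by
      have := qf_conj R (star s * s) ξ
      rwa [hRp.1.star_eq] at this
    have h2 := hRp.pyth ξ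
    have h3 := hRp.compl.qf ξ
    have h4 : (1 - R) ξ = ξ - R ξ := by simp
    rw [qf_add, h1, h3, h4, h2]
    have h5 := h ξ
    have h6 : min c 1 * ‖R ξ‖ ^ 2 ≤ c * ‖R ξ‖ ^ 2 := by gcongr; exact min_le_left _ _
    have h7 : min c 1 * ‖ξ - R ξ‖ ^ 2 ≤ 1 * ‖ξ - R ξ‖ ^ 2 := by gcongr; exact min_le_right _ _
    linarith
  generalize ha : R * (star s * s) * R + (1 - R) = a at *
  obtain ⟨-, hds, hdd⟩ := sqrt_fac h0
  have hdR : CFC.sqrt a * R = R * CFC.sqrt a := by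
    have h1 : Commute a R := haR.trans hRa.symm
    rw [CFC.sqrt_eq_real_sqrt a h0]
    exact (h1.cfcₙ_real _).eq
  have hdB := vsqrt_mem haB h0
  generalize CFC.sqrt a = d at *
  have hdu : IsUnit d := by
    rw [← hdd] at hu
    obtain ⟨v, hv⟩ := hu
    refine ⟨⟨d, d * ↑v⁻¹, ?_, ?_⟩, rfl⟩
    · rw [← mul_assoc, ← hv, Units.mul_inv]
    · have h1 : (d * ↑v⁻¹) = ↑v⁻¹ * d := by
        have h2 : (v : BH H) * d = d * v := by rw [hv, mul_assoc]
        calc d * ↑v⁻¹ = ↑v⁻¹ * (↑v * d) * ↑v⁻¹ := by rw [← mul_assoc, Units.inv_mul, one_mul]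
          _ = ↑v⁻¹ * d := by rw [h2, mul_assoc, mul_assoc, Units.mul_inv, mul_one]
      rw [h1, mul_assoc, ← hv, Units.inv_mul]
  have hi1 := Ring.mul_inverse_cancel d hdu
  have hi2 := Ring.inverse_mul_cancel d hdu
  have hgB := vinv_mem hdB
  generalize Ring.inverse d = g at *
  have hgs : star g = g := by
    have h1 : star g * d = 1 := by
      have := congrArg star hi1
      rwa [star_mul, hds, star_one] at this
    calc star g = star g * (d * g) := by rw [hi1, mul_one]
      _ = g := by rw [← mul_assoc, h1, one_mul]
  have hgR : R * g = g * R := by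
    calc R * g = g * d * (R * g) := by rw [hi2, one_mul]
      _ = g * (d * R) * g := by simp only [mul_assoc]
      _ = g * (R * d) * g := by rw [hdR]
      _ = g * R * (d * g) := by simp only [mul_assoc]
      _ = g * R := by rw [hi1, mul_one]
  refine ⟨R * g, mul_mem hR hgB, ?_⟩
  rw [star_mul, star_mul, hgs, hRp.1.star_eq]
  calc g * R * star s * (s * (R * g)) = g * (R * (star s * s) * R) * g := by simp only [mul_assoc]
    _ = g * (d * d * R) * g := by rw [← haR, hdd]
    _ = g * d * (d * R) * g := by simp only [mul_assoc]
    _ = R * (d * g) := by rw [hi2, one_mul, hdR, mul_assoc]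
    _ = R := by rw [hi1, mul_one]

theorem finA {p : BH H} (hp : IsFiniteProjection (B : Set (BH H)) p) (s G : ℕ → BH H) (hs : ∀ j, s j ∈ B)
    (hG : ∀ j, IsProjection (G j)) (hGG : ∀ i j, i ≠ j → G i * G j = 0) (hpG : ∀ j, p * G j = G j)
    (hGs : ∀ j, G j * s j = s j) {D : BH H} (hD : D ∈ B) (hD0 : 0 ≤ D) (lam : ℕ → ℝ) (hlam : ∀ j, 0 < lam j)
    (hle : ∀ j ξ, qf D ξ ≤ lam j * ‖s j ξ‖ ^ 2) : D = 0 := by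
  refine eq_zero_of_qf hD0 ?_
  by_contra hcon
  push Not at hcon
  obtain ⟨ξ, hξ⟩ := hcon
  have hξ0 : 0 < qf D ξ := lt_of_le_of_ne (qf_nonneg hD0 ξ) (Ne.symm hξ)
  have hpos : 0 < qf D ξ / (‖ξ‖ ^ 2 + 1) := by positivity
  obtain ⟨R, hRB, hRp, -, -, hR2, hR3, -, -⟩ := spectral_cut hD hD0 (qf D ξ / (‖ξ‖ ^ 2 + 1))
  have hex : ∀ j, ∃ g ∈ B, star (s j * g) * (s j * g) = R := by
    intro j
    have hl := hlam j
    refine partial_iso (hs j) hRB hRp (c := qf D ξ / (‖ξ‖ ^ 2 + 1) / lam j) (by positivity) fun ζ => ?_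
    have h1 := hR2 ζ
    have h2 := hle j (R ζ)
    rw [qf_star_mul, div_mul_eq_mul_div, div_le_iff₀ hl]
    linarith
  choose g hgB hg using hex
  have h0 := shift_contra hp (fun j => s j * g j) (fun j => mul_mem (hs j) (hgB j)) hg (by
    intro i j hij
    rw [star_mul]
    have h1 : star (s i) * G i = star (s i) := by
      have := congrArg star (hGs i)
      rwa [star_mul, (hG i).1.star_eq] at this
    rw [← hGs j, ← h1, show star (g i) * (star (s i) * G i) * (G j * s j * g j) = star (g i) * (star (s i)) * (G i * G j) * (s j * g j) by simp only [mul_assoc], hGG i j hij]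
    simp) (by
    intro j
    rw [← mul_assoc, ← hGs j, ← mul_assoc, hpG])
  have hR0 : R = 0 := by
    have := hg 0
    rw [show s 0 * g 0 = 0 from h0] at this
    simpa using this.symm
  have h1 := hR3 hR0 ξ
  rw [div_mul_eq_mul_div, le_div_iff₀ (by positivity)] at h1
  nlinarith
end P12
end Part12

section Part13
open Filter Topology
section P13
variable {H : Type*} [NormedAddCommGroup H] [InnerProductSpace ℂ H] [CompleteSpace H]
variable {B : VonNeumannAlgebra H}

lemma lub_tendsto {a : ℕ → BH H} (hm : Monotone a) {x : BH H} (hx : IsLUB (Set.range a) x) (ξ : H) :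
    Tendsto (fun j => a j ξ) atTop (𝓝 (x ξ)) := by
  have hd : DirectedOn (· ≤ ·) (Set.range a) := directedOn_range.2 hm.directed_le
  rw [Metric.tendsto_atTop]
  intro ε hε
  obtain ⟨_, ⟨n, rfl⟩, h⟩ := lub_approx (Set.range_nonempty a) hd hx ξ hε
  refine ⟨n, fun m hm' => ?_⟩
  rw [dist_comm, dist_eq_norm]
  exact h _ ⟨m, rfl⟩ (hm hm')

lemma inc_lim {a : ℕ → BH H} (hm : Monotone a) {b : BH H} (hb : ∀ j, a j ≤ b) :
    ∃ x, IsLUB (Set.range a) x := by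
  have hd : DirectedOn (· ≤ ·) (Set.range a) := directedOn_range.2 hm.directed_le
  obtain ⟨x, hx, -⟩ := directed_sup (Set.range a) (Set.range_nonempty a) hd ⟨b, by rintro _ ⟨j, rfl⟩; exact hb j⟩
  exact ⟨x, hx⟩

lemma inc_lim_mem (B : VonNeumannAlgebra H) {a : ℕ → BH H} (hm : Monotone a) (ha : ∀ j, a j ∈ B) {x : BH H}
    (hx : IsLUB (Set.range a) x) : x ∈ B :=
  lub_mem B (by rintro _ ⟨j, rfl⟩; exact ha j) (Set.range_nonempty a) (directedOn_range.2 hm.directed_le) hx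

lemma dec_lim (B : VonNeumannAlgebra H) {a : ℕ → BH H} (hm : Antitone a) (ha : ∀ j, a j ∈ B) (h0 : ∀ j, 0 ≤ a j) :
    ∃ D ∈ B, 0 ≤ D ∧ (∀ j, D ≤ a j) ∧ ∀ ξ, Tendsto (fun j => a j ξ) atTop (𝓝 (D ξ)) := by
  have hm' : Monotone (fun j => 1 - a j) := fun i j hij => sub_le_sub_left (hm hij) 1
  obtain ⟨x, hx⟩ := inc_lim hm' (b := 1) (fun j => sub_le_self _ (h0 j))
  refine ⟨1 - x, sub_mem (one_mem B) (inc_lim_mem B hm' (fun j => sub_mem (one_mem B) (ha j)) hx), ?_, ?_, ?_⟩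
  · rw [sub_nonneg]
    exact hx.2 (by rintro _ ⟨j, rfl⟩; exact sub_le_self _ (h0 j))
  · intro j
    have h := hx.1 ⟨j, rfl⟩
    have h : 1 - a j ≤ x := h
    exact sub_le_comm.1 h
  · intro ξ
    have h1 := (lub_tendsto hm' hx ξ).const_sub ξ
    refine (h1.congr fun j => ?_).trans_eq ?_
    · simp
    · simp

lemma resolvent {C : BH H} (hC : C ∈ B) (h0 : 0 ≤ C) {δ : ℝ} (hδ : 0 < δ) :
    ∃ r ∈ B, (∀ ζ, δ • r ζ + C (r ζ) = ζ) ∧ (∀ ζ, ‖C (r ζ)‖ ≤ ‖ζ‖) ∧ (∀ ζ, ‖δ • r ζ‖ ≤ ‖ζ‖) ∧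
      (∀ ζ, δ * qf C (r ζ) ≤ ‖ζ‖ ^ 2) ∧ star r = r := by
  have hu : IsUnit (δ • (1 : BH H) + C) := by
    refine isUnit_of_lb hδ fun ξ => ?_
    rw [qf_add, qf_smul, qf_one]
    linarith [qf_nonneg h0 ξ]
  have hmem : δ • (1 : BH H) + C ∈ B := add_mem (vrsmul_mem δ (one_mem B)) hC
  have h1 := Ring.mul_inverse_cancel _ hu
  have h1' := Ring.inverse_mul_cancel _ hu
  have h2 := vinv_mem hmem
  generalize Ring.inverse (δ • (1 : BH H) + C) = r at *
  have h3 : ∀ ζ, δ • r ζ + C (r ζ) = ζ := fun ζ => by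
    have := congrArg (fun A : BH H => A ζ) h1
    simpa using this
  have h4 : ∀ ζ, ‖ζ‖ ^ 2 = ‖δ • r ζ‖ ^ 2 + 2 * (δ * qf C (r ζ)) + ‖C (r ζ)‖ ^ 2 := by
    intro ζ
    have h5 := @norm_add_sq ℂ H _ _ _ (δ • r ζ) (C (r ζ))
    rw [h3 ζ] at h5
    have h6 : RCLike.re ⟪δ • r ζ, C (r ζ)⟫_ℂ = δ * qf C (r ζ) := by
      rw [← inner_re_symm]
      change (⟪C (r ζ), δ • r ζ⟫_ℂ).re = δ * (⟪C (r ζ), r ζ⟫_ℂ).re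
      rw [show δ • r ζ = (δ : ℂ) • r ζ from (Complex.coe_smul δ _).symm, inner_smul_right, Complex.re_ofReal_mul]
    rw [h6] at h5
    exact h5
  refine ⟨r, h2, h3, fun ζ => ?_, fun ζ => ?_, fun ζ => ?_, ?_⟩
  · refine le_of_sq_le_sq ?_ (norm_nonneg _)
    have := qf_nonneg h0 (r ζ)
    rw [h4 ζ]; nlinarith [sq_nonneg ‖δ • r ζ‖, mul_nonneg hδ.le this]
  · refine le_of_sq_le_sq ?_ (norm_nonneg _)
    have := qf_nonneg h0 (r ζ)
    rw [h4 ζ]; nlinarith [sq_nonneg ‖C (r ζ)‖, mul_nonneg hδ.le this]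
  · have := mul_nonneg hδ.le (qf_nonneg h0 (r ζ))
    rw [h4 ζ]; nlinarith [sq_nonneg ‖C (r ζ)‖, sq_nonneg ‖δ • r ζ‖]
  · have h5 : star (δ • (1 : BH H) + C) = δ • (1 : BH H) + C := by
      rw [star_add, (sa_of_nonneg h0).star_eq, star_smul, star_one, star_trivial]
    have h6 := congrArg star h1
    rw [star_mul, h5, star_one] at h6
    calc star r = star r * ((δ • (1 : BH H) + C) * r) := by rw [h1, mul_one]
      _ = r := by rw [← mul_assoc, h6, one_mul]

/-- one block -/
lemma finB_step (Z g : ℕ → BH H) (hZ : ∀ n, Z n ∈ B) (hg : ∀ n, IsProjection (g n))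
    (hgg : ∀ i j, i ≠ j → g i * g j = 0) (hZg : ∀ n, Z n * g n = Z n) (k : ℕ) {ξ : H}
    (hξ : ξ ∈ (Submodule.span ℂ {v | ∃ n, k ≤ n ∧ ∃ η, v = Z n η}).topologicalClosure) {ε : ℝ} (hε : 0 < ε) :
    ∃ l, k ≤ l ∧ ∃ x ∈ B, ∃ r ∈ B, (∑ n ∈ Finset.Ico k l, g n) * x = x ∧ (∀ ζ, ‖star x (x (r ζ))‖ ≤ ‖ζ‖) ∧
      ‖ξ - star x (x (r ξ))‖ ≤ ε := by
  have hgZ : ∀ n, g n * star (Z n) = star (Z n) := fun n => by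
    have := congrArg star (hZg n)
    rwa [star_mul, (hg n).1.star_eq] at this
  obtain ⟨η, hη, hd⟩ := Metric.mem_closure_iff.1 hξ (ε / 2) (by positivity)
  rw [dist_eq_norm] at hd
  -- claim for elements of the span
  have hspan : ∀ η ∈ Submodule.span ℂ {v | ∃ n, k ≤ n ∧ ∃ η, v = Z n η}, ∃ l, ∃ c : ℝ, 0 ≤ c ∧ ∀ l', l ≤ l' → ∀ δ : ℝ, 0 < δ →
      ∀ r : BH H, star r = r → (∀ ζ, δ * qf (∑ n ∈ Finset.Ico k l', Z n * star (Z n)) (r ζ) ≤ ‖ζ‖ ^ 2) →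
      ‖δ • r η‖ ≤ Real.sqrt δ * c := by
    intro η hη
    induction hη using Submodule.span_induction with
    | mem v hv =>
      obtain ⟨n, hn, η, rfl⟩ := hv
      refine ⟨n + 1, ‖η‖, norm_nonneg _, fun l' hl' δ hδ r hrs hr => ?_⟩
      have h1 : ‖star (Z n) * (δ • r)‖ ≤ Real.sqrt δ := by
        refine ContinuousLinearMap.opNorm_le_bound _ (Real.sqrt_nonneg _) fun ζ => ?_
        refine le_of_sq_le_sq ?_ (by positivity)
        have h2 : ‖(star (Z n)) (r ζ)‖ ^ 2 ≤ qf (∑ n ∈ Finset.Ico k l', Z n * star (Z n)) (r ζ) := by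
          rw [qf_sum]
          have h3 : ∀ i, qf (Z i * star (Z i)) (r ζ) = ‖star (Z i) (r ζ)‖ ^ 2 := fun i => by
            rw [← qf_star_mul, star_star]
          have := Finset.single_le_sum (f := fun i => qf (Z i * star (Z i)) (r ζ)) (s := Finset.Ico k l') (by
            intro i _; rw [h3]; positivity) (Finset.mem_Ico.2 ⟨hn, by omega⟩ : n ∈ Finset.Ico k l')
          simp only [h3] at this ⊢
          exact this
        have h4 := hr ζ
        rw [mul_apply_eq_comp, smul_apply, ContinuousLinearMap.map_smul_of_tower, norm_smul, mul_pow, mul_pow, Real.sq_sqrt hδ.le,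
          Real.norm_of_nonneg hδ.le]
        nlinarith [mul_le_mul_of_nonneg_left h2 hδ.le]
      have h5 : ‖(δ • r) * Z n‖ ≤ Real.sqrt δ := by
        rw [← norm_star, star_mul, star_smul, hrs, star_trivial δ]; exact h1
      have h6 := ((δ • r) * Z n).le_opNorm η
      rw [mul_apply_eq_comp, smul_apply] at h6
      exact h6.trans (by gcongr)
    | zero => exact ⟨0, 0, le_rfl, fun l' _ δ hδ r _ _ => by simp⟩
    | add u v _ _ h1 h2 =>
      obtain ⟨l1, c1, hc1, h1⟩ := h1
      obtain ⟨l2, c2, hc2, h2⟩ := h2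
      refine ⟨max l1 l2, c1 + c2, by positivity, fun l' hl' δ hδ r hrs hr => ?_⟩
      have h3 := h1 l' (le_of_max_le_left hl') δ hδ r hrs hr
      have h4 := h2 l' (le_of_max_le_right hl') δ hδ r hrs hr
      rw [map_add, smul_add, mul_add]
      exact (norm_add_le _ _).trans (add_le_add h3 h4)
    | smul a u _ h1 =>
      obtain ⟨l1, c1, hc1, h1⟩ := h1
      refine ⟨l1, ‖a‖ * c1, by positivity, fun l' hl' δ hδ r hrs hr => ?_⟩
      have h3 := h1 l' hl' δ hδ r hrs hr
      rw [map_smul, smul_comm, norm_smul, mul_left_comm]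
      gcongr
  obtain ⟨l, c, hc, hl⟩ := hspan η hη
  set C : BH H := ∑ n ∈ Finset.Ico k (max k l), Z n * star (Z n) with hCdef
  have hCB : C ∈ B := sum_mem fun n _ => mul_mem (hZ n) (star_mem (hZ n))
  have hC0 : 0 ≤ C := Finset.sum_nonneg fun n _ => mul_star_self_nonneg (Z n)
  have hx : star (∑ n ∈ Finset.Ico k (max k l), star (Z n)) * (∑ n ∈ Finset.Ico k (max k l), star (Z n)) = C := by
    rw [star_sum, Finset.sum_mul, hCdef]
    refine Finset.sum_congr rfl fun i hi => ?_
    rw [Finset.mul_sum, Finset.sum_eq_single i, star_star]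
    · intro j _ hj
      rw [star_star, ← hZg i, ← hgZ j, mul_assoc, ← mul_assoc (g i), hgg i j (Ne.symm hj), zero_mul, mul_zero]
    · intro h; exact absurd hi h
  obtain ⟨δ, hδ, hδc⟩ : ∃ δ : ℝ, 0 < δ ∧ Real.sqrt δ * c ≤ ε / 2 := by
    refine ⟨(ε / 2 / (c + 1)) ^ 2, by positivity, ?_⟩
    rw [Real.sqrt_sq (by positivity), div_mul_eq_mul_div, div_le_iff₀ (by positivity)]
    nlinarith
  obtain ⟨r, hrB, hr1, hr2, hr3, hr4, hrs⟩ := resolvent hCB hC0 hδ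
  have hxC : ∀ ζ, star (∑ n ∈ Finset.Ico k (max k l), star (Z n)) ((∑ n ∈ Finset.Ico k (max k l), star (Z n)) ζ) = C ζ := fun ζ => by
    rw [← hx]; rfl
  refine ⟨max k l, le_max_left _ _, ∑ n ∈ Finset.Ico k (max k l), star (Z n), sum_mem fun n _ => star_mem (hZ n), r, hrB, ?_, ?_, ?_⟩
  · rw [Finset.sum_mul]
    refine Finset.sum_congr rfl fun i hi => ?_
    rw [Finset.mul_sum, Finset.sum_eq_single i, hgZ]
    · intro j _ hj
      rw [← hgZ j, ← mul_assoc, hgg i j (Ne.symm hj), zero_mul]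
    · intro h; exact absurd hi h
  · intro ζ; rw [hxC]; exact hr2 ζ
  · rw [hxC]
    have h1 : ξ - C (r ξ) = δ • r (ξ - η) + δ • r η := by
      rw [← smul_add, ← map_add, sub_add_cancel, sub_eq_iff_eq_add, hr1]
    rw [h1]
    have h2 := hr3 (ξ - η)
    have h3 := hl (max k l) (le_max_right _ _) δ hδ r hrs hr4
    refine (norm_add_le _ _).trans ?_
    linarith
end P13
end Part13

section Part14
open Filter Topology
section P14
variable {H : Type*} [NormedAddCommGroup H] [InnerProductSpace ℂ H] [CompleteSpace H]
variable {B : VonNeumannAlgebra H}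

lemma proj_sum (g : ℕ → BH H) (hg : ∀ n, IsProjection (g n)) (hgg : ∀ i j, i ≠ j → g i * g j = 0) (s : Finset ℕ) :
    IsProjection (∑ n ∈ s, g n) := by
  constructor
  · exact isSelfAdjoint_sum s fun n _ => (hg n).1
  · unfold IsIdempotentElem
    rw [Finset.sum_mul]
    refine Finset.sum_congr rfl fun i hi => ?_
    rw [Finset.mul_sum, Finset.sum_eq_single i (fun j _ hj => hgg i j (Ne.symm hj)) (fun h => absurd hi h)]
    exact (hg i).2.eq

lemma sum_mul_sum_zero (g : ℕ → BH H) (hgg : ∀ i j, i ≠ j → g i * g j = 0) (s t : Finset ℕ)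
    (h : Disjoint s t) : (∑ n ∈ s, g n) * (∑ n ∈ t, g n) = 0 := by
  rw [Finset.sum_mul]
  refine Finset.sum_eq_zero fun i hi => ?_
  rw [Finset.mul_sum]
  exact Finset.sum_eq_zero fun j hj => hgg i j fun e => Finset.disjoint_left.1 h hi (e ▸ hj)

lemma finB_rec {p : BH H} (hp : IsFiniteProjection (B : Set (BH H)) p) (Z g : ℕ → BH H) (hZ : ∀ n, Z n ∈ B)
    (hg : ∀ n, IsProjection (g n)) (hpg : ∀ n, p * g n = g n)
    (hgg : ∀ i j, i ≠ j → g i * g j = 0) (hZg : ∀ n, Z n * g n = Z n) {ξ : H}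
    (hξ : ∀ k, ξ ∈ (Submodule.span ℂ {v | ∃ n, k ≤ n ∧ ∃ η, v = Z n η}).topologicalClosure) : ξ = 0 := by
  by_contra hne
  have hn0 : 0 < ‖ξ‖ := norm_pos_iff.2 hne
  choose l hl x hx r hr h1 h2 h3 using fun k (j : ℕ) =>
    finB_step Z g hZ hg hgg hZg k (hξ k) (ε := ‖ξ‖ / 4 * (1 / 2) ^ j) (by positivity)
  obtain ⟨K, hK⟩ : ∃ K : ℕ → ℕ, ∀ j, K (j + 1) = l (K j) j :=
    ⟨fun n => Nat.rec 0 (fun j k => l k j) n, fun j => rfl⟩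
  obtain ⟨Y, hY0, hY⟩ : ∃ Y : ℕ → BH H, Y 0 = 1 ∧ ∀ j, Y (j + 1) = star (x (K j) j) * (x (K j) j * r (K j) j * Y j) :=
    ⟨fun n => Nat.rec 1 (fun j y => star (x (K j) j) * (x (K j) j * r (K j) j * y)) n, rfl, fun j => rfl⟩
  have hYB : ∀ j, Y j ∈ B := by
    intro j
    induction j with
    | zero => rw [hY0]; exact one_mem B
    | succ j ih => rw [hY]; exact mul_mem (star_mem (hx _ _)) (mul_mem (mul_mem (hx _ _) (hr _ _)) ih)
  have hYap : ∀ j ζ, Y (j + 1) ζ = star (x (K j) j) (x (K j) j (r (K j) j (Y j ζ))) := fun j ζ => by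
    rw [hY]; simp only [mul_apply_eq_comp]
  have hYd : ∀ j ζ, ‖Y (j + 1) ζ‖ ≤ ‖Y j ζ‖ := fun j ζ => by rw [hYap]; exact h2 _ _ _
  have hY1 : ∀ j, ‖Y j ξ - ξ‖ ≤ ‖ξ‖ / 2 * (1 - (1 / 2) ^ j) := by
    intro j
    induction j with
    | zero => rw [hY0]; simp
    | succ j ih =>
      have e : Y (j + 1) ξ - ξ = star (x (K j) j) (x (K j) j (r (K j) j (Y j ξ - ξ))) -
          (ξ - star (x (K j) j) (x (K j) j (r (K j) j ξ))) := by
        rw [hYap, map_sub, map_sub, map_sub]; abel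
      rw [e]
      refine (norm_sub_le _ _).trans ((add_le_add ((h2 _ _ _).trans ih) (h3 _ _)).trans (le_of_eq ?_))
      ring
  have hY2 : ∀ j, ‖ξ‖ / 2 ≤ ‖Y j ξ‖ := by
    intro j
    have a := norm_sub_norm_le ξ (Y j ξ)
    rw [norm_sub_rev] at a
    have b := hY1 j
    have c : (0 : ℝ) < (1 / 2) ^ j := by positivity
    nlinarith
  obtain ⟨D, hDB, hD0, hDle, hDt⟩ := dec_lim B (a := fun j => star (Y j) * Y j)
    (antitone_nat_of_succ_le fun j => le_of_qf (sa_of_nonneg (star_mul_self_nonneg _)) (sa_of_nonneg (star_mul_self_nonneg _)) fun ζ => by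
      rw [qf_star_mul, qf_star_mul]; have := hYd j ζ; gcongr)
    (fun j => mul_mem (star_mem (hYB j)) (hYB j)) (fun j => star_mul_self_nonneg _)
  have hD : D = 0 := by
    have hKm : Monotone K := monotone_nat_of_le_succ fun j => by rw [hK]; exact hl _ _
    refine finA hp (fun j => x (K j) j * r (K j) j * Y j) (fun j => ∑ n ∈ Finset.Ico (K j) (K (j + 1)), g n)
      (fun j => mul_mem (mul_mem (hx _ _) (hr _ _)) (hYB j)) (fun j => proj_sum g hg hgg _) ?_ ?_ ?_ hDB hD0
      (fun j => (‖star (x (K j) j)‖ + 1) ^ 2) (fun j => by positivity) ?_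
    · have key : ∀ i j, i < j → Disjoint (Finset.Ico (K i) (K (i + 1))) (Finset.Ico (K j) (K (j + 1))) := by
        intro i j hij
        rw [Finset.disjoint_left]
        intro n hn hn'
        have := hKm (show i + 1 ≤ j from hij)
        rw [Finset.mem_Ico] at hn hn'
        omega
      intro i j hij
      rcases lt_or_gt_of_ne hij with h | h
      · exact sum_mul_sum_zero g hgg _ _ (key i j h)
      · exact sum_mul_sum_zero g hgg _ _ (key j i h).symm
    · intro j
      rw [Finset.mul_sum]; exact Finset.sum_congr rfl fun n _ => hpg n
    · intro j
      rw [← mul_assoc, ← mul_assoc, hK, h1]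
    · intro j ζ
      have a := qf_mono (hDle (j + 1)) ζ
      rw [qf_star_mul] at a
      refine a.trans ?_
      rw [← mul_pow]
      refine pow_le_pow_left₀ (norm_nonneg _) ?_ 2
      rw [hY, mul_apply_eq_comp]
      refine (ContinuousLinearMap.le_opNorm _ _).trans ?_
      gcongr
      linarith
  have hfin : ‖ξ‖ ^ 2 / 4 ≤ qf D ξ := by
    have ht : Tendsto (fun j => qf (star (Y j) * Y j) ξ) atTop (𝓝 (qf D ξ)) := by
      unfold qf
      exact (Complex.continuous_re.tendsto _).comp ((hDt ξ).inner tendsto_const_nhds)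
    refine ge_of_tendsto' ht fun j => ?_
    rw [qf_star_mul]
    have := hY2 j
    nlinarith
  rw [hD, qf_zero] at hfin
  nlinarith

theorem finB {p : BH H} (hp : IsFiniteProjection (B : Set (BH H)) p) (Z g : ℕ → BH H) (hZ : ∀ n, Z n ∈ B)
    (hg : ∀ n, IsProjection (g n)) (hpg : ∀ n, p * g n = g n)
    (hgg : ∀ i j, i ≠ j → g i * g j = 0) (hZg : ∀ n, Z n * g n = Z n) (hZ1 : ∀ n, ‖Z n‖ ≤ 1) {ξ : H} {c : ℝ} (hc : 0 < c)
    (h : ∀ n, c ≤ ‖star (Z n) ξ‖) : False := by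
  obtain ⟨V, hV⟩ : ∃ V : ℕ → Submodule ℂ H, ∀ k, V k = Submodule.span ℂ {v | ∃ n, k ≤ n ∧ ∃ η, v = Z n η} := ⟨_, fun _ => rfl⟩
  have hVm : ∀ i j, i ≤ j → V j ≤ V i := by
    intro i j hij
    rw [hV, hV]
    refine Submodule.span_mono ?_
    rintro v ⟨n, hn, η, rfl⟩
    exact ⟨n, hij.trans hn, η, rfl⟩
  have hVB : ∀ k, pr (V k) ∈ B := by
    intro k
    refine pr_mem_vN _ fun t ht v hv => (V k).le_topologicalClosure ?_
    rw [hV] at hv ⊢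
    induction hv using Submodule.span_induction with
    | mem v hv =>
      obtain ⟨n, hn, η, rfl⟩ := hv
      refine Submodule.subset_span ⟨n, hn, t η, ?_⟩
      exact congrArg (fun A : BH H => A η) (comm_of_mem (hZ n) ht)
    | zero => rw [map_zero]; exact zero_mem _
    | add u v _ _ h1 h2 => rw [map_add]; exact add_mem h1 h2
    | smul a u _ h1 => rw [map_smul]; exact Submodule.smul_mem _ _ h1
  have hPm : ∀ i j, i ≤ j → ∀ ζ, pr (V i) (pr (V j) ζ) = pr (V j) ζ := fun i j hij ζ =>
    pr_of_mem (Submodule.topologicalClosure_mono (hVm i j hij) (pr_mem _ _))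
  have hanti : Antitone fun k => pr (V k) := by
    intro i j hij
    refine le_of_qf (pr_proj _).1 (pr_proj _).1 fun ζ => ?_
    rw [(pr_proj _).qf, (pr_proj _).qf]
    have e : pr (V j) * pr (V i) = pr (V j) := by
      have e1 : pr (V i) * pr (V j) = pr (V j) := by ext ζ; exact hPm i j hij ζ
      have := congrArg star e1
      rwa [star_mul, (pr_proj _).1.star_eq, (pr_proj _).1.star_eq] at this
    have e2 := congrArg (fun A : BH H => A ζ) e
    simp only [mul_apply_eq_comp] at e2
    rw [← e2]
    have := (pr_proj (V j)).norm_apply_le (pr (V i) ζ)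
    gcongr
  obtain ⟨D, hDB, hD0, hDle, hDt⟩ := dec_lim B hanti hVB (fun j => (pr_proj _).nonneg)
  have hb : ∀ k, c ≤ ‖pr (V k) ξ‖ := by
    intro k
    have e : star (Z k) * pr (V k) = star (Z k) := by
      have e1 : pr (V k) * Z k = Z k := by
        ext ζ
        rw [mul_apply_eq_comp]
        refine pr_of_mem' ?_
        rw [hV]
        exact Submodule.subset_span ⟨k, le_rfl, ζ, rfl⟩
      have := congrArg star e1
      rwa [star_mul, (pr_proj _).1.star_eq] at this
    have e2 := congrArg (fun A : BH H => A ξ) e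
    simp only [mul_apply_eq_comp] at e2
    have a := h k
    rw [← e2] at a
    refine a.trans ((ContinuousLinearMap.le_opNorm _ _).trans ?_)
    rw [norm_star]
    have := hZ1 k
    have := norm_nonneg (pr (V k) ξ)
    nlinarith
  have hD1 : c ≤ ‖D ξ‖ := ge_of_tendsto' (hDt ξ).norm hb
  have hD2 : D ξ = 0 := by
    refine finB_rec hp Z g hZ hg hpg hgg hZg fun k => ?_
    rw [← hV]
    refine (V k).isClosed_topologicalClosure.mem_of_tendsto (hDt ξ) ?_
    filter_upwards [eventually_ge_atTop k] with j hj
    exact Submodule.topologicalClosure_mono (hVm k j hj) (pr_mem _ _)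
  rw [hD2, norm_zero] at hD1
  linarith
end P14
end Part14

section Part15
open Filter Topology
section P15
variable {H : Type*} [NormedAddCommGroup H] [InnerProductSpace ℂ H] [CompleteSpace H]
variable {B : VonNeumannAlgebra H}

lemma finC_step {p R : BH H} (hpp : IsProjection p) (hR : R ∈ B) (hRp : IsProjection R) (hpR : p * R = R) (X T : ℕ → BH H)
    (hT : ∀ m, T m ∈ B) (hT0 : ∀ m, 0 ≤ T m)
    (hTt : ∀ ζ, Tendsto (fun k => T k ζ) atTop (𝓝 0)) (hXT : ∀ k m, k ≤ m → star (X m) * X m ≤ T k)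
    {c κ : ℝ} (hc : 0 < c) (hκ0 : 0 ≤ κ) (hκ : κ < c / 4) {K : ℕ} {ω ξ : H} (hω : ‖ω‖ ≤ 1)
    (hfr : ∃ᶠ m in atTop, c ≤ ‖star (X m) ξ‖) (hK : ∀ m, K ≤ m → ∀ ζ, ‖X m (p ζ - R ζ)‖ ≤ κ * ‖ζ‖) :
    ∃ R' ∈ B, ∃ K', IsProjection R' ∧ p * R' = R' ∧ R * R' = R' ∧ c ≤ ‖star (X K') ξ‖ ∧ ‖R' ω‖ ≤ c / 4 ∧
      ∃ κ', 0 ≤ κ' ∧ κ' < c / 4 ∧ ∀ m, K' ≤ m → ∀ ζ, ‖X m (p ζ - R' ζ)‖ ≤ κ' * ‖ζ‖ := by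
  obtain ⟨ε, hε, hεc⟩ : ∃ ε : ℝ, 0 < ε ∧ κ + ε < c / 4 := ⟨(c / 4 - κ) / 2, by linarith, by linarith⟩
  have hev : ∀ᶠ k in atTop, ‖T k (R ω)‖ < ε ^ 2 * (c / 4) ^ 2 := by
    have := (hTt (R ω)).norm
    rw [norm_zero] at this
    exact this.eventually (gt_mem_nhds (by positivity))
  obtain ⟨K', hK'1, hK'2, hK'3⟩ := (hfr.and_eventually (hev.and (eventually_ge_atTop K))).exists
  have hS0 : 0 ≤ R * T K' * R := by
    have := star_left_conjugate_nonneg (hT0 K') R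
    rwa [hRp.1.star_eq] at this
  obtain ⟨R', hR'B, hR'p, hcm, h1, h2, -, -, h4⟩ := spectral_cut (mul_mem (mul_mem hR (hT K')) hR) hS0 (ε ^ 2)
  have hR'R : R' * R = R' := by
    ext ζ
    have a := h4 (by positivity) (ζ - R ζ) (by
      rw [mul_apply_eq_comp]
      have : R (ζ - R ζ) = 0 := by
        rw [map_sub, sub_eq_zero]
        exact (congrArg (fun A : BH H => A ζ) hRp.2.eq).symm
      rw [this, map_zero])
    rw [map_sub, sub_eq_zero] at a
    rw [mul_apply_eq_comp, ← a]
  have hRR' : R * R' = R' := by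
    have := congrArg star hR'R
    rwa [star_mul, hR'p.1.star_eq, hRp.1.star_eq] at this
  have hpR' : p * R' = R' := by rw [← hRR', ← mul_assoc, hpR]
  refine ⟨R', hR'B, K', hR'p, hpR', hRR', hK'1, ?_, κ + ε, by positivity, hεc, ?_⟩
  · have a := h2 ω
    have e : qf (R * T K' * R) (R' ω) = (⟪R' (R (T K' (R ω))), R' ω⟫_ℂ).re := by
      unfold qf
      have := congrArg (fun A : BH H => A ω) hcm
      simp only [mul_apply_eq_comp] at this
      simp only [mul_apply_eq_comp]
      rw [this]
    rw [e] at a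
    have b : (⟪R' (R (T K' (R ω))), R' ω⟫_ℂ).re ≤ ‖T K' (R ω)‖ * 1 := by
      refine (Complex.re_le_norm _).trans ((norm_inner_le_norm _ _).trans ?_)
      exact mul_le_mul ((hR'p.norm_apply_le _).trans (hRp.norm_apply_le _)) ((hR'p.norm_apply_le _).trans hω) (norm_nonneg _) (norm_nonneg _)
    have : ‖R' ω‖ ^ 2 ≤ (c / 4) ^ 2 := by
      refine le_of_mul_le_mul_left (a := ε ^ 2) ?_ (by positivity)
      linarith
    exact le_of_sq_le_sq this (by positivity)
  · intro m hm ζ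
    have e : p ζ - R' ζ = (p ζ - R ζ) + (R ζ - R' ζ) := by abel
    rw [e, map_add, add_mul]
    refine (norm_add_le _ _).trans (add_le_add (hK m (hK'3.trans hm) ζ) ?_)
    refine le_of_sq_le_sq ?_ (by positivity)
    have e2 : R' (R ζ) = R' ζ := congrArg (fun A : BH H => A ζ) hR'R
    have a := h1 (R ζ)
    rw [e2] at a
    have e3 : R (R ζ - R' ζ) = R ζ - R' ζ := by
      rw [map_sub]
      congr 1
      · exact congrArg (fun A : BH H => A ζ) hRp.2.eq
      · exact congrArg (fun A : BH H => A ζ) hRR'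
    have e4 : qf (R * T K' * R) (R ζ - R' ζ) = qf (T K') (R ζ - R' ζ) := by
      have := qf_conj R (T K') (R ζ - R' ζ)
      rw [hRp.1.star_eq, e3] at this
      exact this
    rw [e4] at a
    have b := qf_mono (hXT K' m hm) (R ζ - R' ζ)
    rw [qf_star_mul] at b
    have d : ‖R ζ - R' ζ‖ ≤ ‖ζ‖ := by
      have := hR'p.compl.norm_apply_le (R ζ)
      rw [sub_apply, e2] at this
      exact (le_trans (by simpa using this) (hRp.norm_apply_le ζ))
    have d2 : ‖R ζ - R' ζ‖ ^ 2 ≤ ‖ζ‖ ^ 2 := by gcongr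
    rw [mul_pow]
    nlinarith [sq_nonneg ε]

theorem finC {p : BH H} (hp : IsFiniteProjection (B : Set (BH H)) p) (X T : ℕ → BH H) (hX : ∀ m, X m ∈ B)
    (hXp : ∀ m, X m * p = X m) (hX1 : ∀ m, ‖X m‖ ≤ 1)
    (hT : ∀ m, T m ∈ B) (hT0 : ∀ m, 0 ≤ T m)
    (hTt : ∀ ζ, Tendsto (fun k => T k ζ) atTop (𝓝 0)) (hXT : ∀ k m, k ≤ m → star (X m) * X m ≤ T k)
    {ξ : H} (hξ : ‖ξ‖ ≤ 1) {c : ℝ} (hc : 0 < c) : ∀ᶠ m in atTop, ‖star (X m) ξ‖ < c := by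
  by_contra hcon
  have hfr : ∃ᶠ m in atTop, c ≤ ‖star (X m) ξ‖ := by
    intro h; exact hcon (h.mono fun m hm => not_le.1 hm)
  have hω : ∀ m, ‖star (X m) ξ‖ ≤ 1 := fun m => by
    refine (ContinuousLinearMap.le_opNorm _ _).trans ?_
    rw [norm_star]
    exact mul_le_one₀ (hX1 m) (norm_nonneg _) hξ
  obtain ⟨K0, hK0⟩ := hfr.exists
  let St := {q : BH H × ℕ // q.1 ∈ B ∧ IsProjection q.1 ∧ p * q.1 = q.1 ∧ c ≤ ‖star (X q.2) ξ‖ ∧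
    ∃ κ, 0 ≤ κ ∧ κ < c / 4 ∧ ∀ m, q.2 ≤ m → ∀ ζ, ‖X m (p ζ - q.1 ζ)‖ ≤ κ * ‖ζ‖}
  have step : ∀ q : St, ∃ q' : St, q.1.1 * q'.1.1 = q'.1.1 ∧ ‖q'.1.1 (star (X q.1.2) ξ)‖ ≤ c / 4 := by
    rintro ⟨⟨R, K⟩, h1, h2, h3, h4, κ, h5, h6, h7⟩
    obtain ⟨R', hR', K', a1, a2, a3, a4, a5, a6⟩ := finC_step hp.1 h1 h2 h3 X T hT hT0 hTt hXT hc h5 h6 (hω K) hfr h7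
    exact ⟨⟨⟨R', K'⟩, hR', a1, a2, a4, a6⟩, a3, a5⟩
  choose nx hnx1 hnx2 using step
  have s0 : St := ⟨⟨p, K0⟩, hp.2.1, hp.1, hp.1.2.eq, hK0, 0, le_rfl, by positivity, fun m _ ζ => by simp⟩
  obtain ⟨s, hs⟩ : ∃ s : ℕ → St, ∀ n, s (n + 1) = nx (s n) := ⟨fun n => Nat.rec s0 (fun _ q => nx q) n, fun _ => rfl⟩
  obtain ⟨R, hRs⟩ : ∃ R : ℕ → BH H, ∀ n, R n = (s n).1.1 := ⟨_, fun _ => rfl⟩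
  obtain ⟨K, hKs⟩ : ∃ K : ℕ → ℕ, ∀ n, K n = (s n).1.2 := ⟨_, fun _ => rfl⟩
  have hRB : ∀ n, R n ∈ B := fun n => by rw [hRs]; exact (s n).2.1
  have hRp : ∀ n, IsProjection (R n) := fun n => by rw [hRs]; exact (s n).2.2.1
  have hpR : ∀ n, p * R n = R n := fun n => by rw [hRs]; exact (s n).2.2.2.1
  have hcK : ∀ n, c ≤ ‖star (X (K n)) ξ‖ := fun n => by rw [hKs]; exact (s n).2.2.2.2.1
  have hκ : ∀ n, ∃ κ, 0 ≤ κ ∧ κ < c / 4 ∧ ∀ ζ, ‖X (K n) (p ζ - R n ζ)‖ ≤ κ * ‖ζ‖ := fun n => by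
    obtain ⟨κ, h1, h2, h3⟩ := (s n).2.2.2.2.2
    rw [hRs, hKs]
    exact ⟨κ, h1, h2, h3 _ le_rfl⟩
  have hRR : ∀ n, R n * R (n + 1) = R (n + 1) := fun n => by rw [hRs, hRs, hs]; exact hnx1 _
  have hRω : ∀ n, ‖R (n + 1) (star (X (K n)) ξ)‖ ≤ c / 4 := fun n => by rw [hRs, hKs, hs]; exact hnx2 _
  have hRR2 : ∀ i j, i ≤ j → R i * R j = R j := by
    intro i j hij
    induction j, hij using Nat.le_induction with
    | base => exact (hRp i).2.eq
    | succ j hij ih => rw [← hRR j, ← mul_assoc, ih]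
  have hRR3 : ∀ i j, i ≤ j → R j * R i = R j := by
    intro i j hij
    have := congrArg star (hRR2 i j hij)
    rwa [star_mul, (hRp _).1.star_eq, (hRp _).1.star_eq] at this
  have hg : ∀ n, IsProjection (R n - R (n + 1)) := by
    intro n
    refine ⟨(hRp n).1.sub (hRp _).1, ?_⟩
    unfold IsIdempotentElem
    rw [sub_mul, mul_sub, mul_sub, hRR, (hRp n).2.eq, (hRp (n + 1)).2.eq, hRR3 n (n + 1) (by omega)]
    abel
  have hgg1 : ∀ i j, i < j → (R i - R (i + 1)) * (R j - R (j + 1)) = 0 := by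
    intro i j hij
    rw [sub_mul, mul_sub, mul_sub, hRR2 i j (by omega), hRR2 i (j + 1) (by omega), hRR2 (i + 1) j (by omega),
      hRR2 (i + 1) (j + 1) (by omega)]
    abel
  have hgg2 : ∀ i j, i < j → (R j - R (j + 1)) * (R i - R (i + 1)) = 0 := by
    intro i j hij
    have := congrArg star (hgg1 i j hij)
    rwa [star_mul, (hg _).1.star_eq, (hg _).1.star_eq, star_zero] at this
  refine finB hp (fun n => X (K n) * (R n - R (n + 1))) (fun n => R n - R (n + 1))
    (fun n => mul_mem (hX _) (sub_mem (hRB _) (hRB _))) hg (fun n => by rw [mul_sub, hpR, hpR]) ?_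
    (fun n => by rw [mul_assoc, (hg n).2.eq]) ?_ (ξ := ξ) (c := c / 2) (by positivity) ?_
  · intro i j hij
    rcases lt_or_gt_of_ne hij with h | h
    · exact hgg1 i j h
    · exact hgg2 j i h
  · intro n
    refine (norm_mul_le _ _).trans (mul_le_one₀ (hX1 _) (norm_nonneg _) (hg n).norm_le)
  · intro n
    rw [star_mul, (hg n).1.star_eq, mul_apply_eq_comp, sub_apply]
    obtain ⟨κ, hκ0, hκ1, hκ2⟩ := hκ n
    have a1 : ‖(p - R n) * star (X (K n))‖ ≤ κ := by
      rw [← norm_star, star_mul, star_star, star_sub, hp.1.1.star_eq, (hRp n).1.star_eq]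
      exact ContinuousLinearMap.opNorm_le_bound _ hκ0 fun ζ => by
        rw [mul_apply_eq_comp, sub_apply]; exact hκ2 ζ
    have a2 : ‖p (star (X (K n)) ξ) - R n (star (X (K n)) ξ)‖ ≤ κ := by
      have := ((p - R n) * star (X (K n))).le_opNorm ξ
      rw [mul_apply_eq_comp, sub_apply] at this
      nlinarith [norm_nonneg ξ]
    have a3 : p (star (X (K n)) ξ) = star (X (K n)) ξ := by
      have := congrArg star (hXp (K n))
      rw [star_mul, hp.1.1.star_eq] at this
      exact congrArg (fun A : BH H => A ξ) this
    rw [a3] at a2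
    have a4 := hcK n
    have a5 := hRω n
    have a6 := norm_sub_norm_le (star (X (K n)) ξ) (R n (star (X (K n)) ξ))
    have a7 := norm_sub_norm_le (R n (star (X (K n)) ξ)) (R (n + 1) (star (X (K n)) ξ))
    linarith
end P15
end Part15

section Part16
open Filter Topology
section P16
variable {H : Type*} [NormedAddCommGroup H] [InnerProductSpace ℂ H] [CompleteSpace H]
variable {B : VonNeumannAlgebra H}

lemma fin_conj {p u : BH H} (hp : IsFiniteProjection (B : Set (BH H)) p) (hu : u ∈ B) (h1 : star u * u = 1) (h2 : u * star u = 1) :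
    IsFiniteProjection (B : Set (BH H)) (u * p * star u) := by
  have hus : star u ∈ B := star_mem hu
  have cj : ∀ {q : BH H} {u : BH H}, star u * u = 1 → IsProjection q → IsProjection (u * q * star u) := by
    intro q u h1 hq
    refine ⟨?_, ?_⟩
    · unfold IsSelfAdjoint; rw [star_mul, star_mul, star_star, hq.1.star_eq, mul_assoc]
    · unfold IsIdempotentElem
      have : u * q * star u * (u * q * star u) = u * (q * ((star u * u) * q)) * star u := by simp only [mul_assoc]
      rw [this, h1, one_mul, hq.2.eq]
  refine ⟨cj h1 hp.1, mul_mem (mul_mem hu hp.2.1) hus, ?_⟩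
  rintro q hq hqB hqp ⟨v, hv, hv1, hv2⟩
  have hq' := cj (u := star u) (by rw [star_star]; exact h2) hq
  rw [star_star] at hq'
  have key := hp.2.2 (star u * q * u) hq' (mul_mem (mul_mem hus hqB) hu) ?_ ⟨star u * v * u, mul_mem (mul_mem hus hv) hu, ?_, ?_⟩
  · rw [← key]
    have : u * (star u * q * u) * star u = (u * star u) * q * (u * star u) := by simp only [mul_assoc]
    rw [this, h2, one_mul, mul_one]
  · have : star u * q * u * p = star u * (q * (u * p * star u)) * u := by
      simp only [mul_assoc]; rw [h1, mul_one]
    rw [this, hqp]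
  · rw [star_mul, star_mul, star_star]
    have : star u * (star v * u) * (star u * v * u) = star u * (star v * ((u * star u) * v)) * u := by simp only [mul_assoc]
    rw [this, h2, one_mul, hv1]
    have : star u * (u * p * star u) * u = (star u * u) * p * (star u * u) := by simp only [mul_assoc]
    rw [this, h1, one_mul, mul_one]
  · rw [star_mul, star_mul, star_star]
    have : star u * v * u * (star u * (star v * u)) = star u * (v * ((u * star u) * star v)) * u := by simp only [mul_assoc]
    rw [this, h2, one_mul, hv2]

theorem fin_total (hB : IsSemifiniteVN (B : Set (BH H))) {b : BH H} (hb : b ≠ 0) :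
    ∃ p, IsFiniteProjection (B : Set (BH H)) p ∧ p * b ≠ 0 := by
  by_contra hcon
  push Not at hcon
  obtain ⟨K, hK⟩ : ∃ K : Submodule ℂ H, K = Submodule.span ℂ {v | ∃ p η, IsFiniteProjection (B : Set (BH H)) p ∧ v = p η} := ⟨_, rfl⟩
  have hKm : ∀ p η, IsFiniteProjection (B : Set (BH H)) p → p η ∈ K := fun p η hp => by
    rw [hK]; exact Submodule.subset_span ⟨p, η, hp, rfl⟩
  have inv : ∀ t : BH H, (∀ p η, IsFiniteProjection (B : Set (BH H)) p → t (p η) ∈ K) → ∀ k ∈ K, t k ∈ K.topologicalClosure := by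
    intro t ht k hk
    refine K.le_topologicalClosure ?_
    have : K ≤ K.comap t.toLinearMap := by
      conv_lhs => rw [hK]
      refine Submodule.span_le.2 ?_
      rintro _ ⟨p, η, hp, rfl⟩
      exact ht p η hp
    exact this hk
  have hzB : pr K ∈ B := by
    refine pr_mem_vN K fun t ht => inv t fun p η hp => ?_
    have := congrArg (fun A : BH H => A η) (comm_of_mem (x := p) hp.2.1 ht)
    simp only [mul_apply_eq_comp] at this
    rw [this]
    exact hKm _ _ hp
  have huni : ∀ u ∈ B, star u * u = 1 → u * star u = 1 → ∀ k ∈ K, u k ∈ K.topologicalClosure := by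
    intro u hu h1 h2
    refine inv u fun p η hp => ?_
    have : u (p η) = (u * p * star u) (u η) := by
      have : u * p = u * p * star u * u := by rw [mul_assoc, h1, mul_one]
      exact congrArg (fun A : BH H => A η) this
    rw [this]
    exact hKm _ _ (fin_conj hp hu h1 h2)
  have hsa : ∀ a ∈ B, IsSelfAdjoint a → ‖a‖ ≤ 1 → pr K * a = a * pr K := by
    intro a ha hsa h1
    have hp0 : 0 ≤ 1 - a ^ 2 := by
      rw [sub_nonneg, ← (CStarAlgebra.norm_le_one_iff_of_nonneg (a ^ 2) hsa.sq_nonneg)]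
      rw [sq]
      exact (norm_mul_le _ _).trans (mul_le_one₀ h1 (norm_nonneg _) h1)
    obtain ⟨s, hsB, hss, hu⟩ : ∃ s ∈ B, star s = s ∧ a + Complex.I • s ∈ unitary (BH H) :=
      ⟨CFC.sqrt (1 - a ^ 2), vsqrt_mem (sub_mem (one_mem B) (pow_mem ha 2)) hp0, (sqrt_fac hp0).2.1,
        hsa.self_add_I_smul_cfcSqrt_sub_sq_mem_unitary a h1⟩
    have hre : star (a + Complex.I • s) = a - Complex.I • s := by
      rw [star_add, star_smul, hss, hsa.star_eq, Complex.star_def, Complex.conj_I, neg_smul, sub_eq_add_neg]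
    have huB : a + Complex.I • s ∈ B := add_mem ha (vsmul_mem _ hsB)
    obtain ⟨u1, u2⟩ := Unitary.mem_iff.1 hu
    have c1 : pr K * (a + Complex.I • s) = (a + Complex.I • s) * pr K :=
      pr_commute (huni _ huB u1 u2) (huni _ (star_mem huB) (by rw [star_star]; exact u2) (by rw [star_star]; exact u1))
    have c2 : pr K * (a - Complex.I • s) = (a - Complex.I • s) * pr K := by
      have := congrArg star c1
      rw [star_mul, star_mul, hre, (pr_proj K).1.star_eq] at this
      exact this.symm
    have e : a = (1 / 2 : ℂ) • ((a + Complex.I • s) + (a - Complex.I • s)) := by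
      rw [add_add_sub_cancel, ← two_smul ℂ a, smul_smul]; norm_num
    rw [e, mul_smul_comm, smul_mul_assoc, mul_add, add_mul, c1, c2]
  have hsa2 : ∀ a ∈ B, IsSelfAdjoint a → pr K * a = a * pr K := by
    intro a ha h
    have hn : (0 : ℝ) < ‖a‖ + 1 := by positivity
    have := hsa ((‖a‖ + 1)⁻¹ • a) (vrsmul_mem _ ha) (by unfold IsSelfAdjoint; rw [star_smul, h.star_eq, star_trivial (‖a‖ + 1)⁻¹]) (by
      rw [norm_smul, norm_inv, Real.norm_of_nonneg hn.le, inv_mul_le_iff₀ hn]; linarith)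
    rw [mul_smul_comm, smul_mul_assoc] at this
    exact smul_right_injective _ (inv_ne_zero hn.ne') this
  have hall : ∀ a ∈ B, pr K * a = a * pr K := by
    intro a ha
    have h1 := hsa2 (a + star a) (add_mem ha (star_mem ha)) (IsSelfAdjoint.add_star_self a)
    have h2 := hsa2 (Complex.I • (a - star a)) (vsmul_mem _ (sub_mem ha (star_mem ha))) (by
      unfold IsSelfAdjoint
      rw [star_smul, star_sub, star_star, Complex.star_def, Complex.conj_I, neg_smul, ← smul_neg, neg_sub])
    rw [mul_smul_comm, smul_mul_assoc] at h2
    have h3 := smul_right_injective _ Complex.I_ne_zero h2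
    rw [mul_add, add_mul] at h1
    rw [mul_sub, sub_mul] at h3
    have e1 := congrArg₂ (· + ·) h1 h3
    have e2 : (2 : ℂ) • (pr K * a) = (2 : ℂ) • (a * pr K) := by
      rw [two_smul, two_smul]
      rw [show pr K * a + pr K * a = pr K * a + pr K * star a + (pr K * a - pr K * star a) by abel, e1]; abel
    exact smul_right_injective _ two_ne_zero e2
  have hz1 : 1 - pr K = 0 := by
    by_contra hne
    obtain ⟨p, hp0, hpz, hpf⟩ := hB (1 - pr K) ⟨(pr_proj K).compl, sub_mem (one_mem B) hzB, fun x hx => by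
      rw [sub_mul, mul_sub, hall x hx, one_mul, mul_one]⟩ hne
    have h1 : pr K * p = p := by
      ext η; exact pr_of_mem' (hKm p η hpf)
    have h2 : p * pr K = p := by
      have := congrArg star h1
      rwa [star_mul, (pr_proj K).1.star_eq, hpf.1.1.star_eq] at this
    rw [mul_sub, mul_one, h2, sub_self] at hpz
    exact hp0 hpz.symm
  refine hb ?_
  ext η
  have h1 : pr K (b η) = b η := by
    have := congrArg (fun A : BH H => A (b η)) hz1
    simp only [sub_apply, ContinuousLinearMap.one_apply, ContinuousLinearMap.zero_apply, sub_eq_zero] at this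
    exact this.symm
  rw [← h1]
  refine pr_eq_zero fun k hk => ?_
  have : K ≤ LinearMap.ker (innerSL ℂ (b η)).toLinearMap := by
    rw [hK]
    refine Submodule.span_le.2 ?_
    rintro _ ⟨p, ζ, hp, rfl⟩
    rw [SetLike.mem_coe, LinearMap.mem_ker]
    change ⟪b η, p ζ⟫_ℂ = 0
    rw [← star_inner, hp.1.1.star_eq]
    have := congrArg (fun A : BH H => A η) (hcon p hp)
    simp only [mul_apply_eq_comp] at this
    rw [this]; simp
  have h2 : ⟪b η, k⟫_ℂ = 0 := this hk
  rw [← inner_conj_symm, h2, map_zero]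

lemma eq_zero_of_star_mul {a : BH H} (h : star a * a = 0) : a = 0 := (CStarRing.star_mul_self_eq_zero_iff a).1 h

theorem exists_shift {p0 : BH H} (hp0 : IsProjection p0) (hp0B : p0 ∈ B) (h : ¬ IsFiniteProjection (B : Set (BH H)) p0) :
    ∃ (f : BH H) (v : ℕ → BH H), f ≠ 0 ∧ IsProjection f ∧ f ∈ B ∧ (∀ m, v m ∈ B) ∧ (∀ m, star (v m) * v m = f) ∧
      (∀ i m, i ≠ m → star (v i) * v m = 0) ∧ (∀ m, p0 * v m = v m) := by
  unfold IsFiniteProjection at h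
  push Not at h
  obtain ⟨q, hq, hqB, hqp, ⟨w, hw, hw1, hw2⟩, hne⟩ := h hp0 hp0B
  have hpq : p0 * q = q := by
    have := congrArg star hqp
    rwa [star_mul, hq.1.star_eq, hp0.1.star_eq] at this
  have hqw : q * w = w := by
    have h1 : star (q * w - w) * (q * w - w) = 0 := by
      rw [star_sub, star_mul, hq.1.star_eq, sub_mul, mul_sub, mul_sub]
      have e1 : star w * q * (q * w) = star w * q * w := by
        rw [mul_assoc, ← mul_assoc q q w, hq.2.eq, mul_assoc]
      have e2 : star w * (q * w) = star w * q * w := by rw [mul_assoc]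
      have e3 : star w * q * w = p0 := by
        rw [← hw2]
        rw [show star w * (w * star w) * w = (star w * w) * (star w * w) by simp only [mul_assoc], hw1, hp0.2.eq]
      rw [e1, e2, e3, hw1]; abel
    exact sub_eq_zero.1 (eq_zero_of_star_mul h1)
  have hpw : p0 * w = w := by rw [← hqw, ← mul_assoc, hpq]
  have hf : IsProjection (p0 - q) := by
    refine ⟨hp0.1.sub hq.1, ?_⟩
    unfold IsIdempotentElem
    rw [sub_mul, mul_sub, mul_sub, hpq, hqp, hq.2.eq, hp0.2.eq]; abel
  have hwf : star w * (p0 - q) = 0 := by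
    refine eq_zero_of_star_mul ?_
    rw [star_mul, star_star, hf.1.star_eq]
    rw [show (p0 - q) * w * (star w * (p0 - q)) = (p0 - q) * ((w * star w) * (p0 - q)) by simp only [mul_assoc], hw2,
      mul_sub q, hqp, hq.2.eq, sub_self, mul_zero]
  obtain ⟨v, hv0, hv⟩ : ∃ v : ℕ → BH H, v 0 = p0 - q ∧ ∀ m, v (m + 1) = w * v m :=
    ⟨fun n => Nat.rec (p0 - q) (fun _ x => w * x) n, rfl, fun _ => rfl⟩
  have hpv : ∀ m, p0 * v m = v m := by
    intro m
    cases m with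
    | zero => rw [hv0, mul_sub, hp0.2.eq, hpq]
    | succ m => rw [hv, ← mul_assoc, hpw]
  have hss : ∀ i m, star (v (i + 1)) * v (m + 1) = star (v i) * v m := by
    intro i m
    rw [hv, hv, star_mul, show star (v i) * star w * (w * v m) = star (v i) * ((star w * w) * v m) by simp only [mul_assoc],
      hw1, hpv]
  have hs0 : ∀ m, star (v 0) * v (m + 1) = 0 := by
    intro m
    have := congrArg star hwf
    rw [star_mul, star_star, star_zero] at this
    rw [hv, hv0, ← mul_assoc, this, zero_mul]
  have hlt : ∀ i m, i < m → star (v i) * v m = 0 := by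
    intro i
    induction i with
    | zero => intro m hm; obtain ⟨m, rfl⟩ := Nat.exists_eq_succ_of_ne_zero (show m ≠ 0 by omega); exact hs0 m
    | succ i ih => intro m hm; obtain ⟨m, rfl⟩ := Nat.exists_eq_succ_of_ne_zero (show m ≠ 0 by omega)
                   rw [hss]; exact ih m (by omega)
  refine ⟨p0 - q, v, fun h => hne (sub_eq_zero.1 h).symm, hf, sub_mem hp0B hqB, ?_, ?_, ?_, hpv⟩
  · intro m
    induction m with
    | zero => rw [hv0]; exact sub_mem hp0B hqB
    | succ m ih => rw [hv]; exact mul_mem hw ih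
  · intro m
    induction m with
    | zero => rw [hv0, hf.1.star_eq, hf.2.eq]
    | succ m ih => rw [hss, ih]
  · intro i m him
    rcases lt_or_gt_of_ne him with h | h
    · exact hlt i m h
    · have := congrArg star (hlt m i h)
      rwa [star_mul, star_star, star_zero] at this
end P16
end Part16

section Part17
open Filter Topology
section P17
variable {H : Type*} [NormedAddCommGroup H] [InnerProductSpace ℂ H] [CompleteSpace H]
variable {L : Type*} [NormedAddCommGroup L] [InnerProductSpace ℂ L] [CompleteSpace L]
variable {M M₁ B : VonNeumannAlgebra H} {E : BH H → BH H}

lemma rep_norm_le {π : BH H → BH L} (hπ : IsRep M π) {x : BH H} (hx : x ∈ M) : ‖π x‖ ≤ ‖x‖ := by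
  refine norm_le_of_sq_le (norm_nonneg _) fun ζ => ?_
  have hxx : star x * x ∈ M := mul_mem (star_mem hx) hx
  have h1 : star x * x ≤ (‖x‖ ^ 2 : ℝ) • (1 : BH H) := by
    have := le_norm_smul (star_mul_self_nonneg x)
    rwa [CStarRing.norm_star_mul_self, ← sq] at this
  have h2 := qf_mono (hπ.mono hxx (vrsmul_mem _ (one_mem M)) h1) ζ
  rw [hπ.mul _ (star_mem hx) _ hx, hπ.star _ hx, ← Complex.coe_smul, hπ.smul _ _ (one_mem M), hπ.one, qf_csmul, qf_one] at h2
  exact h2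

lemma asymp (hE : IsCondExp (M : Set (BH H)) (B : Set (BH H)) E) (hn : IsNormalOn (M : Set (BH H)) E)
    {p f0 : BH H} (hp : IsFiniteProjection (B : Set (BH H)) p) (v : ℕ → BH H) (hv : ∀ m, v m ∈ M) (hf0 : IsProjection f0)
    (hvv : ∀ m, star (v m) * v m = f0) (hvo : ∀ i m, i ≠ m → star (v i) * v m = 0) (hpv : ∀ m, p * v m = v m) (i : ℕ)
    {ξ : H} (hξ : ‖ξ‖ ≤ 1) {c : ℝ} (hc : 0 < c) : ∀ᶠ m in atTop, ‖E (v m * star (v i)) ξ‖ < c := by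
  have hBM := hE.subset
  have hvs : ∀ m, star (v m) ∈ M := fun m => star_mem (hv m)
  have hvf : ∀ m, v m * f0 = v m := by
    intro m
    refine sub_eq_zero.1 (eq_zero_of_star_mul ?_)
    rw [star_sub, star_mul, hf0.1.star_eq, sub_mul, mul_sub, mul_sub,
      show f0 * star (v m) * (v m * f0) = f0 * (star (v m) * v m) * f0 by simp only [mul_assoc],
      show star (v m) * (v m * f0) = (star (v m) * v m) * f0 by simp only [mul_assoc], mul_assoc f0 (star (v m)), hvv, hf0.2.eq, hf0.2.eq]
    abel
  have hfp : ∀ m, IsProjection (v m * star (v m)) := by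
    intro m
    refine ⟨IsSelfAdjoint.mul_star_self _, ?_⟩
    unfold IsIdempotentElem
    rw [show v m * star (v m) * (v m * star (v m)) = v m * (star (v m) * v m) * star (v m) by simp only [mul_assoc], hvv, hvf]
  have hfo : ∀ i j, i ≠ j → (v i * star (v i)) * (v j * star (v j)) = 0 := by
    intro i j hij
    rw [show v i * star (v i) * (v j * star (v j)) = v i * (star (v i) * v j) * star (v j) by simp only [mul_assoc], hvo i j hij,
      mul_zero, zero_mul]
  obtain ⟨G, hG⟩ : ∃ G : ℕ → BH H, ∀ k, G k = ∑ m ∈ Finset.range k, v m * star (v m) := ⟨_, fun _ => rfl⟩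
  have hGM : ∀ k, G k ∈ M := fun k => by rw [hG]; exact sum_mem fun m _ => mul_mem (hv m) (hvs m)
  have hGs : ∀ k, G (k + 1) = G k + v k * star (v k) := fun k => by rw [hG, hG, Finset.sum_range_succ]
  have hGm : Monotone G := monotone_nat_of_le_succ fun k => by rw [hGs]; exact le_add_of_nonneg_right (hfp k).nonneg
  have hG1 : ∀ k, G k ≤ 1 := fun k => by rw [hG]; exact (proj_sum _ hfp hfo _).le_one
  obtain ⟨f, hf⟩ := inc_lim hGm hG1
  have hfM : f ∈ M := inc_lim_mem M hGm hGM hf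
  have hlub := hn (Set.range G) (by rintro _ ⟨k, rfl⟩; exact hGM k) (Set.range_nonempty G) (directedOn_range.2 hGm.directed_le) f hfM hf
  rw [← Set.range_comp] at hlub
  have hEGm : Monotone (E ∘ G) := fun i j hij => ce_mono hE (hGM i) (hGM j) (hGm hij)
  have hXM : ∀ m, v i * star (v m) ∈ M := fun m => mul_mem (hv i) (hvs m)
  have hst : ∀ m, star (E (v i * star (v m))) = E (v m * star (v i)) := fun m => by
    rw [← ce_star hE (hXM m), star_mul, star_star]
  have hXX : ∀ m, star (E (v i * star (v m))) * E (v i * star (v m)) ≤ E (v m * star (v m)) := by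
    intro m
    have := ce_ks hE (hXM m)
    rwa [star_mul, star_star, show v m * star (v i) * (v i * star (v m)) = v m * (star (v i) * v i) * star (v m) by simp only [mul_assoc],
      hvv, hvf] at this
  have key := finC hp (fun m => E (v i * star (v m))) (fun k => E f - E (G k)) (fun m => hE.maps_to _ (hXM m)) ?_ ?_
    (fun k => sub_mem (hE.maps_to _ hfM) (hE.maps_to _ (hGM k))) ?_ ?_ ?_ hξ hc
  · simp only [hst] at key; exact key
  · intro m
    change E (v i * star (v m)) * p = _
    rw [← ce_right hE hp.2.1 (hXM m), mul_assoc]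
    have : star (v m) * p = star (v m) := by
      have := congrArg star (hpv m)
      rwa [star_mul, hp.1.1.star_eq] at this
    rw [this]
  · intro m
    refine norm_le_of_sq_le zero_le_one fun ζ => ?_
    have h1 := qf_mono ((hXX m).trans (ce_mono hE (mul_mem (hv m) (hvs m)) (one_mem M) (hfp m).le_one)) ζ
    rw [ce_one hE, qf_one] at h1
    rw [one_pow, one_mul]; exact h1
  · intro k
    rw [sub_nonneg]
    exact ce_mono hE (hGM k) hfM (hf.1 ⟨k, rfl⟩)
  · intro ζ
    have := (lub_tendsto hEGm hlub ζ).const_sub (E f ζ)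
    rw [sub_self] at this
    exact this
  · intro k m hkm
    refine (hXX m).trans ?_
    rw [← ce_sub hE hfM (hGM k)]
    refine ce_mono hE (mul_mem (hv m) (hvs m)) (sub_mem hfM (hGM k)) ?_
    rw [le_sub_iff_add_le]
    have h1 : G (m + 1) ≤ f := hf.1 ⟨m + 1, rfl⟩
    refine le_trans ?_ h1
    rw [hGs, add_comm]
    exact add_le_add_left (hGm hkm) _

lemma cutoff {s : Finset ℕ} {A : ℕ → BH H} (hA : ∀ j ∈ s, A j ∈ B) {n : ℝ} (hn : 0 < n) :
    ∃ c ∈ B, star c = c ∧ ‖c‖ ≤ 1 ∧ (∀ j ∈ s, ‖A j * c‖ ≤ 1 / n) ∧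
      ∀ η, ‖η - c η‖ ≤ n ^ 2 * ∑ j ∈ s, ‖star (A j) (A j η)‖ := by
  have hδ : 0 < 1 / n ^ 2 := by positivity
  have hYB : ∑ j ∈ s, star (A j) * A j ∈ B := sum_mem fun j hj => mul_mem (star_mem (hA j hj)) (hA j hj)
  have hY0 : 0 ≤ ∑ j ∈ s, star (A j) * A j := Finset.sum_nonneg fun j _ => star_mul_self_nonneg _
  have hYle : ∀ j ∈ s, ∀ ζ, ‖A j ζ‖ ^ 2 ≤ qf (∑ j ∈ s, star (A j) * A j) ζ := by
    intro j hj ζ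
    rw [qf_sum, ← qf_star_mul]
    exact Finset.single_le_sum (f := fun j => qf (star (A j) * A j) ζ) (fun i _ => qf_nonneg (star_mul_self_nonneg _) ζ) hj
  have hYn : ∀ η, ‖(∑ j ∈ s, star (A j) * A j) η‖ ≤ ∑ j ∈ s, ‖star (A j) (A j η)‖ := by
    intro η
    rw [ContinuousLinearMap.sum_apply]
    exact norm_sum_le _ _
  have hYs : star (∑ j ∈ s, star (A j) * A j) = ∑ j ∈ s, star (A j) * A j := (sa_of_nonneg hY0).star_eq
  generalize (∑ j ∈ s, star (A j) * A j) = Y at *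
  generalize hd : 1 / n ^ 2 = δ at *
  obtain ⟨r, hrB, h1, h2, h3, h4, h5⟩ := resolvent hYB hY0 hδ
  refine ⟨δ • r, vrsmul_mem _ hrB, by rw [star_smul, h5, star_trivial δ], ?_, ?_, ?_⟩
  · exact ContinuousLinearMap.opNorm_le_bound _ zero_le_one fun ζ => by rw [one_mul, smul_apply]; exact h3 ζ
  · intro j hj
    refine ContinuousLinearMap.opNorm_le_bound _ (by positivity) fun ζ => ?_
    refine le_of_sq_le_sq ?_ (by positivity)
    rw [mul_apply_eq_comp, smul_apply, ContinuousLinearMap.map_smul_of_tower, norm_smul, mul_pow, mul_pow, Real.norm_of_nonneg hδ.le]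
    have a := hYle j hj (r ζ)
    have b := h4 ζ
    have e : (1 / n) ^ 2 = δ := by rw [← hd]; ring
    rw [e]
    have := mul_le_mul_of_nonneg_left a hδ.le
    nlinarith
  · intro η
    have e1 : (δ • r + Y * r) = 1 := by ext ζ; exact h1 ζ
    have e2 := congrArg star e1
    rw [star_add, star_smul, star_mul, h5, hYs, star_one, star_trivial δ] at e2
    have e3 := congrArg (fun A : BH H => A η) e2
    simp only [add_apply, mul_apply_eq_comp] at e3
    have e4 : η - (δ • r) η = r (Y η) := by
      rw [sub_eq_iff_eq_add, add_comm]; exact e3.symm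
    rw [e4]
    have a := h3 (Y η)
    rw [norm_smul, Real.norm_of_nonneg hδ.le] at a
    have b := hYn η
    have e : n ^ 2 * δ = 1 := by rw [← hd]; field_simp
    calc ‖r (Y η)‖ = n ^ 2 * (δ * ‖r (Y η)‖) := by rw [← mul_assoc, e, one_mul]
      _ ≤ _ := by gcongr; exact a.trans b

lemma almost_orth (N : ℕ) (hN : 0 < N) (A : ℕ → BH L) (hd : ∀ i < N, ‖A i * star (A i)‖ ≤ 1)
    (ho : ∀ i < N, ∀ j < N, i ≠ j → ‖A i * star (A j)‖ ≤ 1 / N) (ζ : L) :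
    ∑ i ∈ Finset.range N, ‖A i ζ‖ ^ 2 ≤ 2 * ‖ζ‖ ^ 2 := by
  have hN' : (0 : ℝ) < N := by exact_mod_cast hN
  generalize hs : ∑ i ∈ Finset.range N, ‖A i ζ‖ ^ 2 = s
  have hs0 : 0 ≤ s := by rw [← hs]; positivity
  generalize hw : ∑ i ∈ Finset.range N, star (A i) (A i ζ) = w
  have h1 : (⟪w, ζ⟫_ℂ).re = s := by
    rw [← hw, sum_inner, Complex.re_sum, ← hs]
    refine Finset.sum_congr rfl fun i _ => ?_
    rw [star_inner, inner_self_eq_norm_sq_to_K]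
    norm_cast
  have h2 : ‖w‖ ^ 2 ≤ 2 * s := by
    have e : ‖w‖ ^ 2 = ∑ i ∈ Finset.range N, ∑ j ∈ Finset.range N, (⟪A i ζ, (A i * star (A j)) (A j ζ)⟫_ℂ).re := by
      rw [← inner_self_eq_norm_sq (𝕜 := ℂ)]
      change (⟪w, w⟫_ℂ).re = _
      conv_lhs => rw [← hw]
      rw [sum_inner, Complex.re_sum]
      refine Finset.sum_congr rfl fun i _ => ?_
      rw [inner_sum, Complex.re_sum]
      refine Finset.sum_congr rfl fun j _ => ?_
      rw [star_inner, mul_apply_eq_comp]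
    have hb : ∀ i ∈ Finset.range N, ∀ j ∈ Finset.range N, (⟪A i ζ, (A i * star (A j)) (A j ζ)⟫_ℂ).re ≤
        (if i = j then ‖A i ζ‖ ^ 2 else 0) + 1 / N * (‖A i ζ‖ * ‖A j ζ‖) := by
      intro i hi j hj
      rw [Finset.mem_range] at hi hj
      have c1 := (Complex.re_le_norm _).trans (norm_inner_le_norm (𝕜 := ℂ) (A i ζ) ((A i * star (A j)) (A j ζ)))
      have c2 := (A i * star (A j)).le_opNorm (A j ζ)
      refine c1.trans ((mul_le_mul_of_nonneg_left c2 (norm_nonneg _)).trans ?_)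
      split_ifs with hij
      · subst hij
        have := hd i hi
        have : 0 ≤ 1 / (N : ℝ) * (‖A i ζ‖ * ‖A i ζ‖) := by positivity
        nlinarith [mul_nonneg (norm_nonneg (A i ζ)) (norm_nonneg (A i ζ))]
      · have := ho i hi j hj hij
        rw [zero_add]
        nlinarith [mul_nonneg (norm_nonneg (A i ζ)) (norm_nonneg (A j ζ))]
    rw [e]
    refine (Finset.sum_le_sum fun i hi => Finset.sum_le_sum fun j hj => hb i hi j hj).trans ?_
    have e2 : ∀ i ∈ Finset.range N, ∑ j ∈ Finset.range N, ((if i = j then ‖A i ζ‖ ^ 2 else 0) + 1 / N * (‖A i ζ‖ * ‖A j ζ‖)) =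
        ‖A i ζ‖ ^ 2 + 1 / N * ‖A i ζ‖ * ∑ j ∈ Finset.range N, ‖A j ζ‖ := by
      intro i hi
      rw [Finset.sum_add_distrib, Finset.sum_ite_eq, if_pos hi, Finset.mul_sum]
      congr 1
      exact Finset.sum_congr rfl fun j _ => by ring
    rw [Finset.sum_congr rfl e2, Finset.sum_add_distrib, hs, ← Finset.sum_mul, ← Finset.mul_sum]
    have := sq_sum_le_card_mul_sum_sq (s := Finset.range N) (f := fun i => ‖A i ζ‖)
    rw [Finset.card_range, hs] at this
    have e3 : 1 / (N : ℝ) * (∑ i ∈ Finset.range N, ‖A i ζ‖) * ∑ i ∈ Finset.range N, ‖A i ζ‖ ≤ s := by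
      rw [mul_assoc, ← sq, one_div, inv_mul_le_iff₀ hN']; exact this
    linarith
  have h3 : s ≤ ‖w‖ * ‖ζ‖ := by rw [← h1]; exact (Complex.re_le_norm _).trans (norm_inner_le_norm _ _)
  have h4 : s * s ≤ s * (2 * ‖ζ‖ ^ 2) := by
    have : s ^ 2 ≤ (‖w‖ * ‖ζ‖) ^ 2 := by gcongr
    rw [mul_pow] at this
    nlinarith [sq_nonneg ‖ζ‖]
  rcases hs0.eq_or_lt with h | h
  · rw [← h]; positivity
  · exact le_of_mul_le_mul_left h4 h
end P17
end Part17

section Part18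
open Filter Topology
section P18
variable {H : Type*} [NormedAddCommGroup H] [InnerProductSpace ℂ H] [CompleteSpace H]
variable {L : Type*} [NormedAddCommGroup L] [InnerProductSpace ℂ L] [CompleteSpace L]
variable {M M₁ B Q : VonNeumannAlgebra H} {E F : BH H → BH H} {π : BH H → BH L} {Φ : BH L → BH H}

lemma IsPhi.sub (hΦ : IsPhi M Q π F Φ) (S T : BH L) : Φ (S - T) = Φ S - Φ T := by
  have := hΦ.add (S - T) T
  rw [sub_add_cancel] at this
  rw [this]; abel
lemma IsPhi.zero (hΦ : IsPhi M Q π F Φ) : Φ 0 = 0 := by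
  have := hΦ.sub 0 0
  rwa [sub_self, sub_self] at this
lemma IsPhi.sum (hΦ : IsPhi M Q π F Φ) (s : Finset ℕ) (T : ℕ → BH L) : Φ (∑ i ∈ s, T i) = ∑ i ∈ s, Φ (T i) := by
  induction s using Finset.induction_on with
  | empty => simp [hΦ.zero]
  | insert a s ha ih => rw [Finset.sum_insert ha, Finset.sum_insert ha, hΦ.add, ih]
lemma IsPhi.mono (hΦ : IsPhi M Q π F Φ) {S T : BH L} (h : S ≤ T) : Φ S ≤ Φ T := by
  rw [← sub_nonneg, ← hΦ.sub]; exact hΦ.pos _ (sub_nonneg.2 h)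

lemma seq_indices {P : ℕ → ℕ → Prop} (h : ∀ i, ∀ᶠ m in atTop, P i m) : ∃ m : ℕ → ℕ, ∀ i j, i < j → P (m i) (m j) := by
  choose K hK using fun i => eventually_atTop.1 (h i)
  obtain ⟨m, hm⟩ : ∃ m : ℕ → ℕ, ∀ j, m (j + 1) = (∑ k ∈ Finset.range (m j + 1), K k) + m j + 1 :=
    ⟨fun n => Nat.rec 0 (fun _ x => (∑ k ∈ Finset.range (x + 1), K k) + x + 1) n, fun _ => rfl⟩
  have hmm : Monotone m := monotone_nat_of_le_succ fun j => by rw [hm]; omega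
  refine ⟨m, fun i j hij => hK _ _ ?_⟩
  obtain ⟨j, rfl⟩ := Nat.exists_eq_succ_of_ne_zero (show j ≠ 0 by omega)
  rw [Nat.succ_eq_add_one, hm]
  have h1 : m i ≤ m j := hmm (by omega)
  have := Finset.single_le_sum (f := K) (s := Finset.range (m j + 1)) (fun _ _ => Nat.zero_le _)
    (Finset.mem_range.2 (by omega : m i < m j + 1))
  omega

lemma qf_lip {b : BH H} (hb : ‖b‖ ≤ 1) {x y : H} (hx : ‖x‖ ≤ 1) (hy : ‖y‖ ≤ 1) : qf b x - 2 * ‖x - y‖ ≤ qf b y := by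
  have e : qf b x - qf b y = (⟪b (x - y), x⟫_ℂ).re + (⟪b y, x - y⟫_ℂ).re := by
    unfold qf
    rw [map_sub, inner_sub_left, inner_sub_right, Complex.sub_re, Complex.sub_re]; ring
  have h1 : (⟪b (x - y), x⟫_ℂ).re ≤ ‖x - y‖ := by
    refine (Complex.re_le_norm _).trans ((norm_inner_le_norm _ _).trans ?_)
    have := b.le_opNorm (x - y)
    nlinarith [norm_nonneg (x - y), norm_nonneg x, norm_nonneg (b (x - y))]
  have h2 : (⟪b y, x - y⟫_ℂ).re ≤ ‖x - y‖ := by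
    refine (Complex.re_le_norm _).trans ((norm_inner_le_norm _ _).trans ?_)
    have h3 : ‖b y‖ ≤ 1 := (b.le_opNorm y).trans (mul_le_one₀ hb (norm_nonneg _) hy)
    nlinarith [norm_nonneg (x - y)]
  linarith

/-- the contradiction from a long almost orthogonal family -/
lemma core_fam (hE : IsCondExp (M : Set (BH H)) (B : Set (BH H)) E) (hBM1 : (B : Set (BH H)) ⊆ (M₁ : Set (BH H)))
    (h1M : (M₁ : Set (BH H)) ⊆ (M : Set (BH H))) (hπ : IsRep M π) {e : BH L} (he : IsProjection e)
    (hee : ∀ x ∈ M₁, e * π x * e = π (E x) * e) (hΦ : IsPhi M M₁ π F Φ) (hF1 : F 1 = 1)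
    (N : ℕ) (hN : 0 < N) (u : ℕ → BH H) (hu : ∀ i, u i ∈ M₁) (hu1 : ∀ i, ‖u i‖ ≤ 1) {ξ : H} (hξ : ‖ξ‖ ≤ 1)
    {δ τ : ℝ} (hτ : ∀ i j, i < j → ‖E (u j * star (u i)) (u i ξ)‖ ≤ τ) (hb : ∀ i, δ ≤ qf (Φ e) (u i ξ)) :
    N * (δ - 2 * (N ^ 2 * (N * τ))) ≤ 2 := by
  have hN' : (0 : ℝ) < N := by exact_mod_cast hN
  have huM : ∀ i, u i ∈ M := fun i => h1M (hu i)
  have hus : ∀ i, star (u i) ∈ M₁ := fun i => star_mem (hu i)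
  have huu1 : ∀ i j, u i * star (u j) ∈ M₁ := fun i j => mul_mem (hu i) (hus j)
  have huu : ∀ i j, u i * star (u j) ∈ M := fun i j => h1M (huu1 i j)
  have hEB : ∀ i j, E (u i * star (u j)) ∈ B := fun i j => hE.maps_to _ (huu i j)
  have hEst : ∀ i j, star (E (u i * star (u j))) = E (u j * star (u i)) := fun i j => by
    rw [← ce_star hE (huu i j), star_mul, star_star]
  have hEn : ∀ i j, ‖E (u i * star (u j))‖ ≤ 1 := by
    intro i j
    refine norm_le_of_sq_le zero_le_one fun ζ => ?_
    have h1 := qf_mono (ce_ks hE (huu i j)) ζ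
    have h2 : star (u i * star (u j)) * (u i * star (u j)) ≤ 1 := by
      have h0 : ‖u i * star (u j)‖ ≤ 1 := (norm_mul_le _ _).trans (mul_le_one₀ (hu1 i) (norm_nonneg _) (by rw [norm_star]; exact hu1 j))
      refine le_of_qf (IsSelfAdjoint.star_mul_self _) (IsSelfAdjoint.one _) fun η => ?_
      rw [qf_star_mul, qf_one]
      have := (u i * star (u j)).le_opNorm η
      have h3 : ‖(u i * star (u j)) η‖ ≤ ‖η‖ := by nlinarith [norm_nonneg η]
      gcongr
    have h3 := qf_mono (ce_mono hE (mul_mem (star_mem (huu i j)) (huu i j)) (one_mem M) h2) ζ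
    rw [ce_one hE, qf_one] at h3
    rw [one_pow, one_mul]; exact h1.trans h3
  choose c hcB hcs hc1 hcE hcη using fun i => cutoff (B := B) (s := Finset.Ico (i + 1) N) (A := fun j => E (u j * star (u i)))
    (fun j _ => hEB j i) hN'
  have hcM1 : ∀ i, c i ∈ M₁ := fun i => hBM1 (hcB i)
  have hcu : ∀ i, c i * u i ∈ M₁ := fun i => mul_mem (hcM1 i) (hu i)
  have hAA : ∀ i j, e * π (c i * u i) * star (e * π (c j * u j)) = π (c i * E (u i * star (u j)) * c j) * e := by
    intro i j
    rw [star_mul, he.1.star_eq, ← hπ.star _ (h1M (hcu j)),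
      show e * π (c i * u i) * (π (star (c j * u j)) * e) = e * (π (c i * u i) * π (star (c j * u j))) * e by simp only [mul_assoc],
      ← hπ.mul _ (h1M (hcu i)) _ (h1M (star_mem (hcu j))), hee _ (mul_mem (hcu i) (star_mem (hcu j))), star_mul, hcs,
      show c i * u i * (star (u j) * c j) = c i * (u i * star (u j)) * c j by simp only [mul_assoc],
      hE.bimod _ (hcB i) _ (hcB j) _ (huu i j)]
  have hAn : ∀ i j, ‖e * π (c i * u i) * star (e * π (c j * u j))‖ ≤ ‖c i * E (u i * star (u j)) * c j‖ := by
    intro i j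
    rw [hAA]
    refine (norm_mul_le _ _).trans ?_
    have := rep_norm_le hπ (h1M (hBM1 (mul_mem (mul_mem (hcB i) (hEB i j)) (hcB j))))
    have h2 := he.norm_le
    nlinarith [norm_nonneg (π (c i * E (u i * star (u j)) * c j))]
  have hlt : ∀ i j, i < j → j < N → ‖c i * E (u i * star (u j)) * c j‖ ≤ 1 / N := by
    intro i j hij hj
    have a := hcE i j (Finset.mem_Ico.2 ⟨hij, hj⟩)
    have a2 : ‖c i * E (u i * star (u j))‖ ≤ 1 / N := by
      rw [← norm_star, star_mul, hEst, hcs]; exact a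
    refine (norm_mul_le _ _).trans ?_
    have := hc1 j
    nlinarith [norm_nonneg (c i * E (u i * star (u j))), norm_nonneg (c j)]
  have hT := almost_orth N hN (fun i => e * π (c i * u i)) (fun i _ => (hAn i i).trans ?_) ?_
  rotate_left
  · refine (norm_mul_le _ _).trans (mul_le_one₀ ((norm_mul_le _ _).trans (mul_le_one₀ (hc1 i) (norm_nonneg _) (hEn i i))) (norm_nonneg _) (hc1 i))
  · intro i hi j hj hij
    refine (hAn i j).trans ?_
    rcases lt_or_gt_of_ne hij with h | h
    · exact hlt i j h hj
    · rw [← norm_star, star_mul, star_mul, hEst, hcs, hcs, ← mul_assoc]; exact hlt j i h hi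
  have hTle : ∑ i ∈ Finset.range N, star (e * π (c i * u i)) * (e * π (c i * u i)) ≤ (2 : ℝ) • (1 : BH L) := by
    refine le_of_qf (isSelfAdjoint_sum _ fun i _ => IsSelfAdjoint.star_mul_self _) ?_ fun ζ => ?_
    · unfold IsSelfAdjoint; rw [star_smul, star_one, star_trivial (2 : ℝ)]
    · rw [qf_sum, qf_smul, qf_one]
      simp only [qf_star_mul]
      exact hT ζ
  have hΦT := qf_mono (hΦ.mono hTle) ξ
  have hΦ1 : Φ 1 = 1 := by rw [← hπ.one, hΦ.map 1 (one_mem M), hF1]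
  rw [← Complex.coe_smul, hΦ.smul, hΦ1, qf_csmul, qf_one, hΦ.sum, qf_sum] at hΦT
  have hterm : ∀ i, qf (Φ (star (e * π (c i * u i)) * (e * π (c i * u i)))) ξ = qf (Φ e) (c i (u i ξ)) := by
    intro i
    rw [star_mul, he.1.star_eq, ← hπ.star _ (h1M (hcu i)),
      show π (star (c i * u i)) * e * (e * π (c i * u i)) = π (star (c i * u i)) * (e * e) * π (c i * u i) by simp only [mul_assoc],
      he.2.eq, hΦ.bimod _ (star_mem (hcu i)) _ (hcu i), qf_conj, mul_apply_eq_comp]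
  have hb1 : ‖Φ e‖ ≤ 1 := by
    have h := norm_mono (hΦ.pos e he.nonneg) (hΦ.mono he.le_one)
    rw [hΦ1] at h
    exact h.trans ContinuousLinearMap.norm_id_le
  have huξ : ∀ i, ‖u i ξ‖ ≤ 1 := fun i => ((u i).le_opNorm ξ).trans (mul_le_one₀ (hu1 i) (norm_nonneg _) hξ)
  have hlow : ∀ i ∈ Finset.range N, δ - 2 * (N ^ 2 * (N * τ)) ≤ qf (Φ (star (e * π (c i * u i)) * (e * π (c i * u i)))) ξ := by
    intro i hi
    rw [hterm]
    have a1 := qf_lip hb1 (huξ i) (((c i).le_opNorm _).trans (mul_le_one₀ (hc1 i) (norm_nonneg _) (huξ i)))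
    have a2 := hcη i (u i ξ)
    have hτ0 : 0 ≤ τ := (norm_nonneg _).trans (hτ i (i + 1) (by omega))
    have a3 : ∑ j ∈ Finset.Ico (i + 1) N, ‖star (E (u j * star (u i))) (E (u j * star (u i)) (u i ξ))‖ ≤ N * τ := by
      refine (Finset.sum_le_card_nsmul _ _ τ fun j hj => ?_).trans ?_
      · rw [Finset.mem_Ico] at hj
        refine (ContinuousLinearMap.le_opNorm _ _).trans ?_
        rw [norm_star]
        have b1 := hEn j i
        have b2 := hτ i j (by omega)
        nlinarith [norm_nonneg (E (u j * star (u i)) (u i ξ))]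
      · rw [Nat.card_Ico, nsmul_eq_mul]
        gcongr
        exact_mod_cast Nat.sub_le _ _
    have a4 : ‖u i ξ - c i (u i ξ)‖ ≤ N ^ 2 * (N * τ) := a2.trans (by gcongr)
    have := hb i
    linarith
  have hsum := Finset.sum_le_sum hlow
  rw [Finset.sum_const, Finset.card_range, nsmul_eq_mul] at hsum
  nlinarith [norm_nonneg ξ]

theorem core (hE : IsCondExp (M : Set (BH H)) (B : Set (BH H)) E) (hn : IsNormalOn (M : Set (BH H)) E)
    (hBM1 : (B : Set (BH H)) ⊆ (M₁ : Set (BH H)))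
    (h1M : (M₁ : Set (BH H)) ⊆ (M : Set (BH H))) (hB : IsSemifiniteVN (B : Set (BH H))) (hIII : IsTypeIII (M₁ : Set (BH H)))
    (hπ : IsRep M π) {e : BH L} (he : IsProjection e)
    (hee : ∀ x ∈ M₁, e * π x * e = π (E x) * e) (hΦ : IsPhi M M₁ π F Φ) (hF1 : F 1 = 1) : Φ e = 0 := by
  by_contra hne
  obtain ⟨p, hp, hpb⟩ := fin_total hB hne
  have hb0 : 0 ≤ Φ e := hΦ.pos e he.nonneg
  have hbM : Φ e ∈ M₁ := hΦ.mem e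
  have hpM : p ∈ M₁ := hBM1 hp.2.1
  have hT0 : 0 ≤ p * Φ e * p := by
    have := star_left_conjugate_nonneg hb0 p
    rwa [hp.1.1.star_eq] at this
  have hTne : p * Φ e * p ≠ 0 := by
    intro h0
    refine hpb ?_
    have h1 : Φ e * p = 0 := by
      ext ζ
      rw [mul_apply_eq_comp]
      refine apply_eq_zero_of_qf hb0 ?_
      have := qf_conj p (Φ e) ζ
      rw [hp.1.1.star_eq, h0, qf_zero] at this
      exact this.symm
    have := congrArg star h1
    rwa [star_mul, hp.1.1.star_eq, (sa_of_nonneg hb0).star_eq, star_zero] at this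
  obtain ⟨ξ1, hξ1⟩ : ∃ ξ, qf (p * Φ e * p) ξ ≠ 0 := by
    by_contra hc
    push Not at hc
    exact hTne (eq_zero_of_qf hT0 hc)
  have hq : 0 < qf (p * Φ e * p) ξ1 := lt_of_le_of_ne (qf_nonneg hT0 _) (Ne.symm hξ1)
  obtain ⟨δ, hδ, hδ1⟩ : ∃ δ : ℝ, 0 < δ ∧ δ * ‖ξ1‖ ^ 2 < qf (p * Φ e * p) ξ1 := by
    refine ⟨qf (p * Φ e * p) ξ1 / (‖ξ1‖ ^ 2 + 1), by positivity, ?_⟩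
    rw [div_mul_eq_mul_div, div_lt_iff₀ (by positivity)]
    linarith
  obtain ⟨p0, hp0M, hp0, -, -, hlow, hzero, -, hker⟩ := spectral_cut (mul_mem (mul_mem hpM hbM) hpM) hT0 δ
  have hp0ne : p0 ≠ 0 := fun h => by
    have := hzero h ξ1
    linarith
  have hp0p : p0 * p = p0 := by
    ext ζ
    have a := hker hδ.le (ζ - p ζ) (by
      rw [mul_apply_eq_comp]
      have : p (ζ - p ζ) = 0 := by
        rw [map_sub, sub_eq_zero]
        exact (congrArg (fun A : BH H => A ζ) hp.1.2.eq).symm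
      rw [this, map_zero])
    rw [map_sub, sub_eq_zero] at a
    rw [mul_apply_eq_comp, ← a]
  have hpp0 : p * p0 = p0 := by
    have := congrArg star hp0p
    rwa [star_mul, hp0.1.star_eq, hp.1.1.star_eq] at this
  obtain ⟨f, v, hf0, hf, hfM, hv, hvv, hvo, hpv⟩ := exists_shift hp0 hp0M (fun h => hp0ne (hIII p0 h))
  obtain ⟨ξ, hξ1, hfξ⟩ : ∃ ξ : H, ‖ξ‖ = 1 ∧ f ξ = ξ := by
    obtain ⟨η, hη⟩ : ∃ η, f η ≠ 0 := by
      by_contra hc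
      push Not at hc
      exact hf0 (by ext η; simpa using hc η)
    have hn : ‖f η‖ ≠ 0 := norm_ne_zero_iff.2 hη
    refine ⟨((‖f η‖ : ℂ)⁻¹) • f η, ?_, ?_⟩
    · rw [norm_smul, norm_inv, Complex.norm_real, norm_norm, inv_mul_cancel₀ hn]
    · rw [map_smul]
      congr 1
      exact congrArg (fun A : BH H => A η) hf.2.eq
  have hvn : ∀ i ζ, ‖v i ζ‖ = ‖f ζ‖ := by
    intro i ζ
    have h1 := qf_star_mul (v i) ζ
    rw [hvv, hf.qf] at h1
    exact ((sq_eq_sq₀ (norm_nonneg _) (norm_nonneg _)).1 h1).symm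
  have hv1 : ∀ i, ‖v i‖ ≤ 1 := fun i => (v i).opNorm_le_bound zero_le_one fun ζ => by
    rw [one_mul, hvn]; exact hf.norm_apply_le ζ
  obtain ⟨N, hN⟩ := exists_nat_gt (4 / δ)
  have hN' : (0 : ℝ) < N := lt_trans (by positivity) hN
  obtain ⟨m, hm⟩ := seq_indices (P := fun i m => ‖E (v m * star (v i)) (v i ξ)‖ < δ / (4 * N ^ 3)) fun i =>
    asymp hE hn hp v (fun m => h1M (hv m)) hf hvv hvo
      (fun m => by rw [← hpv m, ← mul_assoc, hpp0]) i (by rw [hvn, hfξ, hξ1]) (by positivity)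
  have := core_fam hE hBM1 h1M hπ he hee hΦ hF1 N (by exact_mod_cast hN') (fun i => v (m i)) (fun i => hv _) (fun i => hv1 _)
    hξ1.le (δ := δ) (τ := δ / (4 * N ^ 3)) (fun i j hij => (hm i j hij).le) (fun i => by
      have a := hlow (v (m i) ξ)
      have e1 : p0 (v (m i) ξ) = v (m i) ξ := congrArg (fun A : BH H => A ξ) (hpv (m i))
      have e2 : p (v (m i) ξ) = v (m i) ξ := by
        conv_rhs => rw [← e1, ← hpp0]
        rw [mul_apply_eq_comp, e1]
      have e3 := qf_conj p (Φ e) (v (m i) ξ)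
      rw [hp.1.1.star_eq, e2] at e3
      rw [e1, e3, hvn, hfξ, hξ1] at a
      simpa using a)
  have e : (N : ℝ) ^ 2 * (N * (δ / (4 * N ^ 3))) = δ / 4 := by field_simp
  rw [e] at this
  rw [div_lt_iff₀ hδ] at hN
  linarith
end P18
end Part18

section Part19
open Filter Topology
section P19
variable {H : Type*} [NormedAddCommGroup H] [InnerProductSpace ℂ H] [CompleteSpace H]
variable {L : Type*} [NormedAddCommGroup L] [InnerProductSpace ℂ L] [CompleteSpace L]
variable {M M₁ B Q : VonNeumannAlgebra H} {E F : BH H → BH H} {π : BH H → BH L} {Φ : BH L → BH H}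

lemma lin_zero {z w : ℂ} (h : ∀ t : ℝ, 0 ≤ z + (t : ℂ) * w) : w = 0 := by
  have h' : ∀ t : ℝ, 0 ≤ z.re + t * w.re ∧ 0 = z.im + t * w.im := fun t => by
    have := Complex.le_def.1 (h t); simpa using this
  have him : w.im = 0 := by
    have h0 := (h' 0).2
    have h1 := (h' 1).2
    linarith
  have hre : w.re = 0 := by
    by_contra hne
    have := (h' (-(z.re + 1) / w.re)).1
    rw [div_mul_cancel₀ _ hne] at this
    linarith
  exact Complex.ext hre him

lemma IsPhi.cs (hΦ : IsPhi M Q π F Φ) {e : BH L} (he : IsProjection e) (h0 : Φ e = 0) (T : BH L) :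
    Φ (e * T) = 0 ∧ Φ (star T * e) = 0 := by
  have hp : ∀ c : ℂ, 0 ≤ Φ (star T * T) + c • Φ (star T * e) + star c • Φ (e * T) := by
    intro c
    have h1 := hΦ.pos _ (star_mul_self_nonneg (T + c • e))
    have h2 : star (T + c • e) * (T + c • e) = star T * T + c • (star T * e) + star c • (e * T) + (star c * c) • e := by
      rw [star_add, star_smul, he.1.star_eq]
      simp only [add_mul, mul_add, smul_mul_assoc, mul_smul_comm, smul_smul]
      rw [he.2.eq]; simp only [smul_add, smul_smul, mul_comm c]; abel
    rw [h2, hΦ.add, hΦ.add, hΦ.add, hΦ.smul, hΦ.smul, hΦ.smul, h0, smul_zero, add_zero] at h1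
    exact h1
  have key : ∀ ξ, ⟪Φ (star T * e) ξ, ξ⟫_ℂ = 0 ∧ ⟪Φ (e * T) ξ, ξ⟫_ℂ = 0 := by
    intro ξ
    set z := ⟪Φ (star T * T) ξ, ξ⟫_ℂ with hz
    set y := ⟪Φ (star T * e) ξ, ξ⟫_ℂ with hy
    set x := ⟪Φ (e * T) ξ, ξ⟫_ℂ with hx
    have h3 : ∀ c : ℂ, 0 ≤ z + star c * y + c * x := by
      intro c
      have := inner_nonneg_of (hp c) ξ
      rw [add_apply, add_apply, smul_apply, smul_apply, inner_add_left, inner_add_left, inner_smul_left,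
        inner_smul_left, ← hx, ← hy, ← hz] at this
      simpa using this
    have h4 : y + x = 0 := lin_zero (z := z) fun t => by
      have := h3 (t : ℂ)
      have h5 : star (t : ℂ) = t := Complex.conj_ofReal t
      rw [h5] at this
      convert this using 1; ring
    have h6 : Complex.I * (x - y) = 0 := lin_zero (z := z) fun t => by
      have := h3 ((t : ℂ) * Complex.I)
      have h5 : star ((t : ℂ) * Complex.I) = - (t * Complex.I) := by
        change (starRingEnd ℂ) _ = _
        rw [map_mul, Complex.conj_ofReal, Complex.conj_I]; ring
      rw [h5] at this
      convert this using 1; ring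
    have h7 : x - y = 0 := (mul_eq_zero.1 h6).resolve_left Complex.I_ne_zero
    constructor
    · linear_combination (1/2 : ℂ) * h4 - (1/2 : ℂ) * h7
    · linear_combination (1/2 : ℂ) * h4 + (1/2 : ℂ) * h7
  constructor
  · have := (inner_map_self_eq_zero (Φ (e * T)).toLinearMap).1 fun ξ => (key ξ).2
    ext ξ; exact congrArg (fun A : H →ₗ[ℂ] H => A ξ) this
  · have := (inner_map_self_eq_zero (Φ (star T * e)).toLinearMap).1 fun ξ => (key ξ).1
    ext ξ; exact congrArg (fun A : H →ₗ[ℂ] H => A ξ) this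

lemma IsPhi.comp {F1 : BH H → BH H} (hΦ : IsPhi M Q π F Φ) (hQM : (Q : Set (BH H)) ⊆ M)
    (h1Q : (M₁ : Set (BH H)) ⊆ Q)
    (hF1 : IsCondExp (M : Set (BH H)) (M₁ : Set (BH H)) F1) :
    IsPhi M M₁ π (fun x => F1 (F x)) (fun T => F1 (Φ T)) where
  mem T := hF1.maps_to _ (hQM (hΦ.mem T))
  add S T := by rw [hΦ.add, hF1.map_add _ (hQM (hΦ.mem _)) _ (hQM (hΦ.mem _))]
  smul c T := by rw [hΦ.smul, hF1.map_smul _ _ (hQM (hΦ.mem _))]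
  pos T hT := hF1.pos _ (hQM (hΦ.mem T)) (hΦ.pos T hT)
  bimod a ha b hb T := by rw [hΦ.bimod a (h1Q ha) b (h1Q hb), hF1.bimod a ha b hb _ (hQM (hΦ.mem _))]
  map x hx := by rw [hΦ.map x hx]

theorem final {M₂ : VonNeumannAlgebra H} (hA : IsAFP M M₁ M₂ B E)
    (hB : IsSemifiniteVN (B : Set (BH H))) (hIII : IsTypeIII (M₁ : Set (BH H)))
    (hQM : (Q : Set (BH H)) ⊆ (M : Set (BH H)))
    (hQexp : WithExpectation (M : Set (BH H)) (Q : Set (BH H)))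
    (hQamen : IsAmenableVN (Q : Set (BH H)))
    (h1Q : (M₁ : Set (BH H)) ⊆ (Q : Set (BH H))) :
    (Q : Set (BH H)) = (M₁ : Set (BH H)) := by
  have hE := hA.condExp
  have h1M := hA.le₁M
  obtain ⟨L, i1, i2, i3, V, π, hr, hi, ha, ht⟩ := kolm hE hA.normal
  have hk : IsKolm M E V π := ⟨hr, hi, ha, ht⟩
  have hf : ∀ x ∈ M, π x = 0 → x = 0 := fun x hx h0 => kolm_faithful hE hA.faithful hi ha hx h0
  have hE1 : IsCondExp (M₁ : Set (BH H)) (B : Set (BH H)) E :=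
    { subset := hA.le₁
      map_add := fun x hx y hy => hE.map_add x (h1M hx) y (h1M hy)
      map_smul := fun c x hx => hE.map_smul c x (h1M hx)
      maps_to := fun x hx => hE.maps_to x (h1M hx)
      fixes := hE.fixes
      pos := fun x hx => hE.pos x (h1M hx)
      bimod := fun a ha b hb x hx => hE.bimod a ha b hb x (h1M hx) }
  have hn1 : IsNormalOn (M₁ : Set (BH H)) E := fun S hS hne hd x hx hl =>
    hA.normal S (hS.trans h1M) hne hd x (h1M hx) hl
  have hfa1 : FaithfulOn (M₁ : Set (BH H)) E := fun x hx => hA.faithful x (h1M hx)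
  obtain ⟨L1, j1, j2, j3, V1, π1, hr1, hi1, ha1, ht1⟩ := kolm hE1 hn1
  have hk1 : IsKolm M₁ E V1 π1 := ⟨hr1, hi1, ha1, ht1⟩
  obtain ⟨F1, hF1, hF1f⟩ := exists_F1 hA hk hk1 fun x hx h0 => kolm_faithful hE1 hfa1 hi1 ha1 hx h0
  obtain ⟨EQ, hQ, hQf, hQn⟩ := hQexp
  obtain ⟨LQ, k1, k2, k3, VQ, πQ, hrQ, hiQ, haQ, htQ⟩ := kolm hQ hQn
  have hkQ : IsKolm M EQ VQ πQ := ⟨hrQ, hiQ, haQ, htQ⟩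
  obtain ⟨Φ₀, hΦ₀⟩ := hQamen
  obtain ⟨Φ, hΦ⟩ := exists_Phi hQ hr hf hkQ hΦ₀
  obtain ⟨e, he, -, hee, her⟩ := exists_e hA hk
  have hcore := core hE hA.normal hA.le₁ h1M hB hIII hr he hee (hΦ.comp hQM h1Q hF1)
    (by rw [ce_one hQ, ce_one hF1])
  have he0 : Φ e = 0 := hF1f _ (hQM (hΦ.mem e)) (hΦ.pos e he.nonneg) hcore
  have hR : ∀ r, R22 M₁ M₂ E r → EQ r = 0 := by
    intro r hr'
    have h1 : π r = e * (π r * (1 - e)) + star (star (π r)) * e := by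
      rw [← mul_assoc, her r hr', star_star, mul_sub, mul_one, sub_add_cancel]
    rw [← hΦ.map r (hr'.mem hA), h1, hΦ.add, (hΦ.cs he he0 _).1, (hΦ.cs he he0 _).2, add_zero]
  have hW : ∀ w ∈ Wd M₁ M₂ E, EQ w ∈ M₁ := by
    rintro w (hw | ⟨a, b, r, ha', hb', hr', rfl⟩)
    · rw [hQ.fixes w (h1Q hw)]; exact hw
    · rw [hQ.bimod a (h1Q ha') b (h1Q hb') r (hr'.mem hA), hR r hr', mul_zero, zero_mul]
      exact zero_mem M₁
  have hv : ∀ x ∈ M, ∀ ξ η, ⟪VQ 1 η, πQ x (VQ 1 ξ)⟫_ℂ = ⟪η, EQ x ξ⟫_ℂ := by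
    intro x hx ξ η
    rw [haQ x hx 1 (one_mem M), mul_one, hiQ 1 (one_mem M) x hx, mul_one, ce_star hQ hx, star_inner]
  have hall : ∀ x ∈ M, EQ x ∈ M₁ := by
    intro x hx
    refine mem_of_comm M₁ fun t ht => ?_
    ext ξ
    refine ext_inner_left ℂ fun η => ?_
    rw [mul_apply_eq_comp, mul_apply_eq_comp, ← star_inner, ← hv x hx, ← hv x hx]
    refine lemmaW2 hA.generated hrQ hA.le₁M hA.le₂M (Wd_sub hA) Wd_one (Wd_mul hA) _ _ _ _ ?_ hx
    intro w hw
    have hwM := Wd_sub hA hw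
    rw [hv w hwM, hv w hwM, star_inner, ← mul_apply_eq_comp, ← mul_apply_eq_comp, comm_of_mem (hW w hw) ht]
  refine Set.Subset.antisymm (fun q hq => ?_) h1Q
  rw [← hQ.fixes q hq]
  exact hall q (hQM hq)
end P19
end Part19

/-- If `M = M₁ *_B M₂` is an amalgamated free product of σ-finite von Neumann algebras,
`B` is semifinite and `M₁` is amenable and of type III, then `M₁` is maximal amenable
with expectation inside `M`. -/
theorem maximal_amenable_typeIII_amalgam
    {H : Type*} [NormedAddCommGroup H] [InnerProductSpace ℂ H] [CompleteSpace H]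
    (M M₁ M₂ B : VonNeumannAlgebra H) (E : BH H → BH H)
    (hAFP : IsAFP M M₁ M₂ B E)
    (hσB : SigmaFinite (B : Set (BH H))) (hσ₁ : SigmaFinite (M₁ : Set (BH H)))
    (hσ₂ : SigmaFinite (M₂ : Set (BH H))) (hσM : SigmaFinite (M : Set (BH H)))
    (hBsemifinite : IsSemifiniteVN (B : Set (BH H)))
    (hM₁amen : IsAmenableVN (M₁ : Set (BH H)))
    (hM₁III : IsTypeIII (M₁ : Set (BH H)))
    (Q : VonNeumannAlgebra H) (hQM : (Q : Set (BH H)) ⊆ (M : Set (BH H)))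
    (hQexp : WithExpectation (M : Set (BH H)) (Q : Set (BH H)))
    (hQamen : IsAmenableVN (Q : Set (BH H)))
    (hM₁Q : (M₁ : Set (BH H)) ⊆ (Q : Set (BH H))) :
    (Q : Set (BH H)) = (M₁ : Set (BH H)) := by
  exact final hAFP hBsemifinite hM₁III hQM hQexp hQamen hM₁Q

end AFP
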